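/- Let (R, 𝔪) be a Noetherian local ring with dim R > 0 and R/𝔪 infinite, let I be a proper ideal, let M be a finitely generated R-module, let d be a positive integer with dim_R M ≤ d, and let 1 ≤ i < d. Then for general elements a_1, …, a_i of I one has dim_R(M/((a_1, …, a_i)M :_M I^∞)) ≤ d−i and j_d(I, M) = j_{d−i}(I, M/((a_1, …, a_i)M :_M I^∞)). -/

import Mathlib

open Filter

noncomputable section

/-- The length of a module, as the height of `⊤` in the submodule lattice. -/
def mLength (R M : Type*) [CommRing R] [AddCommGroup M] [Module R M] : ℕ∞ :=
  Order.height (⊤ : Submodule R M)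

/-- The Krull dimension of a module, via the annihilator. -/
def mDim (R M : Type*) [CommRing R] [AddCommGroup M] [Module R M] : WithBot ℕ∞ :=
  ringKrullDim (R ⧸ Module.annihilator R M)

/-- `H⁰_I(N)`: elements killed by a power of `I` (0-th local cohomology). -/
def H0 {R : Type*} [CommRing R] (I : Ideal R) (N : Type*) [AddCommGroup N] [Module R N] :
    Submodule R N :=
  ⨆ n : ℕ, Submodule.torsionBySet R N ((I ^ n : Ideal R) : Set R)

/-- `IⁿM/I^{n+1}M`, as a submodule of `M/I^{n+1}M`. -/
def gradedPiece {R : Type*} [CommRing R] (I : Ideal R) {M : Type*} [AddCommGroup M]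
    [Module R M] (n : ℕ) : Submodule R (M ⧸ (I ^ (n + 1) • ⊤ : Submodule R M)) :=
  Submodule.map (I ^ (n + 1) • ⊤ : Submodule R M).mkQ (I ^ n • ⊤ : Submodule R M)

/-- The `j`-multiplicity `j_d(I, M)`, defined as
`lim_n (d−1)!/n^(d−1) · length_R (H⁰_𝔪(IⁿM/I^{n+1}M))`. -/
def jMult {R : Type*} [CommRing R] (𝔪 I : Ideal R) (M : Type*) [AddCommGroup M]
    [Module R M] (d : ℕ) : ℝ :=
  limUnder atTop fun n : ℕ =>
    ((d - 1).factorial : ℝ) / (n : ℝ) ^ (d - 1) *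
      ((mLength R (H0 𝔪 (gradedPiece I (M := M) n))).toNat : ℝ)

/-- The Hilbert–Samuel multiplicity `e(I; N)` of a `d`-dimensional module `N`
(equal to `0` if `N = 0`), defined as `lim_n d!/n^d · length_R (N/IⁿN)`. -/
def hsMult {R : Type*} [CommRing R] (I : Ideal R) (N : Type*) [AddCommGroup N]
    [Module R N] (d : ℕ) : ℝ :=
  limUnder atTop fun n : ℕ =>
    (d.factorial : ℝ) / (n : ℝ) ^ d *
      ((mLength R (N ⧸ (I ^ n • ⊤ : Submodule R N))).toNat : ℝ)

/-- `K :_M I^∞ = ⋃ₙ (K :_M Iⁿ)`. -/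
def satur {R : Type*} [CommRing R] (I : Ideal R) {M : Type*} [AddCommGroup M] [Module R M]
    (K : Submodule R M) : Submodule R M :=
  Submodule.comap K.mkQ (H0 I (M ⧸ K))

/-- "For general elements `a₁, …, aᵢ` of `I`", i.e. for all `i`-tuples of elements of `I`
whose coefficient vectors with respect to any finite generating set of `I` avoid the zero
locus of some nonzero polynomial over the residue field `R/𝔪` (equivalently, whose images
lie in a suitable nonempty Zariski-open set of choices modulo `𝔪I`), property `P` holds. -/
def GeneralElts {R : Type*} [CommRing R] (𝔪 I : Ideal R) (i : ℕ)
    (P : (Fin i → R) → Prop) : Prop :=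
  ∀ (m : ℕ) (x : Fin m → R), Ideal.span (Set.range x) = I →
    ∃ F : MvPolynomial (Fin i × Fin m) R,
      MvPolynomial.map (Ideal.Quotient.mk 𝔪) F ≠ 0 ∧
      ∀ c : Fin i × Fin m → R,
        MvPolynomial.eval (fun p => Ideal.Quotient.mk 𝔪 (c p))
          (MvPolynomial.map (Ideal.Quotient.mk 𝔪) F) ≠ 0 →
        P fun j => ∑ l, c (j, l) * x l

universe u v w

set_option linter.unusedSectionVars false

/-- The vanishing of `Tor₁(D/𝔫, C)`, phrased through presentations of `C`. -/
def TorAt {D : Type u} [CommRing D] (𝔫 : Ideal D) (C : Type w) [AddCommGroup C] [Module D C] :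
    Prop :=
  ∀ (B : Type w) [AddCommGroup B] [Module D B] (f : B →ₗ[D] C), Function.Surjective f →
    ∀ u ∈ LinearMap.ker f, u ∈ (𝔫 • ⊤ : Submodule D B) → u ∈ 𝔫 • LinearMap.ker f

namespace TorAt

variable {D : Type u} [CommRing D] {𝔫 : Ideal D} {C : Type w} [AddCommGroup C] [Module D C]

theorem of_equiv {C' : Type w} [AddCommGroup C'] [Module D C'] (e : C ≃ₗ[D] C')
    (h : TorAt 𝔫 C) : TorAt 𝔫 C' := by
  intro B _ _ f hf u hu hu'
  have hk : LinearMap.ker (e.symm.toLinearMap.comp f) = LinearMap.ker f := by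
    ext; simp
  have := h B (e.symm.toLinearMap.comp f) (e.symm.surjective.comp hf) u (hk ▸ hu) hu'
  rwa [hk] at this

theorem of_submodule {B : Type w} [AddCommGroup B] [Module D B] {C' : Submodule D C}
    (h : TorAt 𝔫 C') (f : B →ₗ[D] C) (hf : Function.Surjective f) {u : B}
    (hu : u ∈ LinearMap.ker f) (hu' : u ∈ 𝔫 • C'.comap f) : u ∈ 𝔫 • LinearMap.ker f := by
  set B' := C'.comap f
  let f' : B' →ₗ[D] C' := (f.comp B'.subtype).codRestrict C' fun x => x.2
  have hf' : Function.Surjective f' := by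
    rintro ⟨y, hy⟩
    obtain ⟨b, rfl⟩ := hf y
    exact ⟨⟨b, hy⟩, rfl⟩
  have hsub : (𝔫 • ⊤ : Submodule D B').map B'.subtype = 𝔫 • B' := by
    rw [Submodule.map_smul'']; simp
  rw [← hsub] at hu'
  obtain ⟨v, hv, rfl⟩ := hu'
  have h1 := h B' f' hf' v (by
    rw [LinearMap.mem_ker]; exact Subtype.ext hu) hv
  have h2 := Submodule.mem_map_of_mem (f := B'.subtype) h1
  rw [Submodule.map_smul''] at h2
  refine Submodule.smul_mono le_rfl ?_ h2
  rintro _ ⟨z, hz, rfl⟩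
  exact congrArg Subtype.val (LinearMap.mem_ker.1 hz)

theorem extension (C' : Submodule D C) (h1 : TorAt 𝔫 C') (h2 : TorAt 𝔫 (C ⧸ C')) :
    TorAt 𝔫 C := by
  intro B _ _ f hf u hu hu'
  refine h1.of_submodule f hf hu ?_
  have hk : LinearMap.ker (C'.mkQ.comp f) = C'.comap f := by
    rw [LinearMap.ker_comp, Submodule.ker_mkQ]
  rw [← hk]
  refine h2 B (C'.mkQ.comp f) (C'.mkQ_surjective.comp hf) u ?_ hu'
  rw [hk, Submodule.mem_comap, LinearMap.mem_ker.1 hu]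
  exact C'.zero_mem

theorem union (L : ℕ → Submodule D C) (hm : Monotone L) (hL : ∀ x, ∃ n, x ∈ L n)
    (h : ∀ n, TorAt 𝔫 (L n)) : TorAt 𝔫 C := by
  intro B _ _ f hf u hu hu'
  have : ∀ v ∈ (𝔫 • ⊤ : Submodule D B), ∃ n, v ∈ 𝔫 • (L n).comap f := by
    intro v hv
    induction hv using Submodule.smul_induction_on' with
    | smul r hr n hn =>
      obtain ⟨k, hk⟩ := hL (f n)
      exact ⟨k, Submodule.smul_mem_smul hr hk⟩
    | add x hx y hy hx' hy' =>
      obtain ⟨k, hk⟩ := hx'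
      obtain ⟨l, hl⟩ := hy'
      refine ⟨max k l, Submodule.add_mem _ ?_ ?_⟩
      · exact Submodule.smul_mono le_rfl (Submodule.comap_mono (hm (le_max_left _ _))) hk
      · exact Submodule.smul_mono le_rfl (Submodule.comap_mono (hm (le_max_right _ _))) hl
  obtain ⟨n, hn⟩ := this u hu'
  exact (h n).of_submodule f hf hu hn

theorem of_projective [Module.Projective D C] : TorAt 𝔫 C := by
  intro B _ _ f hf u hu hu'
  obtain ⟨s, hs⟩ := Module.projective_lifting_property f LinearMap.id hf
  let π : B →ₗ[D] B := LinearMap.id - s.comp f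
  have hπ : π u = u := by
    simp [π, LinearMap.mem_ker.1 hu]
  have h1 := Submodule.mem_map_of_mem (f := π) hu'
  rw [Submodule.map_smul'', hπ] at h1
  refine Submodule.smul_mono le_rfl ?_ h1
  rintro _ ⟨z, -, rfl⟩
  have : f (s (f z)) = f z := LinearMap.congr_fun hs (f z)
  simp [π, this]

theorem of_smul_eq_zero [h𝔫 : 𝔫.IsMaximal] {g : D} (hg : g ∉ 𝔫) (h : ∀ x : C, g • x = 0) :
    TorAt 𝔫 C := by
  intro B _ _ f hf u hu hu'
  obtain ⟨y, z, hz, e⟩ := h𝔫.exists_inv hg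
  have e1 : u = y • (g • u) + z • u := by rw [smul_smul, ← add_smul, e, one_smul]
  rw [e1]
  refine add_mem (Submodule.smul_mem _ _ ?_) (Submodule.smul_mem_smul hz hu)
  have h1 := Submodule.mem_map_of_mem (f := LinearMap.lsmul D B g) hu'
  rw [Submodule.map_smul''] at h1
  refine Submodule.smul_mono le_rfl ?_ h1
  rintro _ ⟨z, -, rfl⟩
  simp [h]

theorem step {Q : Type w} [AddCommGroup Q] [Module D Q] (g : Q →ₗ[D] C) {C₁ C₂ : Submodule D C}
    (hC : C₂ = C₁ ⊔ LinearMap.range g) (h1 : TorAt 𝔫 C₁) (h2 : TorAt 𝔫 (Q ⧸ C₁.comap g)) :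
    TorAt 𝔫 C₂ := by
  have hle : C₁ ≤ C₂ := hC ▸ le_sup_left
  have hg : ∀ q, g q ∈ C₂ := fun q => hC ▸ Submodule.mem_sup_right ⟨q, rfl⟩
  refine extension (C₁.submoduleOf C₂) (h1.of_equiv (Submodule.submoduleOfEquivOfLe hle).symm) ?_
  let φ : Q →ₗ[D] C₂ ⧸ C₁.submoduleOf C₂ :=
    (C₁.submoduleOf C₂).mkQ.comp (g.codRestrict C₂ hg)
  have hφk : LinearMap.ker φ = C₁.comap g := by
    ext q
    rw [LinearMap.ker_comp, Submodule.ker_mkQ]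
    rfl
  have hφ : Function.Surjective φ := by
    intro y
    obtain ⟨⟨y, hy⟩, rfl⟩ := (C₁.submoduleOf C₂).mkQ_surjective y
    have hy' := hy
    rw [hC] at hy'
    obtain ⟨a, ha, b, ⟨q, rfl⟩, rfl⟩ := Submodule.mem_sup.1 hy'
    refine ⟨q, ?_⟩
    simp only [φ, LinearMap.comp_apply, Submodule.mkQ_apply]
    rw [Submodule.Quotient.eq]
    simp [Submodule.submoduleOf, ha]
  exact h2.of_equiv ((Submodule.quotEquivOfEq _ _ hφk.symm).trans
    (φ.quotKerEquivOfSurjective hφ))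

end TorAt

/-- Generic vanishing of `Tor₁(D/𝔫, C)` for all finite `S`-modules `C`. -/
def GenericTor (D : Type u) (S : Type v) [CommRing D] [CommRing S] [Algebra D S] : Prop :=
  ∀ (C : Type w) [AddCommGroup C] [Module S C] [Module D C] [IsScalarTower D S C]
    [Module.Finite S C], ∃ g : D, g ≠ 0 ∧ ∀ 𝔫 : Ideal D, 𝔫.IsMaximal → g ∉ 𝔫 → TorAt 𝔫 C

namespace GenericTor

theorem base_aux (D : Type u) [CommRing D] [IsDomain D] [IsNoetherianRing D]
    (C : Type w) [AddCommGroup C] [Module D C] [hC : Module.Finite D C] :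
    ∃ g : D, g ≠ 0 ∧ ∀ 𝔫 : Ideal D, 𝔫.IsMaximal → g ∉ 𝔫 → TorAt 𝔫 C := by
  induction hC using IsNoetherianRing.induction_on_isQuotientEquivQuotientPrime D with
  | subsingleton N =>
    refine ⟨1, one_ne_zero, fun 𝔫 h𝔫 h => ?_⟩
    exact TorAt.of_smul_eq_zero h fun x => Subsingleton.elim _ _
  | quotient N p e =>
    by_cases hp : p.1 = ⊥
    · refine ⟨1, one_ne_zero, fun 𝔫 h𝔫 h => ?_⟩
      have e' : N ≃ₗ[D] D := e.trans (Submodule.quotEquivOfEqBot _ hp)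
      have : Module.Projective D N := Module.Projective.of_equiv e'.symm
      exact TorAt.of_projective
    · obtain ⟨g, hg, hg0⟩ := Submodule.exists_mem_ne_zero_of_ne_bot hp
      refine ⟨g, hg0, fun 𝔫 h𝔫 h => ?_⟩
      refine TorAt.of_smul_eq_zero h fun x => ?_
      apply e.injective
      rw [map_smul, map_zero]
      obtain ⟨y, hy⟩ := Ideal.Quotient.mk_surjective (e x)
      rw [← hy, Algebra.smul_def, Ideal.Quotient.algebraMap_eq, ← map_mul,
        Ideal.Quotient.eq_zero_iff_mem]
      exact Ideal.mul_mem_right _ _ hg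
  | exact N₁ N₂ N₃ f g hf hg hfg h1 h3 =>
    obtain ⟨g1, hg1, h1⟩ := h1
    obtain ⟨g3, hg3, h3⟩ := h3
    refine ⟨g1 * g3, mul_ne_zero hg1 hg3, fun 𝔫 h𝔫 h => ?_⟩
    have a1 := h1 𝔫 h𝔫 fun h' => h (Ideal.mul_mem_right _ _ h')
    have a3 := h3 𝔫 h𝔫 fun h' => h (Ideal.mul_mem_left _ _ h')
    refine TorAt.extension (LinearMap.range f) (a1.of_equiv (LinearEquiv.ofInjective f hf)) ?_
    exact a3.of_equiv ((Submodule.quotEquivOfEq _ _ (LinearMap.exact_iff.1 hfg).symm).trans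
      (g.quotKerEquivOfSurjective hg)).symm

theorem base (D : Type u) [CommRing D] [IsDomain D] [IsNoetherianRing D] :
    GenericTor.{u, u, w} D D := by
  intro C _ i1 i2 ht hf
  obtain rfl : i1 = i2 := by
    refine Module.ext' _ _ fun r x => ?_
    have h := ht.smul_assoc r (1 : D) x
    rw [smul_eq_mul, mul_one] at h
    rw [h]
    congr 1
    exact @one_smul D C _ i1.toMulAction x
  exact base_aux D C

open Polynomial in
theorem polynomial {D : Type u} {S : Type v} [CommRing D] [IsDomain D] [CommRing S] [Algebra D S]
    [IsNoetherianRing S] (h : GenericTor.{u, v, w} D S) : GenericTor.{u, v, w} D S[X] := by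
  intro C _ _ _ _ hfin
  let _ : Module S C := Module.compHom C (Polynomial.C : S →+* S[X])
  have hs : ∀ (s : S) (x : C), s • x = (Polynomial.C s) • x := fun _ _ => rfl
  have : IsScalarTower D S C := ⟨fun d s x => by
    rw [hs, hs, ← smul_assoc, Polynomial.smul_C]⟩
  obtain ⟨t, ht⟩ := hfin.fg_top
  let L0 : Submodule S C := Submodule.span S (t : Set C)
  have : Module.Finite S L0 := Module.Finite.span_finset S t
  let Xn : ℕ → C →ₗ[S] C := fun n =>
    { toFun := fun x => (X ^ n : S[X]) • x
      map_add' := fun x y => smul_add _ x y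
      map_smul' := fun s x => by
        simp only [hs, smul_smul, RingHom.id_apply, mul_comm] }
  have hXn : ∀ n x, Xn n x = (X ^ n : S[X]) • x := fun _ _ => rfl
  obtain ⟨Lf, hLf0, hLf⟩ : ∃ Lf : ℕ → Submodule S C, Lf 0 = ⊥ ∧
      ∀ n, Lf (n + 1) = Lf n ⊔ L0.map (Xn n) :=
    ⟨fun n => Nat.rec ⊥ (fun n L => L ⊔ L0.map (Xn n)) n, rfl, fun n => rfl⟩
  have hmono : Monotone Lf := monotone_nat_of_le_succ fun n => by rw [hLf]; exact le_sup_left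
  have hX : ∀ n, (Lf n).map (Xn 1) ≤ Lf (n + 1) := by
    intro n
    induction n with
    | zero => rw [hLf0, Submodule.map_bot]; exact bot_le
    | succ n ih =>
      rw [hLf n, Submodule.map_sup, hLf (n + 1)]
      refine sup_le_sup ih ?_
      rw [← Submodule.map_comp]
      apply le_of_eq
      congr 1
      ext x
      simp only [LinearMap.comp_apply, hXn, smul_smul]
      congr 1
      ring
  have hXk : ∀ k n x, x ∈ Lf n → (X ^ k : S[X]) • x ∈ Lf (n + k) := by
    intro k
    induction k with
    | zero => intro n x hx; simpa using hx
    | succ k ih =>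
      intro n x hx
      have := hX (n + k) (Submodule.mem_map_of_mem (ih n x hx))
      rw [hXn, smul_smul, ← pow_add, add_comm 1 k] at this
      exact this
  have hun : ∀ x, ∃ n, x ∈ Lf n := by
    intro x
    have hx : x ∈ Submodule.span S[X] (t : Set C) := ht ▸ Submodule.mem_top
    induction hx using Submodule.span_induction with
    | mem x hx =>
      refine ⟨1, ?_⟩
      rw [← zero_add 1, hLf 0]
      refine Submodule.mem_sup_right ⟨x, Submodule.subset_span hx, ?_⟩
      rw [hXn, pow_zero, one_smul]
    | zero => exact ⟨0, zero_mem _⟩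
    | add x y _ _ hx hy =>
      obtain ⟨k, hk⟩ := hx
      obtain ⟨l, hl⟩ := hy
      exact ⟨max k l, add_mem (hmono (le_max_left _ _) hk) (hmono (le_max_right _ _) hl)⟩
    | smul p x _ hx =>
      obtain ⟨k, hk⟩ := hx
      induction p using Polynomial.induction_on' with
      | add p q hp hq =>
        obtain ⟨k, hk⟩ := hp
        obtain ⟨l, hl⟩ := hq
        exact ⟨max k l, by
          rw [add_smul]
          exact add_mem (hmono (le_max_left _ _) hk) (hmono (le_max_right _ _) hl)⟩
      | monomial n a =>
        refine ⟨k + n, ?_⟩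
        rw [← C_mul_X_pow_eq_monomial, mul_smul, ← hs]
        exact Submodule.smul_mem _ _ (hXk n k x hk)
  let A : ℕ → Submodule S L0 := fun n => (Lf n).comap ((Xn n).comp L0.subtype)
  have hA : Monotone A := monotone_nat_of_le_succ fun n x hx => by
    have h1 : (X ^ n : S[X]) • (x : C) ∈ Lf n := hx
    have h2 := hXk 1 n _ h1
    rw [smul_smul, ← pow_add, add_comm 1 n] at h2
    exact h2
  obtain ⟨N, hN⟩ := monotone_stabilizes_iff_noetherian.2
    (inferInstance : IsNoetherian S L0) ⟨A, hA⟩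
  have hg : ∀ n, ∃ g : D, g ≠ 0 ∧ ∀ 𝔫 : Ideal D, 𝔫.IsMaximal → g ∉ 𝔫 → TorAt 𝔫 (L0 ⧸ A n) :=
    fun n => h (L0 ⧸ A n)
  choose g hg0 hgT using hg
  refine ⟨∏ n ∈ Finset.range (N + 1), g n, Finset.prod_ne_zero_iff.2 fun n _ => hg0 n,
    fun 𝔫 h𝔫 hn => ?_⟩
  have hgn : ∀ n, n ≤ N → g n ∉ 𝔫 := fun n hn' hmem => hn
    (Ideal.mem_of_dvd _ (Finset.dvd_prod_of_mem g (Finset.mem_range.2 (Nat.lt_succ_of_le hn'))) hmem)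
  have hT : ∀ n, TorAt 𝔫 (L0 ⧸ A n) := by
    intro n
    rcases le_total n N with hle | hle
    · exact hgT n 𝔫 h𝔫 (hgn n hle)
    · have : A N = A n := hN n hle
      rw [← this]
      exact hgT N 𝔫 h𝔫 (hgn N le_rfl)
  refine TorAt.union (fun n => (Lf n).restrictScalars D)
    (fun a b hab => hmono hab) hun fun n => ?_
  induction n with
  | zero =>
    have h0 : TorAt 𝔫 (⊥ : Submodule D C) :=
      TorAt.of_smul_eq_zero (fun h' => h𝔫.ne_top ((Ideal.eq_top_iff_one _).2 h'))
        fun x => Subsingleton.elim _ _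
    have h1 : (Lf 0).restrictScalars D = ⊥ := by rw [hLf0]; rfl
    rw [h1]
    exact h0
  | succ n ih =>
    refine TorAt.step (((Xn n).comp L0.subtype).restrictScalars D) ?_ ih ?_
    · ext x
      rw [Submodule.restrictScalars_mem, hLf, Submodule.mem_sup, Submodule.mem_sup]
      simp
    · exact (hT n).of_equiv (Submodule.Quotient.restrictScalarsEquiv D (A n)).symm

theorem of_surjective {D : Type u} {S S' : Type*} [CommRing D] [CommRing S] [Algebra D S]
    [CommRing S'] [Algebra D S'] (f : S →ₐ[D] S') (hf : Function.Surjective f)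
    (h : GenericTor.{_, _, w} D S) : GenericTor.{_, _, w} D S' := by
  intro C _ _ _ _ _
  let _ : Module S C := Module.compHom C f.toRingHom
  have hs : ∀ (s : S) (x : C), s • x = f s • x := fun _ _ => rfl
  have : IsScalarTower D S C := ⟨fun d s x => by
    rw [hs, hs, map_smul, smul_assoc]⟩
  have : Module.Finite S C := by
    obtain ⟨t, ht⟩ := ‹Module.Finite S' C›.fg_top
    refine ⟨t, top_le_iff.1 fun x _ => ?_⟩
    have hx : x ∈ Submodule.span S' (t : Set C) := ht ▸ Submodule.mem_top
    induction hx using Submodule.span_induction with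
    | mem x hx => exact Submodule.subset_span hx
    | zero => exact zero_mem _
    | add x y _ _ hx hy => exact add_mem (hx trivial) (hy trivial)
    | smul a x _ hx =>
      obtain ⟨a, rfl⟩ := hf a
      exact Submodule.smul_mem _ a (hx trivial)
  exact h C

theorem mvPolynomial (D : Type u) [CommRing D] [IsDomain D] [IsNoetherianRing D] (n : ℕ) :
    GenericTor.{u, u, w} D (MvPolynomial (Fin n) D) := by
  induction n with
  | zero =>
    exact of_surjective (MvPolynomial.isEmptyAlgEquiv D (Fin 0)).symm.toAlgHom
      (MvPolynomial.isEmptyAlgEquiv D (Fin 0)).symm.surjective (base D)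
  | succ n ih =>
    refine of_surjective ((MvPolynomial.finSuccEquiv D n).symm.toAlgHom)
      (MvPolynomial.finSuccEquiv D n).symm.surjective ih.polynomial

theorem of_finiteType (D : Type u) (S : Type v) [CommRing D] [IsDomain D] [IsNoetherianRing D]
    [CommRing S] [Algebra D S] [Algebra.FiniteType D S] : GenericTor.{u, v, w} D S := by
  obtain ⟨n, f, hf⟩ := Algebra.FiniteType.iff_quotient_mvPolynomial''.1
    ‹Algebra.FiniteType D S›
  exact of_surjective f hf (mvPolynomial D n)

end GenericTor

section GenericCombination

open TensorProduct

theorem Ideal.map_smul_mem_aux {D : Type u} {S : Type v} [CommRing D] [CommRing S] [Algebra D S]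
    {B : Type w} [AddCommGroup B] [Module S B] [Module D B] [IsScalarTower D S B] (𝔫 : Ideal D)
    (N : Submodule S B) (u : B) :
    u ∈ 𝔫.map (algebraMap D S) • N ↔ u ∈ 𝔫 • N.restrictScalars D := by
  rw [← Ideal.smul_restrictScalars, Submodule.restrictScalars_mem]

/-- If `a` is regular on `B`, then it is regular on `B/𝔫B` for all `𝔫` in a nonempty open set. -/
theorem exists_generic_regular {D : Type u} {S : Type v} [CommRing D] [IsDomain D]
    [IsNoetherianRing D] [CommRing S] [Algebra D S] [Algebra.FiniteType D S]
    {B : Type w} [AddCommGroup B] [Module S B] [Module.Finite S B] (a : S)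
    (ha : ∀ w : B, a • w = 0 → w = 0) :
    ∃ g : D, g ≠ 0 ∧ ∀ 𝔫 : Ideal D, 𝔫.IsMaximal → g ∉ 𝔫 → ∀ w : B,
      a • w ∈ (𝔫.map (algebraMap D S) • ⊤ : Submodule S B) →
      w ∈ (𝔫.map (algebraMap D S) • ⊤ : Submodule S B) := by
  let _ : Module D B := Module.compHom B (algebraMap D S)
  have : IsScalarTower D S B := IsScalarTower.of_algebraMap_smul fun _ _ => rfl
  let P : Submodule S B := LinearMap.range (LinearMap.lsmul S B a)
  obtain ⟨g, hg, h⟩ := GenericTor.of_finiteType D S (B ⧸ P)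
  refine ⟨g, hg, fun 𝔫 h𝔫 hg𝔫 w hw => ?_⟩
  have hk : LinearMap.ker (P.mkQ.restrictScalars D) = P.restrictScalars D := by
    ext; simp
  have h1 := h 𝔫 h𝔫 hg𝔫 B (P.mkQ.restrictScalars D) P.mkQ_surjective (a • w)
    (by rw [hk]; exact ⟨w, rfl⟩) (by
      rw [Ideal.map_smul_mem_aux] at hw
      exact hw)
  rw [hk, ← Ideal.map_smul_mem_aux] at h1
  have h2 : 𝔫.map (algebraMap D S) • P =
      (𝔫.map (algebraMap D S) • ⊤ : Submodule S B).map (LinearMap.lsmul S B a) := by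
    rw [Submodule.map_smul'', Submodule.map_top]
  rw [h2] at h1
  obtain ⟨w', hw', e⟩ := h1
  have : w' - w = 0 := ha _ (by rw [smul_sub]; exact sub_eq_zero.2 e)
  rwa [← sub_eq_zero.1 this]

section Generic

variable {S : Type v} [CommRing S] {N : Type w} [AddCommGroup N] [Module S N] {m : ℕ}

/-- The generic linear combination `∑ Xₗ xₗ`. -/
noncomputable def genericComb (x : Fin m → S) : MvPolynomial (Fin m) S :=
  ∑ l, MvPolynomial.X l * MvPolynomial.C (x l)

/-- The coefficients of an element of `S[X] ⊗ N`. -/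
noncomputable def tensorCoeff :
    MvPolynomial (Fin m) S ⊗[S] N ≃ₗ[S] (Fin m →₀ ℕ) →₀ N :=
  TensorProduct.equivFinsuppOfBasisLeft (MvPolynomial.basisMonomials (Fin m) S)

theorem tensorCoeff_tmul (p : MvPolynomial (Fin m) S) (n : N) (e : Fin m →₀ ℕ) :
    tensorCoeff (p ⊗ₜ[S] n) e = p.coeff e • n := by
  rw [tensorCoeff, TensorProduct.equivFinsuppOfBasisLeft_apply_tmul_apply]
  rfl

theorem coeff_X_mul_C_smul (w : MvPolynomial (Fin m) S ⊗[S] N) (l : Fin m) (s : S)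
    (e : Fin m →₀ ℕ) :
    tensorCoeff ((MvPolynomial.X l * MvPolynomial.C s) • w) e =
      if l ∈ e.support then s • tensorCoeff w (e - Finsupp.single l 1) else 0 := by
  induction w using TensorProduct.induction_on with
  | zero => simp
  | add w w' h h' =>
    rw [smul_add, map_add, Finsupp.add_apply, h, h', map_add, Finsupp.add_apply]
    split_ifs <;> simp
  | tmul p n =>
    rw [TensorProduct.smul_tmul', tensorCoeff_tmul, tensorCoeff_tmul, smul_eq_mul, mul_assoc,
      MvPolynomial.coeff_X_mul', MvPolynomial.coeff_C_mul]
    split_ifs <;> simp [mul_smul]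

theorem genericComb_smul_injective (x : Fin m → S)
    (hN : ∀ u : N, (∀ l, ∃ r : ℕ, x l ^ r • u = 0) → u = 0)
    (w : MvPolynomial (Fin m) S ⊗[S] N) (hw : genericComb x • w = 0) : w = 0 := by
  apply tensorCoeff.injective
  rw [map_zero]
  set f := tensorCoeff w with hf
  have hrel : ∀ e : Fin m →₀ ℕ,
      ∑ l, (if l ∈ e.support then x l • f (e - Finsupp.single l 1) else 0) = 0 := by
    intro e
    have h := congrArg (fun z => tensorCoeff z e) hw
    simp only [genericComb, Finset.sum_smul, map_sum, Finsupp.finsetSum_apply,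
      coeff_X_mul_C_smul, map_zero, Finsupp.zero_apply] at h
    exact h
  ext e
  refine hN _ fun l₀ => ?_
  let M := f.support.sup fun e => e l₀
  have key : ∀ k : ℕ, ∀ e : Fin m →₀ ℕ, M < e l₀ + k → x l₀ ^ k • f e = 0 := by
    intro k
    induction k with
    | zero =>
      intro e he
      by_contra hne
      rw [pow_zero, one_smul] at hne
      have : e l₀ ≤ M := Finset.le_sup (f := fun e : Fin m →₀ ℕ => e l₀)
        (Finsupp.mem_support_iff.2 hne)
      omega
    | succ k ih =>
      intro e he
      have h := congrArg (fun z => x l₀ ^ k • z) (hrel (e + Finsupp.single l₀ 1))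
      simp only [smul_zero, Finset.smul_sum] at h
      rw [Finset.sum_eq_single l₀] at h
      · rw [if_pos (by simp), add_tsub_cancel_right, smul_smul, ← pow_succ] at h
        exact h
      · intro l _ hl
        split_ifs
        · rw [smul_comm, ih, smul_zero]
          simp [hl]
          omega
        · exact smul_zero _
      · simp
  exact ⟨M + 1, key _ e (by omega)⟩

/-- Specialization of the variables at `c`. -/
noncomputable def specialize (c : Fin m → S) : MvPolynomial (Fin m) S ⊗[S] N →ₗ[S] N :=
  (TensorProduct.lid S N).toLinearMap ∘ₗ (MvPolynomial.aeval c).toLinearMap.rTensor N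

theorem specialize_tmul (c : Fin m → S) (p : MvPolynomial (Fin m) S) (n : N) :
    specialize c (p ⊗ₜ[S] n) = MvPolynomial.eval c p • n := by
  simp [specialize, MvPolynomial.aeval_eq_eval]

theorem specialize_smul (c : Fin m → S) (p : MvPolynomial (Fin m) S)
    (w : MvPolynomial (Fin m) S ⊗[S] N) :
    specialize c (p • w) = MvPolynomial.eval c p • specialize c w := by
  induction w using TensorProduct.induction_on with
  | zero => simp
  | add w w' h h' => rw [smul_add, map_add, h, h', map_add, smul_add]
  | tmul q n => rw [TensorProduct.smul_tmul', specialize_tmul, specialize_tmul, smul_eq_mul,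
      map_mul, mul_smul]

theorem eval_genericComb (x c : Fin m → S) :
    MvPolynomial.eval c (genericComb x) = ∑ l, c l * x l := by
  simp [genericComb]

attribute [local instance] MvPolynomial.algebraMvPolynomial

variable {D : Type u} [CommRing D] [Algebra D S]

theorem genericComb_sub_mem (x : Fin m → S) (c : Fin m → D) (𝔫 : Ideal D) :
    genericComb x - MvPolynomial.C (∑ l, algebraMap D S (c l) * x l) ∈
      (𝔫.comap (MvPolynomial.eval c)).map
        (algebraMap (MvPolynomial (Fin m) D) (MvPolynomial (Fin m) S)) := by
  have : genericComb x - MvPolynomial.C (∑ l, algebraMap D S (c l) * x l) =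
      ∑ l, algebraMap (MvPolynomial (Fin m) D) (MvPolynomial (Fin m) S)
        (MvPolynomial.X l - MvPolynomial.C (c l)) * MvPolynomial.C (x l) := by
    simp only [genericComb, map_sum, ← Finset.sum_sub_distrib, map_mul, map_sub, sub_mul,
      MvPolynomial.algebraMap_def, MvPolynomial.map_X, MvPolynomial.map_C]
  rw [this]
  refine Ideal.sum_mem _ fun l _ => Ideal.mul_mem_right _ _ (Ideal.mem_map_of_mem _ ?_)
  simp [Ideal.mem_comap]

theorem one_tmul_mem (c : Fin m → D) (𝔫 : Ideal D) {u : N}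
    (hu : u ∈ (𝔫.map (algebraMap D S) • ⊤ : Submodule S N)) :
    (1 : MvPolynomial (Fin m) S) ⊗ₜ[S] u ∈ ((𝔫.comap (MvPolynomial.eval c)).map
      (algebraMap (MvPolynomial (Fin m) D) (MvPolynomial (Fin m) S)) • ⊤ :
        Submodule (MvPolynomial (Fin m) S) (MvPolynomial (Fin m) S ⊗[S] N)) := by
  induction hu using Submodule.smul_induction_on' with
  | smul r hr n hn =>
    have e : (1 : MvPolynomial (Fin m) S) ⊗ₜ[S] (r • n) =
        (MvPolynomial.C r : MvPolynomial (Fin m) S) • (1 ⊗ₜ[S] n) := by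
      rw [TensorProduct.smul_tmul', ← TensorProduct.smul_tmul, smul_eq_mul, mul_one,
        ← mul_one (MvPolynomial.C r), MvPolynomial.C_mul', ]
    rw [e]
    refine Submodule.smul_mem_smul ?_ trivial
    have h : 𝔫.map (algebraMap D S) ≤ ((𝔫.comap (MvPolynomial.eval c)).map
      (algebraMap (MvPolynomial (Fin m) D) (MvPolynomial (Fin m) S))).comap MvPolynomial.C := by
      rw [Ideal.map_le_iff_le_comap]
      intro d hd
      have hd' : algebraMap (MvPolynomial (Fin m) D) (MvPolynomial (Fin m) S)
        (MvPolynomial.C d) = MvPolynomial.C (algebraMap D S d) := by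
        rw [MvPolynomial.algebraMap_def, MvPolynomial.map_C]
      rw [Ideal.mem_comap, Ideal.mem_comap, ← hd']
      exact Ideal.mem_map_of_mem _ (by simpa using hd)
    exact h hr
  | add x _ y _ hx hy => rw [TensorProduct.tmul_add]; exact add_mem hx hy

theorem specialize_mem (c : Fin m → D) (𝔫 : Ideal D) {w : MvPolynomial (Fin m) S ⊗[S] N}
    (hw : w ∈ ((𝔫.comap (MvPolynomial.eval c)).map
      (algebraMap (MvPolynomial (Fin m) D) (MvPolynomial (Fin m) S)) • ⊤ :
        Submodule (MvPolynomial (Fin m) S) (MvPolynomial (Fin m) S ⊗[S] N))) :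
    specialize (fun l => algebraMap D S (c l)) w ∈
      (𝔫.map (algebraMap D S) • ⊤ : Submodule S N) := by
  induction hw using Submodule.smul_induction_on' with
  | smul r hr n hn =>
    rw [specialize_smul]
    refine Submodule.smul_mem_smul ?_ trivial
    have h : (𝔫.comap (MvPolynomial.eval c)).map
        (algebraMap (MvPolynomial (Fin m) D) (MvPolynomial (Fin m) S)) ≤
        (𝔫.map (algebraMap D S)).comap (MvPolynomial.eval fun l => algebraMap D S (c l)) := by
      rw [Ideal.map_le_iff_le_comap]
      intro p hp
      rw [Ideal.mem_comap, Ideal.mem_comap, MvPolynomial.algebraMap_def]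
      have : MvPolynomial.eval (fun l => algebraMap D S (c l))
          (MvPolynomial.map (algebraMap D S) p) = algebraMap D S (MvPolynomial.eval c p) := by
        rw [MvPolynomial.eval_map, MvPolynomial.eval₂_comp]
        rfl
      rw [this]
      exact Ideal.mem_map_of_mem _ hp
    exact h hr
  | add x _ y _ hx hy => rw [map_add]; exact add_mem hx hy

end Generic

end GenericCombination

section FilterRegular

open TensorProduct

attribute [local instance] MvPolynomial.algebraMvPolynomial

theorem smul_tmul_eq_sub_add {S : Type v} [CommRing S] {N : Type w} [AddCommGroup N] [Module S N]
    {m : ℕ} (p : MvPolynomial (Fin m) S) (s : S) (w : MvPolynomial (Fin m) S ⊗[S] N) :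
    p • w = (p - MvPolynomial.C s) • w + s • w := by
  have h : (MvPolynomial.C s : MvPolynomial (Fin m) S) • w = s • w :=
    algebraMap_smul (MvPolynomial (Fin m) S) s w
  rw [← h, ← add_smul, sub_add_cancel]

theorem generic_step_bot {D : Type u} {S : Type v} [CommRing D] [IsDomain D]
    [IsNoetherianRing D] [CommRing S] [Algebra D S] [Algebra.FiniteType D S]
    {L : Type w} [AddCommGroup L] [Module S L] [Module.Finite S L] {m : ℕ} (x : Fin m → S) :
    ∃ g : MvPolynomial (Fin m) D, g ≠ 0 ∧ ∀ 𝔫 : Ideal D, 𝔫.IsMaximal → ∀ c : Fin m → D,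
      MvPolynomial.eval c g ∉ 𝔫 → ∀ u : L,
        (∑ l, algebraMap D S (c l) * x l) • u ∈ (𝔫.map (algebraMap D S) • ⊤ : Submodule S L) →
        ∀ l, ∃ r : ℕ, x l ^ r • u ∈ (𝔫.map (algebraMap D S) • ⊤ : Submodule S L) := by
  let Γ : Submodule S L :=
    { carrier := {u | ∀ l, ∃ r : ℕ, x l ^ r • u = 0}
      zero_mem' := fun l => ⟨0, smul_zero _⟩
      add_mem' := by
        intro u v hu hv l
        obtain ⟨r, hr⟩ := hu l
        obtain ⟨s, hs⟩ := hv l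
        refine ⟨r + s, ?_⟩
        rw [smul_add, pow_add, mul_smul (x l ^ r) _ v, hs, mul_comm, mul_smul, hr, smul_zero,
          smul_zero, add_zero]
      smul_mem' := by
        intro s u hu l
        obtain ⟨r, hr⟩ := hu l
        exact ⟨r, by rw [smul_comm, hr, smul_zero]⟩ }
  have hΓ : ∀ u : L ⧸ Γ, (∀ l, ∃ r : ℕ, x l ^ r • u = 0) → u = 0 := by
    intro u hu
    obtain ⟨u, rfl⟩ := Γ.mkQ_surjective u
    rw [Submodule.mkQ_apply, Submodule.Quotient.mk_eq_zero]
    intro l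
    obtain ⟨r, hr⟩ := hu l
    rw [← map_smul, Submodule.mkQ_apply, Submodule.Quotient.mk_eq_zero] at hr
    obtain ⟨s, hs⟩ := hr l
    exact ⟨s + r, by rw [pow_add, mul_smul, hs]⟩
  have : Algebra.FiniteType D (MvPolynomial (Fin m) S) :=
    Algebra.FiniteType.trans (S := S) ‹_› inferInstance
  have : Algebra.FiniteType (MvPolynomial (Fin m) D) (MvPolynomial (Fin m) S) :=
    Algebra.FiniteType.of_restrictScalars_finiteType D _ _
  obtain ⟨g, hg, h⟩ := exists_generic_regular (D := MvPolynomial (Fin m) D)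
    (B := MvPolynomial (Fin m) S ⊗[S] (L ⧸ Γ)) (genericComb x)
    (genericComb_smul_injective x hΓ)
  refine ⟨g, hg, fun 𝔫 h𝔫 c hc u hu l => ?_⟩
  have hmax : (𝔫.comap (MvPolynomial.eval c)).IsMaximal :=
    Ideal.comap_isMaximal_of_surjective _ fun d => ⟨MvPolynomial.C d, MvPolynomial.eval_C _⟩
  have hu1 : (∑ l, algebraMap D S (c l) * x l) • Γ.mkQ u ∈
      (𝔫.map (algebraMap D S) • ⊤ : Submodule S (L ⧸ Γ)) := by
    rw [← map_smul]
    have := Submodule.mem_map_of_mem (f := Γ.mkQ) hu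
    rw [Submodule.map_smul''] at this
    exact Submodule.smul_mono le_rfl le_top this
  have hu2 : genericComb x • ((1 : MvPolynomial (Fin m) S) ⊗ₜ[S] Γ.mkQ u) ∈
      ((𝔫.comap (MvPolynomial.eval c)).map
      (algebraMap (MvPolynomial (Fin m) D) (MvPolynomial (Fin m) S)) • ⊤ :
        Submodule (MvPolynomial (Fin m) S) (MvPolynomial (Fin m) S ⊗[S] (L ⧸ Γ))) := by
    have e : genericComb x • ((1 : MvPolynomial (Fin m) S) ⊗ₜ[S] Γ.mkQ u) =
      (genericComb x - MvPolynomial.C (∑ l, algebraMap D S (c l) * x l)) •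
        ((1 : MvPolynomial (Fin m) S) ⊗ₜ[S] Γ.mkQ u) +
        (1 : MvPolynomial (Fin m) S) ⊗ₜ[S] ((∑ l, algebraMap D S (c l) * x l) • Γ.mkQ u) := by
      rw [TensorProduct.tmul_smul]
      exact smul_tmul_eq_sub_add _ _ _
    rw [e]
    exact add_mem (Submodule.smul_mem_smul (genericComb_sub_mem x c 𝔫) trivial)
      (one_tmul_mem c 𝔫 hu1)
  have hu3 := specialize_mem c 𝔫 (h _ hmax hc _ hu2)
  rw [specialize_tmul, map_one, one_smul] at hu3
  have hmap : (𝔫.map (algebraMap D S) • ⊤ : Submodule S (L ⧸ Γ)) =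
      (𝔫.map (algebraMap D S) • ⊤ : Submodule S L).map Γ.mkQ := by
    rw [Submodule.map_smul'', Submodule.map_top, Submodule.range_mkQ]
  rw [hmap] at hu3
  obtain ⟨v, hv, e⟩ := hu3
  have hvu : u - v ∈ Γ := by
    rw [← Submodule.Quotient.mk_eq_zero, ← Submodule.mkQ_apply, map_sub, e, sub_self]
  obtain ⟨r, hr⟩ := hvu l
  rw [smul_sub, sub_eq_zero] at hr
  exact ⟨r, hr ▸ Submodule.smul_mem _ _ hv⟩

/-- The submodule `aL`. -/
def mulTop {S : Type*} (L : Type*) [CommRing S] [AddCommGroup L] [Module S L] (a : S) :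
    Submodule S L :=
  LinearMap.range (LinearMap.lsmul S L a)

theorem mem_mulTop {S : Type*} {L : Type*} [CommRing S] [AddCommGroup L] [Module S L] {a : S}
    {u : L} : u ∈ mulTop L a ↔ ∃ v : L, a • v = u := Iff.rfl

/-- `as` is a filter-regular sequence on `L/K` with respect to the ideal generated by `x`. -/
def FiltSeq {S L : Type*} [CommRing S] [AddCommGroup L] [Module S L] {m : ℕ} (x : Fin m → S) :
    Submodule S L → List S → Prop
  | _, [] => True
  | K, a :: as => (∀ u : L, a • u ∈ K → ∀ l, ∃ r : ℕ, x l ^ r • u ∈ K) ∧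
      FiltSeq x (K ⊔ mulTop L a) as

theorem FiltSeq.of_surjective {S S' L L' : Type*} [CommRing S] [AddCommGroup L] [Module S L]
    [CommRing S'] [AddCommGroup L'] [Module S' L'] {m : ℕ} (x : Fin m → S) (ρ : S →+* S')
    (φ : L →+ L') (hφ : Function.Surjective φ) (h : ∀ (a : S) (u : L), φ (a • u) = ρ a • φ u)
    (as : List S) (K : Submodule S L) (K' : Submodule S' L') (hK : ∀ u, u ∈ K ↔ φ u ∈ K')
    (hs : FiltSeq (fun l => ρ (x l)) K' (as.map ρ)) : FiltSeq x K as := by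
  induction as generalizing K K' with
  | nil => trivial
  | cons a as ih =>
    refine ⟨fun u hu l => ?_, ih _ _ (fun u => ?_) hs.2⟩
    · obtain ⟨r, hr⟩ := hs.1 (φ u) (by rw [← h, ← hK]; exact hu) l
      exact ⟨r, by rw [hK, h, map_pow]; exact hr⟩
    · rw [Submodule.mem_sup, Submodule.mem_sup]
      constructor
      · rintro ⟨y, hy, _, ⟨v, rfl⟩, rfl⟩
        exact ⟨φ y, (hK y).1 hy, _, ⟨φ v, rfl⟩, by
          rw [map_add, LinearMap.lsmul_apply, LinearMap.lsmul_apply, h]⟩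
      · rintro ⟨y, hy, _, ⟨v, rfl⟩, e⟩
        obtain ⟨v, rfl⟩ := hφ v
        rw [LinearMap.lsmul_apply, ← h] at e
        refine ⟨u - a • v, ?_, a • v, ⟨v, rfl⟩, sub_add_cancel _ _⟩
        rw [hK, map_sub, ← e, add_sub_cancel_right]
        exact hy

theorem FiltSeq.of_retract {S S' L L' : Type*} [CommRing S] [AddCommGroup L] [Module S L]
    [CommRing S'] [AddCommGroup L'] [Module S' L'] {m : ℕ} (x : Fin m → S) (ρ : S →+* S')
    (φ : L →+ L') (ψ : L' →+ L) (hφψ : ∀ u, ψ (φ u) = u)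
    (h : ∀ (a : S) (u : L), φ (a • u) = ρ a • φ u)
    (h' : ∀ (a : S) (u : L'), ψ (ρ a • u) = a • ψ u)
    (as : List S) (K : Submodule S L) (K' : Submodule S' L') (hK : ∀ u ∈ K, φ u ∈ K')
    (hK' : ∀ u ∈ K', ψ u ∈ K)
    (hs : FiltSeq (fun l => ρ (x l)) K' (as.map ρ)) : FiltSeq x K as := by
  induction as generalizing K K' with
  | nil => trivial
  | cons a as ih =>
    refine ⟨fun u hu l => ?_, ih _ _ (fun u hu => ?_) (fun u hu => ?_) hs.2⟩
    · obtain ⟨r, hr⟩ := hs.1 (φ u) (by rw [← h]; exact hK _ hu) l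
      refine ⟨r, ?_⟩
      have := hK' _ hr
      rwa [← map_pow, h', hφψ] at this
    · obtain ⟨y, hy, _, ⟨v, rfl⟩, rfl⟩ := Submodule.mem_sup.1 hu
      rw [map_add, LinearMap.lsmul_apply, h]
      exact add_mem (Submodule.mem_sup_left (hK _ hy)) (Submodule.mem_sup_right ⟨φ v, rfl⟩)
    · obtain ⟨y, hy, _, ⟨v, rfl⟩, rfl⟩ := Submodule.mem_sup.1 hu
      rw [map_add, LinearMap.lsmul_apply, h']
      exact add_mem (Submodule.mem_sup_left (hK' _ hy)) (Submodule.mem_sup_right ⟨ψ v, rfl⟩)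

theorem mem_sup_smul_top_iff {S L : Type*} [CommRing S] [AddCommGroup L] [Module S L]
    (K : Submodule S L) (J : Ideal S) (u : L) :
    u ∈ K ⊔ J • ⊤ ↔ K.mkQ u ∈ (J • ⊤ : Submodule S (L ⧸ K)) := by
  have : (J • ⊤ : Submodule S (L ⧸ K)) = (J • ⊤ : Submodule S L).map K.mkQ := by
    rw [Submodule.map_smul'', Submodule.map_top, Submodule.range_mkQ]
  rw [this, ← Submodule.mem_comap, Submodule.comap_map_mkQ]

theorem generic_step {D : Type u} {S : Type v} [CommRing D] [IsDomain D]
    [IsNoetherianRing D] [CommRing S] [Algebra D S] [Algebra.FiniteType D S]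
    {L : Type w} [AddCommGroup L] [Module S L] [Module.Finite S L] (K : Submodule S L)
    {m : ℕ} (x : Fin m → S) :
    ∃ g : MvPolynomial (Fin m) D, g ≠ 0 ∧ ∀ 𝔫 : Ideal D, 𝔫.IsMaximal → ∀ c : Fin m → D,
      MvPolynomial.eval c g ∉ 𝔫 → ∀ u : L,
        (∑ l, algebraMap D S (c l) * x l) • u ∈ K ⊔ 𝔫.map (algebraMap D S) • ⊤ →
        ∀ l, ∃ r : ℕ, x l ^ r • u ∈ K ⊔ 𝔫.map (algebraMap D S) • ⊤ := by
  obtain ⟨g, hg, h⟩ := generic_step_bot (D := D) (L := L ⧸ K) x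
  refine ⟨g, hg, fun 𝔫 h𝔫 c hc u hu l => ?_⟩
  rw [mem_sup_smul_top_iff, map_smul] at hu
  obtain ⟨r, hr⟩ := h 𝔫 h𝔫 c hc _ hu l
  exact ⟨r, by rw [mem_sup_smul_top_iff, map_smul]; exact hr⟩

theorem generic_filtSeq (m i : ℕ) : ∀ (D : Type u) (S : Type v) [CommRing D] [IsDomain D]
    [IsNoetherianRing D] [CommRing S] [Algebra D S] [Algebra.FiniteType D S]
    (L : Type (max v w)) [AddCommGroup L] [Module S L] [Module.Finite S L] (K : Submodule S L)
    (x : Fin m → S),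
    ∃ F : MvPolynomial (Fin i × Fin m) D, F ≠ 0 ∧ ∀ 𝔫 : Ideal D, 𝔫.IsMaximal →
      ∀ c : Fin i × Fin m → D, MvPolynomial.eval c F ∉ 𝔫 →
        FiltSeq x (K ⊔ 𝔫.map (algebraMap D S) • ⊤)
          (List.ofFn fun j => ∑ l, algebraMap D S (c (j, l)) * x l) := by
  induction i with
  | zero =>
    intro D S _ _ _ _ _ _ L _ _ _ K x
    exact ⟨1, one_ne_zero, fun 𝔫 _ c _ => by rw [List.ofFn_zero]; trivial⟩
  | succ i ih =>
    intro D S _ _ _ _ _ _ L _ _ _ K x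
    obtain ⟨g, hg, hstep⟩ := generic_step (D := D) K x
    have : Algebra.FiniteType D (MvPolynomial (Fin m) S) :=
      Algebra.FiniteType.trans (S := S) ‹_› inferInstance
    have : Algebra.FiniteType (MvPolynomial (Fin m) D) (MvPolynomial (Fin m) S) :=
      Algebra.FiniteType.of_restrictScalars_finiteType D _ _
    let φ : L →ₗ[S] MvPolynomial (Fin m) S ⊗[S] L := TensorProduct.mk S _ L 1
    let K' : Submodule (MvPolynomial (Fin m) S) (MvPolynomial (Fin m) S ⊗[S] L) :=
      Submodule.span _ (φ '' K) ⊔ mulTop _ (genericComb x)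
    obtain ⟨F', hF', hs⟩ := ih (MvPolynomial (Fin m) D) (MvPolynomial (Fin m) S)
      (MvPolynomial (Fin m) S ⊗[S] L) K' (fun l => MvPolynomial.C (x l))
    let e : (Fin i × Fin m) ⊕ Fin m → Fin (i + 1) × Fin m :=
      Sum.elim (fun p => (p.1.succ, p.2)) (fun l => (0, l))
    have he : Function.Injective e := by
      rintro (⟨j, l⟩ | l) (⟨j', l'⟩ | l') h <;> simp [e, Fin.succ_ne_zero] at h ⊢
      · exact h
      · exact absurd h.1.symm (Fin.succ_ne_zero _)
      · exact h
    let T := MvPolynomial.sumAlgEquiv D (Fin i × Fin m) (Fin m)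
    let F₁ : MvPolynomial (Fin (i + 1) × Fin m) D := MvPolynomial.rename e (T.symm F')
    have hF₁ : F₁ ≠ 0 := by
      intro h0
      apply hF'
      apply T.symm.injective
      apply MvPolynomial.rename_injective e he
      rw [map_zero, map_zero]
      exact h0
    have hi0 : Function.Injective fun l : Fin m => ((0 : Fin (i + 1)), l) :=
      fun a b h => (Prod.mk.inj h).2
    refine ⟨MvPolynomial.rename (fun l => (0, l)) g * F₁, mul_ne_zero ?_ hF₁, ?_⟩
    · intro h0
      exact hg (MvPolynomial.rename_injective _ hi0 (by rw [h0, map_zero]))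
    intro 𝔫 h𝔫 c hc
    let c₀ : Fin m → D := fun l => c (0, l)
    let c' : Fin i × Fin m → MvPolynomial (Fin m) D := fun p => MvPolynomial.C (c (p.1.succ, p.2))
    have hev : ∀ G : MvPolynomial ((Fin i × Fin m) ⊕ Fin m) D,
        MvPolynomial.eval (c ∘ e) G = MvPolynomial.eval c₀ (MvPolynomial.eval c' (T G)) := by
      intro G
      induction G using MvPolynomial.induction_on with
      | C a => simp [T]
      | add p q hp hq => simp only [map_add, hp, hq]
      | mul_X p i hp =>
        simp only [map_mul, hp]
        congr 1
        rcases i with p | l <;> simp [T, e, c', c₀]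
    have hF₁c : MvPolynomial.eval c F₁ = MvPolynomial.eval c₀ (MvPolynomial.eval c' F') := by
      rw [MvPolynomial.eval_rename, hev, AlgEquiv.apply_symm_apply]
    rw [map_mul, MvPolynomial.eval_rename, hF₁c] at hc
    have hc1 : MvPolynomial.eval c₀ g ∉ 𝔫 := fun h => hc (Ideal.mul_mem_right _ _ h)
    have hc2 : MvPolynomial.eval c' F' ∉ 𝔫.comap (MvPolynomial.eval c₀) :=
      fun h => hc (Ideal.mul_mem_left _ _ h)
    have hmax : (𝔫.comap (MvPolynomial.eval c₀)).IsMaximal :=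
      Ideal.comap_isMaximal_of_surjective _ fun d => ⟨MvPolynomial.C d, MvPolynomial.eval_C _⟩
    have hs' := hs _ hmax c' hc2
    rw [List.ofFn_succ]
    refine ⟨hstep 𝔫 h𝔫 c₀ hc1, ?_⟩
    let ψ := specialize (N := L) fun l => algebraMap D S (c₀ l)
    have hψφ : ∀ u, ψ (φ u) = u := fun u => by
      change specialize _ (1 ⊗ₜ[S] u) = u
      rw [specialize_tmul, map_one, one_smul]
    have hCsmul : ∀ (a : S) (w : MvPolynomial (Fin m) S ⊗[S] L),
        (MvPolynomial.C a : MvPolynomial (Fin m) S) • w = a • w := fun a w =>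
      algebraMap_smul (MvPolynomial (Fin m) S) a w
    refine FiltSeq.of_retract x MvPolynomial.C φ.toAddMonoidHom ψ.toAddMonoidHom hψφ ?_ ?_ _ _
      (K' ⊔ (𝔫.comap (MvPolynomial.eval c₀)).map
        (algebraMap (MvPolynomial (Fin m) D) (MvPolynomial (Fin m) S)) • ⊤) ?_ ?_ ?_
    · intro a u
      rw [hCsmul]
      exact map_smul φ a u
    · intro a u
      rw [hCsmul]
      exact map_smul ψ a u
    · intro u hu
      obtain ⟨y, hy, _, ⟨v, rfl⟩, rfl⟩ := Submodule.mem_sup.1 hu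
      obtain ⟨y, hyK, z, hz, rfl⟩ := Submodule.mem_sup.1 hy
      have hv : φ ((∑ l, algebraMap D S (c₀ l) * x l) • v) = genericComb x • φ v -
          (genericComb x - MvPolynomial.C (∑ l, algebraMap D S (c₀ l) * x l)) • φ v := by
        rw [map_smul, eq_sub_iff_add_eq, add_comm]
        exact (smul_tmul_eq_sub_add _ _ _).symm
      change φ _ ∈ _
      rw [LinearMap.lsmul_apply, map_add, map_add]
      refine add_mem (add_mem ?_ ?_) ?_
      · exact Submodule.mem_sup_left (Submodule.mem_sup_left
          (Submodule.subset_span ⟨y, hyK, rfl⟩))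
      · exact Submodule.mem_sup_right (one_tmul_mem c₀ 𝔫 hz)
      · erw [hv]
        exact sub_mem (Submodule.mem_sup_left (Submodule.mem_sup_right ⟨φ v, rfl⟩))
          (Submodule.mem_sup_right
            (Submodule.smul_mem_smul (genericComb_sub_mem x c₀ 𝔫) trivial))
    · intro u hu
      obtain ⟨y', hy', z, hz, rfl⟩ := Submodule.mem_sup.1 hu
      obtain ⟨y, hy, _, ⟨v, rfl⟩, rfl⟩ := Submodule.mem_sup.1 hy'
      clear hu hy'
      change ψ _ ∈ _
      rw [LinearMap.lsmul_apply, map_add, map_add]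
      refine add_mem (add_mem ?_ ?_) ?_
      · refine Submodule.mem_sup_left (Submodule.mem_sup_left ?_)
        induction hy using Submodule.span_induction with
        | mem y hy =>
          obtain ⟨y, hy, rfl⟩ := hy
          rw [hψφ]
          exact hy
        | zero => rw [map_zero]; exact zero_mem _
        | add y y' _ _ h h' => rw [map_add]; exact add_mem h h'
        | smul p y _ h =>
          rw [specialize_smul]
          exact Submodule.smul_mem _ _ h
      · refine Submodule.mem_sup_right ⟨ψ v, ?_⟩
        rw [LinearMap.lsmul_apply, specialize_smul, eval_genericComb]
      · exact Submodule.mem_sup_left (Submodule.mem_sup_right (specialize_mem c₀ 𝔫 hz))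
    · convert hs' using 1
      rw [List.map_ofFn]
      congr 1
      funext j
      simp only [Function.comp_apply, map_sum, map_mul, c', MvPolynomial.algebraMap_def,
        MvPolynomial.map_C]

/-- Generic tuples of linear combinations of `x` over a local ring form a filter-regular
sequence. -/
theorem exists_filtSeq_of_local {R : Type u} [CommRing R] [IsLocalRing R] {S : Type v} [CommRing S]
    [Algebra R S] [Algebra.FiniteType R S] {L : Type w} [AddCommGroup L] [Module S L]
    [Module.Finite S L] (K : Submodule S L)
    (hK : ∀ r ∈ IsLocalRing.maximalIdeal R, ∀ u : L, algebraMap R S r • u ∈ K)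
    (m i : ℕ) (x : Fin m → S) :
    ∃ F : MvPolynomial (Fin i × Fin m) R,
      MvPolynomial.map (Ideal.Quotient.mk (IsLocalRing.maximalIdeal R)) F ≠ 0 ∧
      ∀ c : Fin i × Fin m → R,
        MvPolynomial.eval (fun p => Ideal.Quotient.mk (IsLocalRing.maximalIdeal R) (c p))
          (MvPolynomial.map (Ideal.Quotient.mk (IsLocalRing.maximalIdeal R)) F) ≠ 0 →
        FiltSeq x K (List.ofFn fun j => ∑ l, algebraMap R S (c (j, l)) * x l) := by
  let 𝔪 := IsLocalRing.maximalIdeal R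
  let J : Ideal S := 𝔪.map (algebraMap R S)
  let _ : Field (R ⧸ 𝔪) := Ideal.Quotient.field 𝔪
  have hJ : ∀ s ∈ J, ∀ u : L, s • u ∈ K := by
    intro s hs u
    have : J ≤ (Ideal.comap (Ideal.Quotient.mk (Module.annihilator S (L ⧸ K))) ⊥) := by
      refine Ideal.map_le_iff_le_comap.2 fun r hr => ?_
      rw [Ideal.mem_comap, Ideal.mem_comap, Ideal.mem_bot, Ideal.Quotient.eq_zero_iff_mem,
        Module.mem_annihilator]
      intro u
      obtain ⟨u, rfl⟩ := K.mkQ_surjective u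
      rw [← map_smul, Submodule.mkQ_apply, Submodule.Quotient.mk_eq_zero]
      exact hK r hr u
    have h := this hs
    rw [Ideal.mem_comap, Ideal.mem_bot, Ideal.Quotient.eq_zero_iff_mem,
        Module.mem_annihilator] at h
    have h' := h (K.mkQ u)
    rwa [← map_smul, Submodule.mkQ_apply, Submodule.Quotient.mk_eq_zero] at h'
  have hT : Module.IsTorsionBySet S (L ⧸ K) J := by
    rintro u ⟨s, hs⟩
    obtain ⟨u, rfl⟩ := K.mkQ_surjective u
    rw [← map_smul, Submodule.mkQ_apply, Submodule.Quotient.mk_eq_zero]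
    exact hJ s hs u
  let _ : Module (S ⧸ J) (L ⧸ K) := hT.module
  have hmk : ∀ (s : S) (u : L ⧸ K), Ideal.Quotient.mk J s • u = s • u := fun _ _ => rfl
  have : IsScalarTower S (S ⧸ J) (L ⧸ K) := hT.isScalarTower
  have : Module.Finite (S ⧸ J) (L ⧸ K) := Module.Finite.of_restrictScalars_finite S _ _
  let _ : Algebra (R ⧸ 𝔪) (S ⧸ J) :=
    (Ideal.quotientMap J (algebraMap R S) Ideal.le_comap_map).toAlgebra
  have halg : ∀ r : R, algebraMap (R ⧸ 𝔪) (S ⧸ J) (Ideal.Quotient.mk 𝔪 r) =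
      Ideal.Quotient.mk J (algebraMap R S r) := fun r => rfl
  have : IsScalarTower R (R ⧸ 𝔪) (S ⧸ J) := IsScalarTower.of_algebraMap_eq fun r => rfl
  have : Algebra.FiniteType R (S ⧸ J) := Algebra.FiniteType.of_surjective
    (Ideal.Quotient.mkₐ R J) (Ideal.Quotient.mkₐ_surjective R J)
  have : Algebra.FiniteType (R ⧸ 𝔪) (S ⧸ J) := Algebra.FiniteType.of_restrictScalars_finiteType R _ _
  have : Module.Finite (S ⧸ J) (ULift.{v} (L ⧸ K)) :=
    Module.Finite.equiv (ULift.moduleEquiv (R := S ⧸ J) (M := L ⧸ K)).symm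
  obtain ⟨F, hF, h⟩ := generic_filtSeq.{u, v, w} m i (R ⧸ 𝔪) (S ⧸ J) (ULift.{v} (L ⧸ K)) ⊥
    (fun l => Ideal.Quotient.mk J (x l))
  obtain ⟨G, rfl⟩ := MvPolynomial.map_surjective _ (Ideal.Quotient.mk_surjective (I := 𝔪)) F
  refine ⟨G, hF, fun c hc => ?_⟩
  have hs := h ⊥ Ideal.bot_isMaximal (fun p => Ideal.Quotient.mk 𝔪 (c p)) (by rwa [Ideal.mem_bot])
  rw [Ideal.map_bot, Submodule.bot_smul, sup_bot_eq] at hs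
  let φ : L →+ ULift.{v} (L ⧸ K) :=
    (ULift.moduleEquiv (R := S ⧸ J) (M := L ⧸ K)).symm.toAddEquiv.toAddMonoidHom.comp
      K.mkQ.toAddMonoidHom
  refine FiltSeq.of_surjective x (Ideal.Quotient.mk J) φ ?_ ?_ _ K ⊥ ?_ ?_
  · rintro ⟨u⟩
    obtain ⟨u, rfl⟩ := K.mkQ_surjective u
    exact ⟨u, rfl⟩
  · intro a u
    rfl
  · intro u
    rw [← Submodule.Quotient.mk_eq_zero K, Submodule.mem_bot]
    exact ⟨fun h => congrArg ULift.up h, fun h => congrArg ULift.down h⟩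
  · convert hs using 1
    rw [List.map_ofFn]
    congr 1
    funext j
    simp only [Function.comp_apply, map_sum, map_mul]
    rfl

end FilterRegular

section Graded

theorem exists_algHom_of_commute {R A κ : Type*} [CommRing R] [Ring A] [Algebra R A] (f : κ → A)
    (hf : ∀ s t, f s * f t = f t * f s) :
    ∃ φ : MvPolynomial κ R →ₐ[R] A, ∀ t, φ (MvPolynomial.X t) = f t := by
  have hc : IsMulCommutative (Algebra.adjoin R (Set.range f)) :=
    Algebra.isMulCommutative_adjoin R (by
      rintro _ ⟨s, rfl⟩ _ ⟨t, rfl⟩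
      exact hf s t)
  let _ : CommRing (Algebra.adjoin R (Set.range f)) :=
    { (inferInstance : Ring (Algebra.adjoin R (Set.range f))) with
      mul_comm := hc.is_comm.comm }
  refine ⟨(Algebra.adjoin R (Set.range f)).val.comp
    (MvPolynomial.aeval fun t => ⟨f t, Algebra.subset_adjoin ⟨t, rfl⟩⟩), fun t => ?_⟩
  rw [AlgHom.comp_apply, MvPolynomial.aeval_X]
  rfl

variable {R : Type u} [CommRing R] {κ : Type*} {ι : Type*} [AddCommMonoid ι]

/-- The operator `r` followed by the shift by `δ`. -/
noncomputable def shiftOp (M : Type w) [AddCommGroup M] [Module R M] (r : R) (δ : ι) :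
    Module.End R (ι →₀ M) :=
  r • Finsupp.lmapDomain M R (· + δ)

theorem shiftOp_single {M : Type w} [AddCommGroup M] [Module R M] (r : R) (δ p : ι) (u : M) :
    shiftOp M r δ (Finsupp.single p u) = Finsupp.single (p + δ) (r • u) := by
  rw [shiftOp, LinearMap.smul_apply, Finsupp.lmapDomain_apply, Finsupp.mapDomain_single,
    Finsupp.smul_single]

theorem shiftOp_comm (M : Type w) [AddCommGroup M] [Module R M] (r s : R) (δ ε : ι) :
    shiftOp M r δ * shiftOp M s ε = shiftOp M s ε * shiftOp M r δ := by
  refine Finsupp.lhom_ext fun p u => ?_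
  simp only [Module.End.mul_apply, shiftOp_single]
  rw [smul_comm, add_right_comm]

/-- The graded module `⊕_p M`, on which the variable `X t` acts as `r t` and shifts by `δ t`. -/
def GrMod (_r : κ → R) (_δ : κ → ι) (M : Type w) [AddCommGroup M] : Type _ := ι →₀ M

namespace GrMod

variable {r : κ → R} {δ : κ → ι} {M : Type w} [AddCommGroup M] [Module R M]

noncomputable instance : AddCommGroup (GrMod r δ M) := inferInstanceAs (AddCommGroup (ι →₀ M))

/-- The action of polynomials. -/
noncomputable def action (r : κ → R) (δ : κ → ι) (M : Type w) [AddCommGroup M] [Module R M] :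
    MvPolynomial κ R →ₐ[R] Module.End R (ι →₀ M) :=
  (exists_algHom_of_commute (fun t => shiftOp M (r t) (δ t))
    fun _ _ => shiftOp_comm M _ _ _ _).choose

theorem action_X (t : κ) : action r δ M (MvPolynomial.X t) = shiftOp M (r t) (δ t) :=
  (exists_algHom_of_commute (fun t => shiftOp M (r t) (δ t))
    fun _ _ => shiftOp_comm M _ _ _ _).choose_spec t

noncomputable instance : Module (MvPolynomial κ R) (GrMod r δ M) :=
  Module.compHom (ι →₀ M) (action r δ M).toRingHom

/-- The homogeneous element `u` in degree `p`. -/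
noncomputable def of (r : κ → R) (δ : κ → ι) (p : ι) : M →+ GrMod r δ M :=
  Finsupp.singleAddHom p

/-- The component in degree `p`. -/
noncomputable def comp (p : ι) : GrMod r δ M →+ M := Finsupp.applyAddHom p

theorem smul_def (f : MvPolynomial κ R) (g : GrMod r δ M) : f • g = action r δ M f g := rfl

theorem C_smul_of (a : R) (p : ι) (u : M) :
    (MvPolynomial.C a : MvPolynomial κ R) • of r δ p u = of r δ p (a • u) := by
  rw [smul_def, ← MvPolynomial.algebraMap_eq, AlgHom.commutes]
  exact Finsupp.smul_single a p u

theorem X_smul_of (t : κ) (p : ι) (u : M) :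
    (MvPolynomial.X t : MvPolynomial κ R) • of r δ p u = of r δ (p + δ t) (r t • u) := by
  rw [smul_def, action_X]
  exact shiftOp_single _ _ _ _

theorem comp_of_same (p : ι) (u : M) : comp p (of r δ p u) = u := Finsupp.single_eq_same

theorem comp_of_ne {p q : ι} (h : q ≠ p) (u : M) : comp q (of r δ p u) = 0 :=
  Finsupp.single_eq_of_ne h

theorem induction_on {motive : GrMod r δ M → Prop} (f : GrMod r δ M) (zero : motive 0)
    (add : ∀ f g, motive f → motive g → motive (f + g)) (of : ∀ p u, motive (of r δ p u)) :
    motive f :=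
  Finsupp.induction_linear f zero add of

theorem mem_of_forall_comp_mem (T : AddSubmonoid (GrMod r δ M)) (f : GrMod r δ M)
    (h : ∀ p, of r δ p (comp p f) ∈ T) : f ∈ T := by
  have : f = (Finsupp.sum f fun p u => of r δ p u : GrMod r δ M) := (Finsupp.sum_single f).symm
  rw [this]
  exact T.sum_mem fun p _ => h p

/-- Elements with `p`-th component in `A p`. -/
noncomputable def fam (r : κ → R) (δ : κ → ι) (A : ι → Submodule R M)
    (hA : ∀ t p, ∀ u ∈ A p, r t • u ∈ A (p + δ t)) :
    Submodule (MvPolynomial κ R) (GrMod r δ M) where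
  carrier := {f | ∀ p, comp p f ∈ A p}
  add_mem' := fun {f g} hf hg p => by
    rw [map_add]
    exact add_mem (hf p) (hg p)
  zero_mem' := fun p => by
    rw [map_zero]
    exact zero_mem _
  smul_mem' := fun a f hf => by
    let T : AddSubmonoid (GrMod r δ M) :=
      { carrier := {f | ∀ p, comp p f ∈ A p}
        add_mem' := fun {f g} hf hg p => by
          rw [map_add]
          exact add_mem (hf p) (hg p)
        zero_mem' := fun p => by
          rw [map_zero]
          exact zero_mem _ }
    have hof : ∀ p, ∀ u ∈ A p, of r δ p u ∈ T := fun p u hu q => by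
      by_cases h : q = p
      · subst h
        rw [comp_of_same]
        exact hu
      · rw [comp_of_ne h]
        exact zero_mem _
    change a • f ∈ T
    induction a using MvPolynomial.induction_on generalizing f with
    | C a =>
      refine mem_of_forall_comp_mem
        (T.comap (DistribSMul.toAddMonoidHom _ (MvPolynomial.C a : MvPolynomial κ R))) f
        fun p => ?_
      change (MvPolynomial.C a : MvPolynomial κ R) • of r δ p (comp p f) ∈ T
      rw [C_smul_of]
      exact hof _ _ ((A p).smul_mem _ (hf p))
    | add a b ha hb =>
      rw [add_smul]
      exact T.add_mem (ha f hf) (hb f hf)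
    | mul_X a t ha =>
      rw [mul_smul]
      refine ha _ (mem_of_forall_comp_mem (f := f)
        (T := T.comap (DistribSMul.toAddMonoidHom _ (MvPolynomial.X t : MvPolynomial κ R)))
        fun p => ?_)
      change (MvPolynomial.X t : MvPolynomial κ R) • of r δ p (comp p f) ∈ T
      rw [X_smul_of]
      exact hof _ _ (hA t p _ (hf p))

variable {A : ι → Submodule R M} {hA : ∀ t p, ∀ u ∈ A p, r t • u ∈ A (p + δ t)}

theorem of_mem_fam {p : ι} {u : M} (hu : u ∈ A p) : of r δ p u ∈ fam r δ A hA := fun q => by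
  by_cases h : q = p
  · subst h
    rw [comp_of_same]
    exact hu
  · rw [comp_of_ne h]
    exact zero_mem _

theorem of_mem_smul {κ' : Type*} (g : κ' → κ) (e : ι) (he : ∀ k, δ (g k) = e)
    (T : Submodule (MvPolynomial κ R) (GrMod r δ M)) (p : ι) (N : Submodule R M)
    (h : ∀ u ∈ N, of r δ p u ∈ T) {u : M}
    (hu : u ∈ Ideal.span (Set.range fun k => r (g k)) • N) :
    of r δ (p + e) u ∈
      Ideal.span (Set.range fun k => (MvPolynomial.X (g k) : MvPolynomial κ R)) • T := by
  refine Submodule.smul_induction_on hu (fun a ha n hn => ?_) fun x y hx hy => ?_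
  · refine Submodule.span_induction (p := fun a _ => ∀ n ∈ N, of r δ (p + e) (a • n) ∈ _)
      ?_ ?_ ?_ ?_ ha n hn
    · rintro _ ⟨k, rfl⟩ n hn
      rw [← he k, ← X_smul_of]
      exact Submodule.smul_mem_smul (Submodule.subset_span ⟨k, rfl⟩) (h n hn)
    · intro n _
      rw [zero_smul, map_zero]
      exact zero_mem _
    · intro x y _ _ hx hy n hn
      rw [add_smul, map_add]
      exact add_mem (hx n hn) (hy n hn)
    · intro a x _ hx n hn
      rw [smul_eq_mul, mul_smul, ← C_smul_of]
      exact Submodule.smul_mem _ _ (hx n hn) |> fun h => by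
        rwa [C_smul_of, ← smul_assoc, smul_eq_mul, mul_comm, mul_smul] at h ⊢
  · rw [map_add]
    exact add_mem hx hy

theorem span_of_zero_fg [Module.Finite R M] :
    (Submodule.span (MvPolynomial κ R) (Set.range (of r δ (M := M) (0 : ι)))).FG := by
  obtain ⟨s, hs⟩ := Module.Finite.fg_top (R := R) (M := M)
  classical
  refine ⟨s.image (of r δ 0), le_antisymm (Submodule.span_mono ?_) (Submodule.span_le.2 ?_)⟩
  · intro _ h
    obtain ⟨u, _, rfl⟩ := Finset.mem_image.1 (Finset.mem_coe.1 h)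
    exact ⟨u, rfl⟩
  · rintro _ ⟨u, rfl⟩
    have hu : u ∈ Submodule.span R (s : Set M) := hs ▸ Submodule.mem_top
    refine Submodule.span_induction (p := fun u _ => of r δ 0 u ∈ _) ?_ ?_ ?_ ?_ hu
    · intro x hx
      exact Submodule.subset_span (Finset.mem_coe.2 (Finset.mem_image_of_mem _ hx))
    · rw [map_zero]
      exact zero_mem _
    · intro x y _ _ hx hy
      rw [map_add]
      exact add_mem hx hy
    · intro a x _ hx
      rw [← C_smul_of]
      exact Submodule.smul_mem _ _ hx

end GrMod

end Graded

section Good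

variable {R : Type u} [CommRing R]

/-- The submodule `𝔪^s I^n P + I^(n+1) P`. -/
def biE (𝔪 I : Ideal R) (P : Type w) [AddCommGroup P] [Module R P] (n s : ℕ) : Submodule R P :=
  𝔪 ^ s • (I ^ n • ⊤) ⊔ I ^ (n + 1) • ⊤

/-- The element `a` is, in large degrees, a nonzerodivisor on the bigraded module associated with
`I` and `𝔪`. -/
def GoodElt (𝔪 I : Ideal R) (P : Type w) [AddCommGroup P] [Module R P] (a : R) : Prop :=
  ∃ n₀ : ℕ, ∀ n, n₀ ≤ n → ∀ s, ∀ u ∈ (𝔪 ^ s • (I ^ n • ⊤) : Submodule R P),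
    a • u ∈ biE 𝔪 I P (n + 1) (s + 1) → u ∈ biE 𝔪 I P n (s + 1)

variable {𝔪 I : Ideal R} {P : Type w} [AddCommGroup P] [Module R P] {a : R}

theorem biE_zero (n : ℕ) : biE 𝔪 I P n 0 = I ^ n • ⊤ := by
  rw [biE, pow_zero, Ideal.one_eq_top, Submodule.top_smul]
  exact sup_eq_left.2 (Submodule.smul_mono_left (Ideal.pow_le_pow_right n.le_succ))

theorem biE_anti {n s t : ℕ} (h : s ≤ t) : biE 𝔪 I P n t ≤ biE 𝔪 I P n s :=
  sup_le_sup_right (Submodule.smul_mono_left (Ideal.pow_le_pow_right h)) _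

theorem biE_le (n s : ℕ) : biE 𝔪 I P n s ≤ I ^ n • ⊤ :=
  biE_zero (𝔪 := 𝔪) (I := I) (P := P) n ▸ biE_anti s.zero_le

theorem le_biE (n s : ℕ) : I ^ (n + 1) • ⊤ ≤ biE 𝔪 I P n s := le_sup_right

theorem smul_le_biE (n s : ℕ) : 𝔪 ^ s • (I ^ n • ⊤) ≤ biE 𝔪 I P n s := le_sup_left

theorem smul_mem_pow_smul (ha : a ∈ I) {n : ℕ} {u : P} (hu : u ∈ (I ^ n • ⊤ : Submodule R P)) :
    a • u ∈ (I ^ (n + 1) • ⊤ : Submodule R P) := by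
  rw [pow_succ', ← smul_eq_mul, Submodule.smul_assoc]
  exact Submodule.smul_mem_smul ha hu

theorem smul_mem_pow_smul_pow_smul (ha : a ∈ I) {n s : ℕ} {u : P}
    (hu : u ∈ (𝔪 ^ s • (I ^ n • ⊤) : Submodule R P)) :
    a • u ∈ (𝔪 ^ s • (I ^ (n + 1) • ⊤) : Submodule R P) := by
  have : (𝔪 ^ s • (I ^ (n + 1) • ⊤) : Submodule R P) = I • (𝔪 ^ s • (I ^ n • ⊤)) := by
    rw [← Submodule.mul_smul, ← Submodule.mul_smul, ← Submodule.mul_smul]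
    congr 1
    ring
  rw [this]
  exact Submodule.smul_mem_smul ha hu

theorem smul_mem_biE (ha : a ∈ I) {n s : ℕ} {u : P} (hu : u ∈ biE 𝔪 I P n s) :
    a • u ∈ biE 𝔪 I P (n + 1) s := by
  obtain ⟨y, hy, v, hv, rfl⟩ := Submodule.mem_sup.1 hu
  rw [smul_add]
  exact add_mem (smul_le_biE _ _ (smul_mem_pow_smul_pow_smul ha hy))
    (le_biE _ _ (smul_mem_pow_smul ha hv))

theorem map_biE {P' : Type*} [AddCommGroup P'] [Module R P'] (f : P →ₗ[R] P')
    (hf : Function.Surjective f) (n s : ℕ) : (biE 𝔪 I P n s).map f = biE 𝔪 I P' n s := by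
  rw [biE, biE, Submodule.map_sup, Submodule.map_smul'', Submodule.map_smul'',
    Submodule.map_smul'', Submodule.map_top, LinearMap.range_eq_top.2 hf]

theorem map_pow_smul_top {P' : Type*} [AddCommGroup P'] [Module R P'] (f : P →ₗ[R] P')
    (hf : Function.Surjective f) (n : ℕ) :
    (I ^ n • ⊤ : Submodule R P).map f = I ^ n • ⊤ := by
  rw [Submodule.map_smul'', Submodule.map_top, LinearMap.range_eq_top.2 hf]

theorem mem_of_forall_mem_sup_pow_smul [IsNoetherianRing R] [IsLocalRing R] [Module.Finite R P]
    {J : Ideal R} (hJ : J ≠ ⊤) (N Q : Submodule R P) {u : P} (h : ∀ s : ℕ, u ∈ J ^ s • N ⊔ Q) :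
    u ∈ Q := by
  rw [← Submodule.Quotient.mk_eq_zero, ← Submodule.mem_bot R,
    ← Ideal.iInf_pow_smul_eq_bot_of_isLocalRing (M := P ⧸ Q) J hJ, Submodule.mem_iInf]
  intro s
  obtain ⟨x, hx, y, hy, rfl⟩ := Submodule.mem_sup.1 (h s)
  rw [Submodule.Quotient.mk_add, (Submodule.Quotient.mk_eq_zero Q).2 hy, add_zero]
  have := Submodule.mem_map_of_mem (f := Q.mkQ) hx
  rw [Submodule.map_smul''] at this
  exact Submodule.smul_mono le_rfl le_top this

theorem GoodElt.exists_bound (h : GoodElt 𝔪 I P a) (ha : a ∈ I) :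
    ∃ n₀ : ℕ, ∀ n, n₀ ≤ n → ∀ s, ∀ u ∈ (I ^ n • ⊤ : Submodule R P),
      a • u ∈ biE 𝔪 I P (n + 1) s → u ∈ biE 𝔪 I P n s := by
  obtain ⟨n₀, h⟩ := h
  refine ⟨n₀, fun n hn s => ?_⟩
  induction s with
  | zero =>
    intro u hu _
    rwa [biE_zero]
  | succ s ih =>
    intro u hu hau
    obtain ⟨x, hx, y, hy, rfl⟩ := Submodule.mem_sup.1 (ih u hu (biE_anti s.le_succ hau))
    refine add_mem (h n hn s x hx ?_) (le_biE _ _ hy)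
    rw [smul_add] at hau
    exact (Submodule.add_mem_iff_left _ (le_biE _ _ (smul_mem_pow_smul ha hy))).1 hau

variable [IsNoetherianRing R] [IsLocalRing R] [Module.Finite R P]

theorem GoodElt.exists_climb (h : GoodElt 𝔪 I P a) (ha : a ∈ I) (h𝔪 : 𝔪 ≠ ⊤) :
    ∃ n₀ : ℕ, ∀ n, n₀ ≤ n → ∀ k, ∀ u ∈ (I ^ n • ⊤ : Submodule R P),
      a • u ∈ (I ^ (n + k + 1) • ⊤ : Submodule R P) → u ∈ (I ^ (n + k) • ⊤ : Submodule R P) := by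
  obtain ⟨n₀, h⟩ := h.exists_bound ha
  refine ⟨n₀, fun n hn k => ?_⟩
  induction k with
  | zero => exact fun u hu _ => hu
  | succ k ih =>
    intro u hu hau
    have hle : (I ^ (n + (k + 1) + 1) • ⊤ : Submodule R P) ≤ I ^ (n + k + 1) • ⊤ :=
      Submodule.smul_mono_left (Ideal.pow_le_pow_right (by omega))
    exact mem_of_forall_mem_sup_pow_smul h𝔪 _ _ fun s =>
      h (n + k) (by omega) s u (ih u hu (hle hau)) (le_biE _ _ hau)

theorem GoodElt.exists_injective (h : GoodElt 𝔪 I P a) (ha : a ∈ I) (h𝔪 : 𝔪 ≠ ⊤) (hI : I ≠ ⊤) :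
    ∃ n₀ : ℕ, ∀ u ∈ (I ^ n₀ • ⊤ : Submodule R P), a • u = 0 → u = 0 := by
  obtain ⟨n₀, h⟩ := h.exists_climb ha h𝔪
  refine ⟨n₀, fun u hu hau => ?_⟩
  rw [← Submodule.mem_bot R]
  refine mem_of_forall_mem_sup_pow_smul hI ⊤ _ fun s => ?_
  rw [sup_bot_eq]
  refine Submodule.smul_mono_left (Ideal.pow_le_pow_right (Nat.le_add_left s n₀))
    (h n₀ le_rfl s u hu ?_)
  rw [hau]
  exact zero_mem _

theorem GoodElt.exists_lift (h : GoodElt 𝔪 I P a) (ha : a ∈ I) (h𝔪 : 𝔪 ≠ ⊤) :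
    ∃ n₀ : ℕ, ∀ n, n₀ ≤ n → ∀ s, ∀ u : P, a • u ∈ biE 𝔪 I P (n + 1) s →
      ∃ v ∈ biE 𝔪 I P n s, a • v = a • u := by
  obtain ⟨n₁, h₁⟩ := h.exists_bound ha
  obtain ⟨n₀, h₀⟩ := h.exists_climb ha h𝔪
  obtain ⟨c, hc⟩ := Ideal.exists_pow_inf_eq_pow_smul I (mulTop P a)
  refine ⟨n₁ + n₀ + c, fun n hn s u hu => ?_⟩
  have hmem : a • u ∈ (I ^ (n + 1) • ⊤ : Submodule R P) ⊓ mulTop P a :=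
    ⟨biE_le _ _ hu, mem_mulTop.2 ⟨u, rfl⟩⟩
  rw [hc (n + 1) (by omega)] at hmem
  have hle : I ^ (n + 1 - c) • (I ^ c • ⊤ ⊓ mulTop P a) ≤
      (I ^ (n + 1 - c) • ⊤ : Submodule R P).map (LinearMap.lsmul R P a) := by
    rw [Submodule.map_smul'', Submodule.map_top]
    exact Submodule.smul_mono le_rfl inf_le_right
  obtain ⟨v, hv, hvu⟩ := hle hmem
  have hvu : a • v = a • u := hvu
  have hv' : v ∈ (I ^ n • ⊤ : Submodule R P) := by
    rcases Nat.eq_zero_or_pos c with rfl | hc0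
    · exact Submodule.smul_mono_left (Ideal.pow_le_pow_right (by omega)) hv
    · have := h₀ (n + 1 - c) (by omega) (c - 1) v hv
      rw [show n + 1 - c + (c - 1) = n by omega] at this
      exact this (hvu ▸ biE_le _ _ hu)
  exact ⟨v, h₁ n (by omega) s v hv' (hvu ▸ hu), hvu⟩

end Good

/-- Successive quotients by `as` start from good elements. -/
def GoodChain {R : Type u} [CommRing R] (𝔪 I : Ideal R) {P : Type w} [AddCommGroup P] [Module R P] :
    Submodule R P → List R → Prop
  | _, [] => True
  | K, a :: as => GoodElt 𝔪 I (P ⧸ K) a ∧ GoodChain 𝔪 I (K ⊔ mulTop P a) as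

theorem mem_mkQ_map_iff {R P : Type*} [CommRing R] [AddCommGroup P] [Module R P]
    (K N : Submodule R P) (u : P) : K.mkQ u ∈ N.map K.mkQ ↔ u ∈ N ⊔ K := by
  rw [← Submodule.mem_comap, Submodule.comap_map_eq, Submodule.ker_mkQ]

theorem exists_pow_smul_le_of_forall {S L : Type*} [CommRing S] [AddCommGroup L] [Module S L]
    [IsNoetherianRing S] [Module.Finite S L] {m : ℕ} (x : Fin m → S) (G K : Submodule S L)
    (h : ∀ u ∈ G, ∀ l, ∃ r : ℕ, x l ^ r • u ∈ K) :
    ∃ k, Ideal.span (Set.range x) ^ k • G ≤ K := by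
  have hle : Ideal.span (Set.range x) ≤ (K.colon (G : Set L)).radical := by
    rw [Ideal.span_le]
    rintro _ ⟨l, rfl⟩
    obtain ⟨s, hs⟩ := IsNoetherian.noetherian G
    have key : ∃ r : ℕ, ∀ u ∈ s, x l ^ r • u ∈ K := by
      choose! f hf using fun u hu => h u hu l
      refine ⟨s.sup f, fun u hu => ?_⟩
      rw [← Nat.sub_add_cancel (Finset.le_sup (f := f) hu), pow_add, mul_smul]
      exact K.smul_mem _ (hf u (hs ▸ Submodule.subset_span hu))
    obtain ⟨r, hr⟩ := key
    refine ⟨r, Submodule.mem_colon.2 fun u hu => ?_⟩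
    rw [SetLike.mem_coe, ← hs] at hu
    exact (Submodule.span_le (p := K.comap (LinearMap.lsmul S L (x l ^ r)))).2 hr hu
  obtain ⟨k, hk⟩ := Ideal.exists_pow_le_of_le_radical_of_fg hle
    (IsNoetherian.noetherian (Ideal.span (Set.range x)))
  exact ⟨k, Submodule.smul_le.2 fun a ha u hu => Submodule.mem_colon.1 (hk ha) u hu⟩

theorem exists_uniform_of_filter {S L : Type*} [CommRing S] [AddCommGroup L] [Module S L]
    [IsNoetherianRing S] [Module.Finite S L] {m : ℕ} (x : Fin m → S) (K : Submodule S L) (a : S)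
    (h : ∀ u : L, a • u ∈ K → ∀ l, ∃ r : ℕ, x l ^ r • u ∈ K) :
    ∃ n₀ : ℕ, ∀ n, n₀ ≤ n → ∀ u ∈ (Ideal.span (Set.range x) ^ n • ⊤ : Submodule S L),
      a • u ∈ K → u ∈ K := by
  let G : Submodule S L := K.comap (LinearMap.lsmul S L a)
  obtain ⟨k, hk⟩ := exists_pow_smul_le_of_forall x G K h
  obtain ⟨c, hc⟩ := Ideal.exists_pow_inf_eq_pow_smul (Ideal.span (Set.range x)) G
  refine ⟨c + k, fun n hn u hu hau => ?_⟩
  have hmem : u ∈ (Ideal.span (Set.range x) ^ n • ⊤ : Submodule S L) ⊓ G := ⟨hu, hau⟩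
  rw [hc n (by omega)] at hmem
  exact hk (Submodule.smul_mono (Ideal.pow_le_pow_right (by omega)) inf_le_right hmem)

section Bigraded

open GrMod

variable {R : Type u} [CommRing R] {M : Type w} [AddCommGroup M] [Module R M]

theorem smul_mem_bi {𝔪 I : Ideal R} {m e : ℕ} (x : Fin m → R) (z : Fin e → R)
    (hx : ∀ l, x l ∈ I) (hz : ∀ l, z l ∈ 𝔪) (t : Fin m ⊕ Fin e) (p : ℕ × ℕ) (u : M)
    (hu : u ∈ (𝔪 ^ p.2 • (I ^ p.1 • ⊤) : Submodule R M)) :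
    Sum.elim x z t • u ∈
      (𝔪 ^ (p + Sum.elim (fun _ => (1, 0)) (fun _ => (0, 1)) t : ℕ × ℕ).2 •
        (I ^ (p + Sum.elim (fun _ => (1, 0)) (fun _ => (0, 1)) t : ℕ × ℕ).1 • ⊤) :
        Submodule R M) := by
  rcases t with l | l
  · exact smul_mem_pow_smul_pow_smul (hx l) hu
  · change z l • u ∈ (𝔪 ^ (p.2 + 1) • (I ^ p.1 • ⊤) : Submodule R M)
    rw [pow_succ', ← smul_eq_mul, Submodule.smul_assoc]
    exact Submodule.smul_mem_smul (hz l) hu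

theorem smul_mem_biE_bi {𝔪 I : Ideal R} {m e : ℕ} (x : Fin m → R) (z : Fin e → R)
    (hx : ∀ l, x l ∈ I) (hz : ∀ l, z l ∈ 𝔪) (t : Fin m ⊕ Fin e) (p : ℕ × ℕ) (u : M)
    (hu : u ∈ biE 𝔪 I M p.1 (p.2 + 1)) :
    Sum.elim x z t • u ∈
      biE 𝔪 I M (p + Sum.elim (fun _ => (1, 0)) (fun _ => (0, 1)) t : ℕ × ℕ).1
        ((p + Sum.elim (fun _ => (1, 0)) (fun _ => (0, 1)) t : ℕ × ℕ).2 + 1) := by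
  rcases t with l | l
  · exact smul_mem_biE (hx l) hu
  · change z l • u ∈ biE 𝔪 I M p.1 (p.2 + 1 + 1)
    obtain ⟨y, hy, v, hv, rfl⟩ := Submodule.mem_sup.1 hu
    rw [smul_add]
    refine add_mem (smul_le_biE _ _ ?_) (le_biE _ _ (Submodule.smul_mem _ _ hv))
    rw [pow_succ', ← smul_eq_mul, Submodule.smul_assoc]
    exact Submodule.smul_mem_smul (hz l) hy

theorem goodChain_of_filtSeq [IsNoetherianRing R] [IsLocalRing R] [Module.Finite R M]
    {𝔪 I : Ideal R} (h𝔪 : 𝔪 ≠ ⊤) {m e : ℕ} (x : Fin m → R) (hx : ∀ l, x l ∈ I)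
    (δ : Fin m ⊕ Fin e → ℕ × ℕ) (r : Fin m ⊕ Fin e → R)
    (hr : ∀ l, r (Sum.inl l) = x l) (hδ : ∀ l, δ (Sum.inl l) = (1, 0))
    (hA : ∀ t p, ∀ u ∈ (fun p : ℕ × ℕ => (𝔪 ^ p.2 • (I ^ p.1 • ⊤) : Submodule R M)) p,
      r t • u ∈ (fun p : ℕ × ℕ => (𝔪 ^ p.2 • (I ^ p.1 • ⊤) : Submodule R M)) (p + δ t))
    [Module.Finite (MvPolynomial (Fin m ⊕ Fin e) R) (fam r δ _ hA)]
    (hgen : ∀ n s, ∀ u, ∀ hu : u ∈ (𝔪 ^ s • (I ^ n • ⊤) : Submodule R M),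
      (⟨of r δ (n, s) u, of_mem_fam (hA := hA) (p := (n, s)) hu⟩ : fam r δ _ hA) ∈
        (Ideal.span (Set.range fun l =>
          (MvPolynomial.X (Sum.inl l) : MvPolynomial (Fin m ⊕ Fin e) R)) ^ n • ⊤ :
          Submodule (MvPolynomial (Fin m ⊕ Fin e) R) (fam r δ _ hA)))
    (cs : List (Fin m → R)) :
    ∀ (Kf : Submodule (MvPolynomial (Fin m ⊕ Fin e) R) (fam r δ _ hA)) (K : Submodule R M),
      (∀ f ∈ Kf, ∀ n s, GrMod.comp (n, s) (f : GrMod r δ M) ∈ biE 𝔪 I M n (s + 1) ⊔ K) →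
      (∃ n₀ : ℕ, ∀ n, n₀ ≤ n → ∀ s u, ∀ hu : u ∈ (𝔪 ^ s • (I ^ n • ⊤) : Submodule R M),
        u ∈ biE 𝔪 I M n (s + 1) ⊔ K →
          (⟨of r δ (n, s) u, of_mem_fam (hA := hA) (p := (n, s)) hu⟩ : fam r δ _ hA) ∈ Kf) →
      FiltSeq (fun l => MvPolynomial.X (Sum.inl l)) Kf
        (cs.map fun c => ∑ l, algebraMap R _ (c l) * MvPolynomial.X (Sum.inl l)) →
      GoodChain 𝔪 I K (cs.map fun c => ∑ l, c l * x l) := by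
  induction cs with
  | nil => exact fun _ _ _ _ _ => trivial
  | cons c cs ih =>
    rintro Kf K h1 ⟨n₀, h2⟩ ⟨hc, hcs⟩
    set a' : MvPolynomial (Fin m ⊕ Fin e) R :=
      ∑ l, algebraMap R _ (c l) * MvPolynomial.X (Sum.inl l) with ha'
    set a : R := ∑ l, c l * x l with ha_def
    have ha : a ∈ I := I.sum_mem fun l _ => I.mul_mem_left _ (hx l)
    have hact : ∀ (p : ℕ × ℕ) (u : M), a' • of r δ p u = of r δ (p + (1, 0)) (a • u) := by
      intro p u
      rw [ha', ha_def, Finset.sum_smul, Finset.sum_smul, map_sum]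
      refine Finset.sum_congr rfl fun l _ => ?_
      rw [mul_smul, X_smul_of, MvPolynomial.algebraMap_eq, C_smul_of, hr, hδ, mul_smul]
    have hgood : GoodElt 𝔪 I (M ⧸ K) a := by
      obtain ⟨k, hk⟩ := exists_uniform_of_filter _ Kf a' hc
      refine ⟨n₀ + k, fun n hn s u' hu' hau' => ?_⟩
      rw [← map_pow_smul_top (P := M) K.mkQ K.mkQ_surjective, ← Submodule.map_smul''] at hu'
      obtain ⟨u, hu, rfl⟩ := hu'
      rw [← map_biE (P := M) K.mkQ K.mkQ_surjective, ← map_smul, mem_mkQ_map_iff] at hau'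
      rw [← map_biE (P := M) K.mkQ K.mkQ_surjective, mem_mkQ_map_iff]
      have := h2 (n + 1) (by omega) s _ (smul_mem_pow_smul_pow_smul ha hu) hau'
      have hk' := hk n (by omega) _ (hgen n s u hu) (by
        convert this using 1
        exact Subtype.ext (hact (n, s) u))
      have := h1 _ hk' n s
      rwa [comp_of_same] at this
    refine ⟨hgood, ih _ _ ?_ ?_ hcs⟩
    · intro f hf n s
      obtain ⟨f, hfK, g, ⟨g, rfl⟩, rfl⟩ := Submodule.mem_sup.1 hf
      change GrMod.comp (n, s) ((f : GrMod r δ M) + a' • (g : GrMod r δ M)) ∈ _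
      rw [map_add]
      refine add_mem ((sup_le_sup_left le_sup_left _ : biE 𝔪 I M n (s + 1) ⊔ K ≤ _) (h1 f hfK n s)) (Submodule.mem_sup_right
        (Submodule.mem_sup_right ?_))
      generalize (g : GrMod r δ M) = g
      induction g using GrMod.induction_on with
      | zero =>
        rw [smul_zero, map_zero]
        exact zero_mem _
      | add f g hf hg =>
        rw [smul_add, map_add]
        exact add_mem hf hg
      | of p u =>
        rw [hact]
        by_cases h : (n, s) = p + (1, 0)
        · rw [h, comp_of_same]
          exact mem_mulTop.2 ⟨u, rfl⟩
        · rw [comp_of_ne h]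
          exact zero_mem _
    · obtain ⟨n₁, h₁⟩ := hgood.exists_lift ha h𝔪
      refine ⟨n₀ + n₁ + 1, fun n hn s u hu hmem => ?_⟩
      obtain ⟨n, rfl⟩ : ∃ n', n = n' + 1 := ⟨n - 1, by omega⟩
      rw [← sup_assoc] at hmem
      obtain ⟨w, hw, b, ⟨v, rfl⟩, rfl⟩ := Submodule.mem_sup.1 hmem
      have hav : a • K.mkQ v ∈ biE 𝔪 I (M ⧸ K) (n + 1) s := by
        rw [← map_smul, ← map_biE (P := M) K.mkQ K.mkQ_surjective, mem_mkQ_map_iff]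
        have h3 : w ∈ biE 𝔪 I M (n + 1) s ⊔ K := (sup_le_sup_right (biE_anti s.le_succ) _ : biE 𝔪 I M (n + 1) (s + 1) ⊔ K ≤ _) hw
        have h4 : w + a • v ∈ biE 𝔪 I M (n + 1) s ⊔ K :=
          Submodule.mem_sup_left (smul_le_biE _ _ hu)
        exact (Submodule.add_mem_iff_right _ h3).1 h4
      obtain ⟨y, hy, hya⟩ := h₁ n (by omega) s _ hav
      rw [← map_biE (P := M) K.mkQ K.mkQ_surjective] at hy
      obtain ⟨y, hy, rfl⟩ := hy
      obtain ⟨y, hyA, y', hy', rfl⟩ := Submodule.mem_sup.1 hy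
      have hK : a • v - a • (y + y') ∈ K := by
        rw [← Submodule.Quotient.mk_eq_zero, Submodule.Quotient.mk_sub, sub_eq_zero]
        exact hya.symm
      have hay := smul_mem_pow_smul_pow_smul ha hyA
      have hu' : w + a • v - a • y ∈ (𝔪 ^ s • (I ^ (n + 1) • ⊤) : Submodule R M) :=
        sub_mem hu hay
      have key : w + a • v - a • y ∈ biE 𝔪 I M (n + 1) (s + 1) ⊔ K := by
        have : w + a • v - a • y = w + (a • v - a • (y + y')) + a • y' := by
          rw [smul_add]
          abel
        rw [this]
        exact add_mem (add_mem hw (Submodule.mem_sup_right hK))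
          (Submodule.mem_sup_left (le_biE _ _ (smul_mem_pow_smul ha hy')))
      have h5 := h2 (n + 1) (by omega) s _ hu' key
      refine Submodule.mem_sup.2 ⟨_, h5, a' • ⟨of r δ (n, s) y,
        of_mem_fam (hA := hA) (p := (n, s)) hyA⟩, mem_mulTop.2 ⟨_, rfl⟩, Subtype.ext ?_⟩
      change of r δ (n + 1, s) (w + a • v - a • y) + a' • of r δ (n, s) y =
        of r δ (n + 1, s) (w + a • v)
      rw [hact, Prod.mk_add_mk, add_zero, ← map_add, sub_add_cancel]

end Bigraded

open GrMod in
/-- For generic `c`, the combinations `∑ c (j, l) x l` of generators of `I` form a good chain. -/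
theorem exists_goodChain {R : Type u} [CommRing R] [IsNoetherianRing R] [IsLocalRing R]
    {M : Type w} [AddCommGroup M] [Module R M] [Module.Finite R M] {m : ℕ} (x : Fin m → R)
    {I : Ideal R} (hx : Ideal.span (Set.range x) = I) (i : ℕ) :
    ∃ F : MvPolynomial (Fin i × Fin m) R,
      MvPolynomial.map (Ideal.Quotient.mk (IsLocalRing.maximalIdeal R)) F ≠ 0 ∧
      ∀ c : Fin i × Fin m → R,
        MvPolynomial.eval (fun p => Ideal.Quotient.mk (IsLocalRing.maximalIdeal R) (c p))
          (MvPolynomial.map (Ideal.Quotient.mk (IsLocalRing.maximalIdeal R)) F) ≠ 0 →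
        GoodChain (IsLocalRing.maximalIdeal R) I (⊥ : Submodule R M)
          (List.ofFn fun j => ∑ l, c (j, l) * x l) := by
  set 𝔪 := IsLocalRing.maximalIdeal R with h𝔪
  obtain ⟨e, z, hz⟩ := Submodule.fg_iff_exists_fin_generating_family.1 (IsNoetherian.noetherian 𝔪)
  have hxI : ∀ l, x l ∈ I := fun l => hx ▸ Ideal.subset_span ⟨l, rfl⟩
  have hz𝔪 : ∀ l, z l ∈ 𝔪 := fun l => hz ▸ Submodule.subset_span ⟨l, rfl⟩
  let r : Fin m ⊕ Fin e → R := Sum.elim x z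
  let δ : Fin m ⊕ Fin e → ℕ × ℕ := Sum.elim (fun _ => (1, 0)) (fun _ => (0, 1))
  let W := MvPolynomial (Fin m ⊕ Fin e) R
  have hA : ∀ t p, ∀ u ∈ (fun p : ℕ × ℕ => (𝔪 ^ p.2 • (I ^ p.1 • ⊤) : Submodule R M)) p,
      r t • u ∈ (fun p : ℕ × ℕ => (𝔪 ^ p.2 • (I ^ p.1 • ⊤) : Submodule R M)) (p + δ t) :=
    smul_mem_bi x z hxI hz𝔪
  let X : Ideal W := Ideal.span (Set.range fun l => MvPolynomial.X (Sum.inl l))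
  let T : Submodule W (GrMod r δ M) := Submodule.span W (Set.range (of r δ (M := M) 0))
  have hgen0 : ∀ n, ∀ u ∈ (I ^ n • ⊤ : Submodule R M), of r δ (n, 0) u ∈ X ^ n • T := by
    intro n
    induction n with
    | zero =>
      intro u _
      rw [pow_zero, Ideal.one_eq_top, Submodule.top_smul]
      exact Submodule.subset_span ⟨u, rfl⟩
    | succ n ih =>
      intro u hu
      have h1 := of_mem_smul (r := r) (δ := δ) Sum.inl (1, 0) (fun _ => rfl) (X ^ n • T) (n, 0) _ ih
        (u := u) (by
          change u ∈ Ideal.span (Set.range x) • _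
          rwa [hx, ← Submodule.mul_smul, ← pow_succ'])
      rw [← Submodule.mul_smul, ← pow_succ'] at h1
      exact h1
  have hgenT : ∀ n s, ∀ u ∈ (𝔪 ^ s • (I ^ n • ⊤) : Submodule R M),
      of r δ (n, s) u ∈ X ^ n • T := by
    intro n s
    induction s with
    | zero =>
      intro u hu
      rw [pow_zero, Ideal.one_eq_top, Submodule.top_smul] at hu
      exact hgen0 n u hu
    | succ s ih =>
      intro u hu
      have h1 := of_mem_smul (r := r) (δ := δ) Sum.inr (0, 1) (fun _ => rfl) (X ^ n • T) (n, s) _ ih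
        (u := u) (by
          change u ∈ Ideal.span (Set.range z) • _
          change Ideal.span (Set.range z) = 𝔪 at hz
          rwa [hz, ← Submodule.mul_smul, ← pow_succ'])
      exact Submodule.smul_le_right h1
  have hT : fam r δ _ hA = T := by
    refine le_antisymm (fun f hf => ?_) (Submodule.span_le.2 ?_)
    · exact mem_of_forall_comp_mem T.toAddSubmonoid f fun p =>
        Submodule.smul_le_right (hgenT p.1 p.2 _ (hf p))
    · rintro _ ⟨u, rfl⟩
      refine of_mem_fam ?_
      change u ∈ (𝔪 ^ 0 • (I ^ 0 • ⊤) : Submodule R M)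
      rw [pow_zero, pow_zero, Ideal.one_eq_top, Submodule.top_smul, Submodule.top_smul]
      trivial
  have hfin : Module.Finite W (fam r δ _ hA) := by
    rw [Module.Finite.iff_fg, hT]
    exact span_of_zero_fg
  have hB : ∀ t p, ∀ u ∈ (fun p : ℕ × ℕ => biE 𝔪 I M p.1 (p.2 + 1)) p,
      r t • u ∈ (fun p : ℕ × ℕ => biE 𝔪 I M p.1 (p.2 + 1)) (p + δ t) :=
    smul_mem_biE_bi x z hxI hz𝔪
  let K₀ : Submodule W (fam r δ _ hA) := (fam r δ _ hB).comap (Submodule.subtype _)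
  obtain ⟨F, hF, h⟩ := exists_filtSeq_of_local (R := R) K₀ (by
    rintro a ha ⟨f, hf⟩
    change algebraMap R W a • f ∈ fam r δ _ hB
    refine mem_of_forall_comp_mem ((fam r δ _ hB).comap
      (LinearMap.lsmul W (GrMod r δ M) (algebraMap R W a))).toAddSubmonoid f fun p => ?_
    change algebraMap R W a • of r δ p (GrMod.comp p f) ∈ fam r δ _ hB
    rw [MvPolynomial.algebraMap_eq, C_smul_of]
    refine of_mem_fam (smul_le_biE _ _ ?_)
    rw [pow_succ', ← smul_eq_mul, Submodule.smul_assoc]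
    exact Submodule.smul_mem_smul ha (hf p)) m i (fun l => MvPolynomial.X (Sum.inl l))
  refine ⟨F, hF, fun c hc => ?_⟩
  have := goodChain_of_filtSeq (IsLocalRing.maximalIdeal.isMaximal R).ne_top x hxI δ r
    (fun _ => rfl) (fun _ => rfl) hA (fun n s u hu => ?_) (List.ofFn fun j l => c (j, l)) K₀ ⊥ ?_ ?_ ?_
  · rwa [List.map_ofFn] at this
  · have h1 := hgenT n s u hu
    rw [← hT] at h1
    have h2 : (X ^ n • ⊤ : Submodule W (fam r δ _ hA)).map (Submodule.subtype _) =
        X ^ n • fam r δ _ hA := by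
      rw [Submodule.map_smul'', Submodule.map_top, Submodule.range_subtype]
    rw [← h2] at h1
    obtain ⟨f, hf, hfu⟩ := h1
    obtain rfl : f = ⟨of r δ (n, s) u, of_mem_fam (hA := hA) (p := (n, s)) hu⟩ := Subtype.ext hfu
    exact hf
  · intro f hf n s
    exact Submodule.mem_sup_left (hf (n, s))
  · refine ⟨0, fun n _ s u hu hmem => ?_⟩
    rw [sup_bot_eq] at hmem
    exact of_mem_fam (hA := hB) (p := (n, s)) hmem
  · have := h c hc
    rwa [List.map_ofFn]

theorem exists_goodChain_list {R : Type u} [CommRing R] [IsNoetherianRing R] [IsLocalRing R]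
    [Infinite (IsLocalRing.ResidueField R)] (M : Type w) [AddCommGroup M] [Module R M]
    [Module.Finite R M] (I : Ideal R) (i : ℕ) :
    ∃ as : List R, as.length = i ∧ (∀ a ∈ as, a ∈ I) ∧
      GoodChain (IsLocalRing.maximalIdeal R) I (⊥ : Submodule R M) as := by
  obtain ⟨m, x, hx⟩ := Submodule.fg_iff_exists_fin_generating_family.1 (IsNoetherian.noetherian I)
  obtain ⟨F, hF, h⟩ := exists_goodChain (M := M) x hx i
  have : Infinite (R ⧸ IsLocalRing.maximalIdeal R) :=
    inferInstanceAs (Infinite (IsLocalRing.ResidueField R))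
  let _ : Field (R ⧸ IsLocalRing.maximalIdeal R) := Ideal.Quotient.field _
  obtain ⟨c, hc⟩ : ∃ c : Fin i × Fin m → R ⧸ IsLocalRing.maximalIdeal R,
      MvPolynomial.eval c (MvPolynomial.map (Ideal.Quotient.mk (IsLocalRing.maximalIdeal R)) F)
        ≠ 0 := by
    by_contra! hcon
    exact hF (MvPolynomial.funext fun c => by rw [hcon c, map_zero])
  choose c' hc' using fun p => Ideal.Quotient.mk_surjective (c p)
  refine ⟨_, List.length_ofFn, fun a ha => ?_, h c' (by simpa only [hc'] using hc)⟩
  obtain ⟨j, rfl⟩ := (List.mem_ofFn' _ _).1 ha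
  exact I.sum_mem fun l _ => I.mul_mem_left _ (hx ▸ Submodule.subset_span ⟨l, rfl⟩)

theorem exists_goodElt {R : Type u} [CommRing R] [IsNoetherianRing R] [IsLocalRing R]
    [Infinite (IsLocalRing.ResidueField R)] (P : Type w) [AddCommGroup P] [Module R P]
    [Module.Finite R P] (I : Ideal R) :
    ∃ a ∈ I, GoodElt (IsLocalRing.maximalIdeal R) I P a := by
  obtain ⟨as, hlen, hI, has⟩ := exists_goodChain_list P I 1
  obtain ⟨a, rfl⟩ := List.length_eq_one_iff.1 hlen
  refine ⟨a, hI a List.mem_cons_self, ?_⟩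
  obtain ⟨n₀, h⟩ := has.1
  have hsurj := (⊥ : Submodule R P).mkQ_surjective
  refine ⟨n₀, fun n hn s u hu hau => ?_⟩
  have h1 := h n hn s ((⊥ : Submodule R P).mkQ u) (by
    rw [← map_pow_smul_top (P := P) _ hsurj, ← Submodule.map_smul'']
    exact Submodule.mem_map_of_mem hu) (by
    rw [← map_biE (P := P) _ hsurj, ← map_smul]
    exact Submodule.mem_map_of_mem hau)
  rwa [← map_biE (P := P) _ hsurj, mem_mkQ_map_iff, sup_bot_eq] at h1

section Length

variable {R : Type u} [CommRing R]

/-- The length of `(A + B) / B`. -/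
noncomputable def relLength {P : Type*} [AddCommGroup P] [Module R P] (A B : Submodule R P) : ℕ∞ :=
  Module.length R (A.map B.mkQ)

variable {P P' : Type*} [AddCommGroup P] [Module R P] [AddCommGroup P'] [Module R P']

theorem relLength_congr (f : P →ₗ[R] P') {A B : Submodule R P} {A' B' : Submodule R P'}
    (h : A.map f ⊔ B' = A' ⊔ B') (h' : ∀ u ∈ A, f u ∈ B' ↔ u ∈ B) :
    relLength A B = relLength A' B' := by
  have h1 : A'.map B'.mkQ = LinearMap.range (B'.mkQ.comp (f.comp A.subtype)) := by
    rw [LinearMap.range_comp, LinearMap.range_comp, Submodule.range_subtype]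
    have hB : B'.map B'.mkQ = ⊥ := by
      rw [← LinearMap.le_ker_iff_map, Submodule.ker_mkQ]
    rw [← sup_bot_eq (A'.map _), ← hB, ← Submodule.map_sup, ← h, Submodule.map_sup, hB, sup_bot_eq]
  have h2 : A.map B.mkQ = LinearMap.range (B.mkQ.comp A.subtype) := by
    rw [LinearMap.range_comp, Submodule.range_subtype]
  have hker : LinearMap.ker (B'.mkQ.comp (f.comp A.subtype)) =
      LinearMap.ker (B.mkQ.comp A.subtype) := by
    ext u
    simp only [LinearMap.mem_ker, LinearMap.comp_apply, Submodule.mkQ_apply,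
      Submodule.Quotient.mk_eq_zero]
    exact h' u u.2
  rw [relLength, relLength, h1, h2]
  exact ((LinearMap.quotKerEquivRange _).symm.trans
    ((Submodule.quotEquivOfEq _ _ hker.symm).trans (LinearMap.quotKerEquivRange _))).length_eq

theorem relLength_add {A B C : Submodule R P} (hBC : B ≤ C) (hCA : C ≤ A) :
    relLength A B = relLength C B + relLength A C := by
  have hle : C.map B.mkQ ≤ A.map B.mkQ := Submodule.map_mono hCA
  let g : A.map B.mkQ →ₗ[R] A.map C.mkQ := (Submodule.factor hBC).restrict (by
    rintro _ ⟨u, hu, rfl⟩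
    exact ⟨u, hu, rfl⟩)
  refine Module.length_eq_add_of_exact (Submodule.inclusion hle) g
    (Submodule.inclusion_injective hle) ?_ ?_
  · rintro ⟨_, u, hu, rfl⟩
    exact ⟨⟨B.mkQ u, u, hu, rfl⟩, rfl⟩
  · rintro ⟨_, u, hu, rfl⟩
    constructor
    · intro h
      have : C.mkQ u = 0 := congrArg Subtype.val h
      rw [Submodule.mkQ_apply, Submodule.Quotient.mk_eq_zero] at this
      exact ⟨⟨B.mkQ u, u, this, rfl⟩, rfl⟩
    · rintro ⟨⟨_, v, hv, rfl⟩, h⟩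
      have h : B.mkQ v = B.mkQ u := congrArg Subtype.val h
      rw [Submodule.mkQ_apply, Submodule.mkQ_apply, Submodule.Quotient.eq] at h
      refine Subtype.ext ((Submodule.Quotient.mk_eq_zero C).2 ?_)
      exact (sub_mem_comm_iff.1 (hBC h) |> fun h' => by simpa using add_mem h' hv)

theorem relLength_mono_right {A B C : Submodule R P} (hBC : B ≤ C) :
    relLength A C ≤ relLength A B := by
  let g : A.map B.mkQ →ₗ[R] A.map C.mkQ := (Submodule.factor hBC).restrict (by
    rintro _ ⟨u, hu, rfl⟩
    exact ⟨u, hu, rfl⟩)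
  refine Module.length_le_of_surjective g ?_
  rintro ⟨_, u, hu, rfl⟩
  exact ⟨⟨B.mkQ u, u, hu, rfl⟩, rfl⟩

theorem relLength_eq_zero {A B : Submodule R P} (h : A ≤ B) : relLength A B = 0 := by
  rw [relLength, Module.length_eq_zero_iff, Submodule.subsingleton_iff_eq_bot,
    ← LinearMap.le_ker_iff_map, Submodule.ker_mkQ]
  exact h

variable [IsNoetherianRing R] [IsLocalRing R]

theorem length_ne_top_of_smul_eq_zero [Module.Finite R P] {k : ℕ}
    (h : ∀ r ∈ IsLocalRing.maximalIdeal R ^ k, ∀ u : P, r • u = 0) : Module.length R P ≠ ⊤ := by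
  rcases subsingleton_or_nontrivial P with hP | hP
  · rw [Module.length_eq_zero]
    exact ENat.zero_ne_top
  set J := IsLocalRing.maximalIdeal R ^ k with hJ
  have htor : Module.IsTorsionBySet R P J := fun u r => h r r.2 u
  let _ : Module (R ⧸ J) P := htor.module
  have : IsScalarTower R (R ⧸ J) P := htor.isScalarTower
  have hJ1 : J ≠ ⊤ := fun h1 => by
    obtain ⟨u, hu⟩ := exists_ne (0 : P)
    exact hu (by rw [← one_smul R u, h 1 (h1 ▸ Submodule.mem_top)])
  have : Nontrivial (R ⧸ J) := Ideal.Quotient.nontrivial_iff.2 hJ1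
  have : IsLocalRing (R ⧸ J) := IsLocalRing.of_surjective' _ Ideal.Quotient.mk_surjective
  have : IsArtinianRing (R ⧸ J) := by
    rw [isArtinianRing_iff_isNilpotent_maximalIdeal]
    refine ⟨k, ?_⟩
    have hle : IsLocalRing.maximalIdeal (R ⧸ J) ≤
        (IsLocalRing.maximalIdeal R).map (Ideal.Quotient.mk J) := by
      intro x hx
      obtain ⟨r, rfl⟩ := Ideal.Quotient.mk_surjective x
      refine Ideal.mem_map_of_mem _ ?_
      rw [IsLocalRing.mem_maximalIdeal] at hx ⊢
      exact fun hr => hx (hr.map _)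
    rw [Submodule.zero_eq_bot, eq_bot_iff]
    refine (Ideal.pow_right_mono hle k).trans ?_
    rw [← Ideal.map_pow, ← hJ, Ideal.map_quotient_self]
  have : Module.Finite (R ⧸ J) P := Module.Finite.of_restrictScalars_finite R _ _
  have : IsArtinian (R ⧸ J) P := inferInstance
  have : IsArtinian R P :=
    isArtinian_of_surjective_algebraMap (R := R ⧸ J) Ideal.Quotient.mk_surjective
  exact Module.length_ne_top

theorem relLength_ne_top [Module.Finite R P] {k : ℕ} {A B : Submodule R P}
    (h : IsLocalRing.maximalIdeal R ^ k • A ≤ B) : relLength A B ≠ ⊤ := by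
  refine length_ne_top_of_smul_eq_zero (k := k) ?_
  rintro r hr ⟨_, u, hu, rfl⟩
  refine Subtype.ext ?_
  change r • B.mkQ u = 0
  rw [← map_smul]
  exact (Submodule.Quotient.mk_eq_zero B).2 (h (Submodule.smul_mem_smul hr hu))

end Length

section BiLen

variable {R : Type u} [CommRing R]

/-- The length of `I^n P / (𝔪^s I^n P + I^(n+1) P)`. -/
noncomputable def biLen (𝔪 I : Ideal R) (P : Type w) [AddCommGroup P] [Module R P] (n s : ℕ) : ℕ∞ :=
  relLength (I ^ n • ⊤) (biE 𝔪 I P n s)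

variable {𝔪 I : Ideal R} {P : Type w} [AddCommGroup P] [Module R P] {a : R}

theorem biLen_eq_of_equiv {P' : Type*} [AddCommGroup P'] [Module R P'] (e : P ≃ₗ[R] P') (n s : ℕ) :
    biLen 𝔪 I P n s = biLen 𝔪 I P' n s := by
  refine relLength_congr e.toLinearMap ?_ fun u _ => ?_
  · rw [map_pow_smul_top _ e.surjective]
  · rw [← map_biE e.toLinearMap e.surjective]
    exact ⟨fun ⟨v, hv, hvu⟩ => e.injective hvu ▸ hv, fun h => ⟨u, h, rfl⟩⟩

theorem GoodElt.biLen_succ [IsNoetherianRing R] [IsLocalRing R] [Module.Finite R P]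
    (h : GoodElt 𝔪 I P a) (ha : a ∈ I) (h𝔪 : 𝔪 ≠ ⊤) :
    ∃ n₀ : ℕ, ∀ n, n₀ ≤ n → ∀ s, biLen 𝔪 I P (n + 1) s =
      biLen 𝔪 I P n s + biLen 𝔪 I (P ⧸ mulTop P a) (n + 1) s := by
  obtain ⟨n₁, h₁⟩ := h.exists_bound ha
  obtain ⟨n₂, h₂⟩ := h.exists_lift ha h𝔪
  refine ⟨n₁ + n₂, fun n hn s => ?_⟩
  set C : Submodule R P := (I ^ n • ⊤ : Submodule R P).map (LinearMap.lsmul R P a) ⊔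
    biE 𝔪 I P (n + 1) s with hC
  have hCA : C ≤ I ^ (n + 1) • ⊤ := by
    refine sup_le ?_ (biE_le _ _)
    rintro _ ⟨u, hu, rfl⟩
    exact smul_mem_pow_smul ha hu
  rw [biLen, relLength_add (le_sup_right : _ ≤ C) hCA]
  congr 1
  · refine (relLength_congr (LinearMap.lsmul R P a) ?_ fun u hu => ?_).symm
    · exact (sup_assoc _ _ _).trans (by rw [sup_idem]) |>.symm
    · exact ⟨h₁ n (by omega) s u hu, fun hu => smul_mem_biE ha hu⟩
  · refine relLength_congr (mulTop P a).mkQ ?_ fun u hu => ?_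
    · rw [map_pow_smul_top _ (Submodule.mkQ_surjective _)]
    · rw [← map_biE _ (Submodule.mkQ_surjective _), mem_mkQ_map_iff]
      constructor
      · intro h
        obtain ⟨e, he, _, ⟨v, rfl⟩, rfl⟩ := Submodule.mem_sup.1 h
        change e + a • v ∈ C
        have hav : a • v ∈ biE 𝔪 I P (n + 1) 0 := by
          rw [biE_zero]
          exact (Submodule.add_mem_iff_right _ (biE_le _ _ he)).1 hu
        obtain ⟨w, hw, hwv⟩ := h₂ n (by omega) 0 v hav
        rw [biE_zero] at hw
        rw [← hwv]
        exact add_mem (Submodule.mem_sup_right he) (Submodule.mem_sup_left ⟨w, hw, rfl⟩)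
      · intro h
        refine (sup_le ?_ le_sup_left : C ≤ _) h
        rintro _ ⟨v, _, rfl⟩
        exact Submodule.mem_sup_right ⟨v, rfl⟩

theorem biLen_ne_top [IsNoetherianRing R] [IsLocalRing R] [Module.Finite R P] (n s : ℕ) :
    biLen (IsLocalRing.maximalIdeal R) I P n s ≠ ⊤ :=
  relLength_ne_top (k := s) (smul_le_biE n s)

/-- Every prime of the support of `P` not containing `J` has coheight at most `δ`. -/
def DimLE (J : Ideal R) (P : Type w) [AddCommGroup P] [Module R P] (δ : ℕ) : Prop :=
  ∀ p ∈ Module.support R P, ¬ J ≤ p.asIdeal → Order.coheight p ≤ δ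

theorem exists_lt_mem_support [IsNoetherianRing R] [Module.Finite R P]
    (ha : ∀ u : P, a • u = 0 → u = 0) {p : PrimeSpectrum R} (hp : p ∈ Module.support R P)
    (hap : a ∈ p.asIdeal) : ∃ q ∈ Module.support R P, q < p ∧ a ∉ q.asIdeal := by
  rw [Module.support_eq_zeroLocus] at hp
  obtain ⟨q, hq, hqp⟩ := Ideal.exists_minimalPrimes_le (J := p.asIdeal) hp
  have hass := Module.associatedPrimes.minimalPrimes_annihilator_subset_associatedPrimes R P hq
  have haq : a ∉ q := by
    intro haq
    obtain ⟨_, f, hf⟩ := (isAssociatedPrime_iff_exists_injective_linearMap q P).1 hass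
    have h1 : a • f 1 = 0 := by
      rw [← map_smul, ← map_zero f]
      congr 1
      rw [Algebra.smul_def, mul_one]
      exact Ideal.Quotient.eq_zero_iff_mem.2 haq
    have h2 : (1 : R ⧸ q) = 0 := hf (by rw [ha _ h1, map_zero])
    exact hq.isPrime.ne_top ((Ideal.eq_top_iff_one q).2 (Ideal.Quotient.eq_zero_iff_mem.1 h2))
  refine ⟨⟨q, hq.isPrime⟩, ?_, ?_, haq⟩
  · rw [Module.support_eq_zeroLocus]
    exact hq.1.2
  · exact lt_of_le_of_ne hqp fun h => haq (by rw [show q = p.asIdeal from congrArg PrimeSpectrum.asIdeal h]; exact hap)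

theorem GoodElt.dimLE_quotient [IsNoetherianRing R] [IsLocalRing R] [Module.Finite R P]
    (h : GoodElt 𝔪 I P a) (ha : a ∈ I) (h𝔪 : 𝔪 ≠ ⊤) (hI : I ≠ ⊤) {δ : ℕ}
    (hd : DimLE I P (δ + 1)) : DimLE I (P ⧸ mulTop P a) δ := by
  obtain ⟨n₀, h₀⟩ := h.exists_injective ha h𝔪 hI
  intro p hp hIp
  have hap : a ∈ p.asIdeal := Module.annihilator_le_of_mem_support hp (by
    rw [Module.mem_annihilator]
    intro u
    obtain ⟨u, rfl⟩ := Submodule.mkQ_surjective _ u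
    rw [← map_smul]
    exact (Submodule.Quotient.mk_eq_zero _).2 ⟨u, rfl⟩)
  have hpP := Module.support_subset_of_surjective _ (Submodule.mkQ_surjective _) hp
  let N : Submodule R P := I ^ n₀ • ⊤
  have hpN : p ∈ Module.support R N := by
    obtain ⟨u, hu⟩ := Module.mem_support_iff'.1 hpP
    obtain ⟨x, hx, hxp⟩ := Set.not_subset.1 hIp
    refine Module.mem_support_iff'.2 ⟨⟨x ^ n₀ • u, Submodule.smul_mem_smul
      (Ideal.pow_mem_pow hx _) Submodule.mem_top⟩, fun r hr h => ?_⟩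
    have h : r • x ^ n₀ • u = 0 := congrArg Subtype.val h
    rw [← mul_smul] at h
    refine hu _ (fun h' => ?_) h
    exact (p.isPrime.mem_or_mem h').elim hr fun h'' => hxp (p.isPrime.mem_of_pow_mem _ h'')
  obtain ⟨q, hq, hqp, haq⟩ := exists_lt_mem_support (P := N)
    (fun u hu => Subtype.ext (h₀ u u.2 (congrArg Subtype.val hu))) hpN hap
  have h1 := hd q (Module.support_subset_of_injective N.subtype N.injective_subtype hq)
    fun h => haq (h ha)
  have h2 := (Order.coheight_add_one_le hqp).trans h1
  push_cast at h2
  exact (ENat.add_le_add_iff_right ENat.one_ne_top).1 h2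

theorem DimLE.exists_pow_smul_eq_bot [IsNoetherianRing R] [IsLocalRing R] [Module.Finite R P]
    (h : DimLE I P 0) (hI : I ≠ ⊤) : ∃ n : ℕ, (I ^ n • ⊤ : Submodule R P) = ⊥ := by
  have hle : I ≤ (Module.annihilator R P).radical := by
    rw [Ideal.radical_eq_sInf]
    refine le_sInf fun p hp => ?_
    by_contra hIp
    have h0 := h ⟨p, hp.2⟩ (by rw [Module.support_eq_zeroLocus]; exact hp.1) hIp
    rw [Nat.cast_zero, nonpos_iff_eq_zero, Order.coheight_eq_zero] at h0
    have hle : (⟨p, hp.2⟩ : PrimeSpectrum R) ≤ IsLocalRing.closedPoint R :=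
      IsLocalRing.le_maximalIdeal hp.2.ne_top
    exact hIp ((IsLocalRing.le_maximalIdeal hI).trans (h0 hle))
  obtain ⟨n, hn⟩ := Ideal.exists_pow_le_of_le_radical_of_fg hle (IsNoetherian.noetherian I)
  refine ⟨n, eq_bot_iff.2 (Submodule.smul_le.2 fun r hr u _ => ?_)⟩
  rw [Submodule.mem_bot]
  exact Module.mem_annihilator.1 (hn hr) u

theorem DimLE.exists_biLen_eq_zero [IsNoetherianRing R] [IsLocalRing R] [Module.Finite R P]
    (h : DimLE I P 0) (hI : I ≠ ⊤) : ∃ n₀ : ℕ, ∀ n, n₀ ≤ n → ∀ s, biLen 𝔪 I P n s = 0 := by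
  obtain ⟨n₀, h⟩ := h.exists_pow_smul_eq_bot hI
  refine ⟨n₀, fun n hn s => relLength_eq_zero ?_⟩
  exact (Submodule.smul_mono_left (Ideal.pow_le_pow_right hn)).trans (h.le.trans bot_le)

end BiLen

section Bounds

variable {R : Type u} [CommRing R] [IsNoetherianRing R] [IsLocalRing R]

theorem pow_succ_add_pow_le (X δ : ℕ) : X ^ (δ + 1) + (X + 1) ^ δ ≤ (X + 1) ^ (δ + 1) := by
  have : X ^ δ ≤ (X + 1) ^ δ := Nat.pow_le_pow_left X.le_succ δ
  calc X ^ (δ + 1) + (X + 1) ^ δ = X * X ^ δ + (X + 1) ^ δ := by ring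
    _ ≤ X * (X + 1) ^ δ + (X + 1) ^ δ := by gcongr
    _ = (X + 1) ^ (δ + 1) := by ring

theorem mul_pow_succ_add_le {C C' X δ : ℕ} (h : C' ≤ C) :
    C * X ^ (δ + 1) + C' * (X + 1) ^ δ ≤ C * (X + 1) ^ (δ + 1) :=
  calc C * X ^ (δ + 1) + C' * (X + 1) ^ δ ≤ C * X ^ (δ + 1) + C * (X + 1) ^ δ := by gcongr
    _ = C * (X ^ (δ + 1) + (X + 1) ^ δ) := by ring
    _ ≤ C * (X + 1) ^ (δ + 1) := Nat.mul_le_mul_left _ (pow_succ_add_pow_le X δ)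

theorem relLength_pow_succ_le {V : Type w} [AddCommGroup V] [Module R V] {J : Ideal R} {a : R}
    (ha : a ∈ J) (s : ℕ) :
    relLength ⊤ (J ^ (s + 1) • ⊤ : Submodule R V) ≤ relLength ⊤ (J ^ s • ⊤ : Submodule R V) +
      relLength ⊤ (J ^ (s + 1) • ⊤ : Submodule R (V ⧸ mulTop V a)) := by
  set B : Submodule R V := J ^ (s + 1) • ⊤ with hB
  rw [relLength_add (le_sup_right : B ≤ mulTop V a ⊔ B) le_top]
  refine add_le_add ?_ (le_of_eq ?_)
  · rw [← relLength_congr (LinearMap.lsmul R V a) (A := ⊤) (B := B.comap (LinearMap.lsmul R V a))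
      (A' := mulTop V a ⊔ B) (B' := B)]
    · exact relLength_mono_right fun u hu => smul_mem_pow_smul ha hu
    · rw [Submodule.map_top, sup_assoc, sup_idem]
      rfl
    · exact fun _ _ => Iff.rfl
  · refine relLength_congr (mulTop V a).mkQ ?_ fun u _ => ?_
    · rw [Submodule.map_top, Submodule.range_mkQ]
    · rw [← map_pow_smul_top _ (mulTop V a).mkQ_surjective, mem_mkQ_map_iff, sup_comm]

theorem DimLE.exists_relLength_le [Infinite (IsLocalRing.ResidueField R)] {δ : ℕ} :
    ∀ {V : Type w} [AddCommGroup V] [Module R V] [Module.Finite R V],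
    DimLE (IsLocalRing.maximalIdeal R) V δ →
    ∃ C : ℕ, ∀ s, relLength ⊤ (IsLocalRing.maximalIdeal R ^ s • ⊤ : Submodule R V) ≤
      ((C * (s + 1) ^ δ : ℕ) : ℕ∞) := by
  have h𝔪 := (IsLocalRing.maximalIdeal.isMaximal R).ne_top
  induction δ with
  | zero =>
    intro V _ _ _ h
    obtain ⟨n, hn⟩ := h.exists_pow_smul_eq_bot h𝔪
    have hfin : relLength (⊤ : Submodule R V) ⊥ ≠ ⊤ := relLength_ne_top (k := n) hn.le
    refine ⟨(relLength (⊤ : Submodule R V) ⊥).toNat, fun s => ?_⟩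
    rw [pow_zero, mul_one, ENat.natCast_toNat hfin]
    exact relLength_mono_right bot_le
  | succ δ ih =>
    intro V _ _ _ h
    obtain ⟨a, ha, hgood⟩ := exists_goodElt V (IsLocalRing.maximalIdeal R)
    obtain ⟨C, hC⟩ := ih (hgood.dimLE_quotient ha h𝔪 h𝔪 h)
    refine ⟨C, fun s => ?_⟩
    induction s with
    | zero =>
      rw [relLength_eq_zero]
      · exact zero_le
      · rw [pow_zero, Ideal.one_eq_top, Submodule.top_smul]
    | succ s ihs =>
      refine (relLength_pow_succ_le ha s).trans ((add_le_add ihs (hC (s + 1))).trans ?_)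
      rw [← Nat.cast_add, Nat.cast_le]
      exact mul_pow_succ_add_le le_rfl

theorem exists_biLen_fixed_le [Infinite (IsLocalRing.ResidueField R)] {I : Ideal R} {P : Type w}
    [AddCommGroup P] [Module R P] [Module.Finite R P] {a : R} (haI : a ∈ I) {δ : ℕ}
    (hd : DimLE I P (δ + 1)) {n : ℕ} (ha : ∀ u ∈ (I ^ n • ⊤ : Submodule R P), a • u = 0 → u = 0) :
    ∃ C : ℕ, ∀ s, biLen (IsLocalRing.maximalIdeal R) I P n s ≤ ((C * (s + 1) ^ δ : ℕ) : ℕ∞) := by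
  let N : Submodule R P := I ^ n • ⊤
  let Q : Submodule R N := (I ^ (n + 1) • ⊤ : Submodule R P).comap N.subtype
  have hV : DimLE (IsLocalRing.maximalIdeal R) (N ⧸ Q) δ := by
    intro p hp _
    have hap : a ∈ p.asIdeal := Module.annihilator_le_of_mem_support hp (by
      rw [Module.mem_annihilator]
      intro u
      obtain ⟨u, rfl⟩ := Submodule.mkQ_surjective _ u
      rw [← map_smul]
      exact (Submodule.Quotient.mk_eq_zero _).2 (smul_mem_pow_smul haI u.2))
    obtain ⟨q, hq, hqp, haq⟩ := exists_lt_mem_support (P := N)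
      (fun u hu => Subtype.ext (ha u u.2 (congrArg Subtype.val hu)))
      (Module.support_subset_of_surjective _ Q.mkQ_surjective hp) hap
    have h1 := hd q (Module.support_subset_of_injective N.subtype N.injective_subtype hq)
      fun h => haq (h haI)
    have h2 := (Order.coheight_add_one_le hqp).trans h1
    push_cast at h2
    exact (ENat.add_le_add_iff_right ENat.one_ne_top).1 h2
  obtain ⟨C, hC⟩ := hV.exists_relLength_le
  refine ⟨C, fun s => le_trans (le_of_eq ?_) (hC s)⟩
  have hmap : (IsLocalRing.maximalIdeal R ^ s • ⊤ ⊔ Q).map N.subtype =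
      biE (IsLocalRing.maximalIdeal R) I P n s := by
    rw [Submodule.map_sup, Submodule.map_smul'', Submodule.map_top, Submodule.range_subtype,
      Submodule.map_comap_subtype, inf_eq_right.2
        (Submodule.smul_mono_left (Ideal.pow_le_pow_right n.le_succ))]
    rfl
  rw [← relLength_congr Q.mkQ (A := ⊤) (B := IsLocalRing.maximalIdeal R ^ s • ⊤ ⊔ Q)]
  · refine (relLength_congr N.subtype ?_ fun u _ => ?_).symm
    · rw [Submodule.map_top, Submodule.range_subtype]
    · rw [← hmap]
      exact ⟨fun ⟨v, hv, hvu⟩ => Subtype.ext hvu ▸ hv, fun h => ⟨u, h, rfl⟩⟩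
  · rw [Submodule.map_top, Submodule.range_mkQ]
  · intro u _
    rw [← mem_mkQ_map_iff, Submodule.map_smul'', Submodule.map_top, Submodule.range_mkQ]

theorem DimLE.exists_biLen_le [Infinite (IsLocalRing.ResidueField R)] {I : Ideal R} (hI : I ≠ ⊤)
    {δ : ℕ} : ∀ {P : Type w} [AddCommGroup P] [Module R P] [Module.Finite R P],
    DimLE I P (δ + 1) → ∃ C n₀ : ℕ, ∀ n, n₀ ≤ n → ∀ s,
      biLen (IsLocalRing.maximalIdeal R) I P n s ≤ ((C * (n + s + 1) ^ δ : ℕ) : ℕ∞) := by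
  have h𝔪 := (IsLocalRing.maximalIdeal.isMaximal R).ne_top
  induction δ with
  | zero =>
    intro P _ _ _ h
    obtain ⟨a, ha, hgood⟩ := exists_goodElt P I
    obtain ⟨n₁, h₁⟩ := hgood.exists_injective ha h𝔪 hI
    obtain ⟨n₂, h₂⟩ := (hgood.dimLE_quotient ha h𝔪 hI h).exists_biLen_eq_zero
      (𝔪 := IsLocalRing.maximalIdeal R) hI
    obtain ⟨n₃, h₃⟩ := hgood.biLen_succ ha h𝔪
    obtain ⟨C, hC⟩ := exists_biLen_fixed_le (n := n₁ + n₂ + n₃) ha h fun u hu => h₁ u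
      (Submodule.smul_mono_left (Ideal.pow_le_pow_right (by omega)) hu)
    refine ⟨C, n₁ + n₂ + n₃, fun n hn s => ?_⟩
    induction n, hn using Nat.le_induction with
    | base => simpa only [pow_zero] using hC s
    | succ n hn ih =>
      rw [h₃ n (by omega), h₂ (n + 1) (by omega), add_zero]
      simpa only [pow_zero] using ih
  | succ δ ih =>
    intro P _ _ _ h
    obtain ⟨a, ha, hgood⟩ := exists_goodElt P I
    obtain ⟨n₁, h₁⟩ := hgood.exists_injective ha h𝔪 hI
    obtain ⟨C', n₂, h₂⟩ := ih (hgood.dimLE_quotient ha h𝔪 hI h)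
    obtain ⟨n₃, h₃⟩ := hgood.biLen_succ ha h𝔪
    obtain ⟨C, hC⟩ := exists_biLen_fixed_le (n := n₁ + n₂ + n₃) ha h fun u hu => h₁ u
      (Submodule.smul_mono_left (Ideal.pow_le_pow_right (by omega)) hu)
    refine ⟨C + C', n₁ + n₂ + n₃, fun n hn s => ?_⟩
    induction n, hn using Nat.le_induction with
    | base =>
      refine (hC s).trans (Nat.cast_le.2 ?_)
      gcongr
      · omega
      · omega
    | succ n hn ih =>
      rw [h₃ n (by omega)]
      refine (add_le_add ih (h₂ (n + 1) (by omega) s)).trans ?_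
      rw [← Nat.cast_add, Nat.cast_le, show n + 1 + s + 1 = n + s + 1 + 1 by ring]
      exact mul_pow_succ_add_le (Nat.le_add_left _ _)

end Bounds

section LocalCohomology

variable {R : Type*} [CommRing R] {N : Type*} [AddCommGroup N] [Module R N]

theorem mem_H0 {I : Ideal R} {u : N} : u ∈ H0 I N ↔ ∃ r : ℕ, ∀ t ∈ I ^ r, t • u = 0 := by
  rw [H0, Submodule.mem_iSup_of_directed]
  · simp only [Submodule.mem_torsionBySet_iff, Subtype.forall, SetLike.mem_coe]
  · refine Monotone.directed_le fun r s h => ?_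
    exact Submodule.torsionBySet_le_torsionBySet_of_subset (Ideal.pow_le_pow_right h)

theorem mem_satur {I : Ideal R} {K : Submodule R N} {u : N} :
    u ∈ satur I K ↔ ∃ r : ℕ, ∀ t ∈ I ^ r, t • u ∈ K := by
  rw [satur, Submodule.mem_comap, mem_H0]
  simp only [← map_smul, ← LinearMap.mem_ker, Submodule.ker_mkQ]

/-- The preimage in `I^n N` of the zeroth local cohomology of `I^n N / I^(n+1) N`. -/
def locH (𝔪 I : Ideal R) (N : Type*) [AddCommGroup N] [Module R N] (n : ℕ) : Submodule R N :=
  satur 𝔪 (I ^ (n + 1) • ⊤) ⊓ I ^ n • ⊤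

theorem mem_locH {𝔪 I : Ideal R} {n : ℕ} {u : N} :
    u ∈ locH 𝔪 I N n ↔ (∃ r : ℕ, ∀ t ∈ 𝔪 ^ r, t • u ∈ (I ^ (n + 1) • ⊤ : Submodule R N)) ∧
      u ∈ (I ^ n • ⊤ : Submodule R N) := by
  rw [locH, Submodule.mem_inf, mem_satur]

theorem locH_le {𝔪 I : Ideal R} (n : ℕ) : locH 𝔪 I N n ≤ I ^ n • ⊤ := inf_le_right

theorem le_locH {𝔪 I : Ideal R} (n : ℕ) : I ^ (n + 1) • ⊤ ≤ locH 𝔪 I N n := fun _ hu =>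
  mem_locH.2 ⟨⟨0, fun t _ => Submodule.smul_mem _ t hu⟩,
    Submodule.smul_mono_left (Ideal.pow_le_pow_right n.le_succ) hu⟩

end LocalCohomology

section ArtinRees

variable {W L : Type*} [CommRing W] [AddCommGroup L] [Module W L]

theorem exists_pow_smul_inf_le [IsNoetherianRing W] [Module.Finite W L] (J : Ideal W)
    {H B : Submodule W L} {r : ℕ} (h : J ^ r • H ≤ B) :
    ∃ s₀ : ℕ, ∀ s, s₀ ≤ s → J ^ s • ⊤ ⊓ H ≤ B := by
  obtain ⟨c, hc⟩ := Ideal.exists_pow_inf_eq_pow_smul J H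
  refine ⟨c + r, fun s hs => ?_⟩
  rw [hc s (by omega)]
  exact (Submodule.smul_mono (Ideal.pow_le_pow_right (by omega)) inf_le_right).trans h

theorem exists_mem_of_smul_mem_sup [IsNoetherianRing W] [Module.Finite W L] (J : Ideal W)
    {H : Submodule W L} {y : W} (h : ∀ u, y • u ∈ H → u ∈ H) :
    ∃ c : ℕ, ∀ t, ∀ u, y • u ∈ H ⊔ J ^ (t + c) • ⊤ → u ∈ H ⊔ J ^ t • ⊤ := by
  obtain ⟨c, hc⟩ := Ideal.exists_pow_inf_eq_pow_smul J (mulTop (L ⧸ H) y)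
  refine ⟨c, fun t u hu => ?_⟩
  have hmap : ∀ k : ℕ, (J ^ k • ⊤ : Submodule W L).map H.mkQ = J ^ k • ⊤ := fun k => by
    rw [Submodule.map_smul'', Submodule.map_top, Submodule.range_mkQ]
  rw [sup_comm, ← mem_mkQ_map_iff, hmap] at hu ⊢
  have h1 : H.mkQ (y • u) ∈ J ^ (t + c) • ⊤ ⊓ mulTop (L ⧸ H) y :=
    ⟨hu, H.mkQ u, (map_smul _ _ _).symm⟩
  rw [hc _ (by omega), Nat.add_sub_cancel] at h1
  have h2 := Submodule.smul_mono (le_refl (J ^ t)) inf_le_right h1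
  rw [mulTop, LinearMap.range_eq_map, ← Submodule.map_smul''] at h2
  obtain ⟨v, hv, hvu⟩ := h2
  obtain ⟨v, rfl⟩ := H.mkQ_surjective v
  have h3 : v - u ∈ H := h _ (by
    rw [smul_sub, ← Submodule.ker_mkQ H, LinearMap.mem_ker, map_sub, sub_eq_zero, ← hvu]
    exact map_smul _ _ _)
  rw [← Submodule.ker_mkQ H, LinearMap.mem_ker, map_sub, sub_eq_zero] at h3
  rwa [← h3]

theorem exists_nonzerodivisor_mem {R : Type*} [CommRing R] [IsNoetherianRing W]
    [Module.Finite W L] (φ : R →+* W) (𝔪 : Ideal R)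
    (h : ∀ u : L, (∀ r ∈ 𝔪, φ r • u = 0) → u = 0) :
    ∃ z ∈ 𝔪, ∀ u : L, φ z • u = 0 → u = 0 := by
  by_contra! hcon
  have hsub : (𝔪 : Set R) ⊆ ⋃ q ∈ associatedPrimes W L, (q.comap φ : Ideal R) := fun z hz => by
    obtain ⟨u, hu, hne⟩ := hcon z hz
    have : φ z ∈ ⋃ q ∈ associatedPrimes W L, (q : Set W) := by
      rw [biUnion_associatedPrimes_eq_zero_divisors]
      exact ⟨u, hne, hu⟩
    simpa using this
  rw [Ideal.subset_union_prime_finite (associatedPrimes.finite W L) ⊥ ⊥ fun q hq _ _ =>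
    have : q.IsPrime := hq.1
    Ideal.comap_isPrime φ q] at hsub
  obtain ⟨q, hq, hle⟩ := hsub
  obtain ⟨hp, u, hu⟩ := isAssociatedPrime_iff.1 hq
  have h0 := h u fun r hr => by
    have : φ r ∈ q := hle hr
    rw [hu] at this
    simpa [Submodule.mem_colon] using this
  refine hp.ne_top (hu.trans ?_)
  rw [h0, Ideal.eq_top_iff_one]
  simp [Submodule.mem_colon]

end ArtinRees

section GradedIdeals

namespace GrMod

variable {R : Type u} [CommRing R] {κ : Type*} {ι : Type*} [AddCommMonoid ι] {r : κ → R}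
  {δ : κ → ι} {M : Type w} [AddCommGroup M] [Module R M]

theorem comp_C_smul (a : R) (p : ι) (f : GrMod r δ M) :
    comp p ((MvPolynomial.C a : MvPolynomial κ R) • f) = a • comp p f := by
  rw [smul_def, ← MvPolynomial.algebraMap_eq, AlgHom.commutes]
  rfl

theorem of_mem_map_smul (a : Ideal R) (T : Submodule (MvPolynomial κ R) (GrMod r δ M)) (p : ι)
    (N : Submodule R M) (h : ∀ u ∈ N, of r δ p u ∈ T) {u : M} (hu : u ∈ a • N) :
    of r δ p u ∈ a.map (MvPolynomial.C : R →+* MvPolynomial κ R) • T := by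
  refine Submodule.smul_induction_on hu (fun t ht n hn => ?_) fun x y hx hy => ?_
  · rw [← C_smul_of]
    exact Submodule.smul_mem_smul (Ideal.mem_map_of_mem _ ht) (h n hn)
  · rw [map_add]
    exact add_mem hx hy

theorem map_smul_le {a : Ideal R} {T T' : Submodule (MvPolynomial κ R) (GrMod r δ M)}
    (h : ∀ t ∈ a, ∀ f ∈ T, (MvPolynomial.C t : MvPolynomial κ R) • f ∈ T') :
    a.map (MvPolynomial.C : R →+* MvPolynomial κ R) • T ≤ T' := by
  refine Submodule.smul_le.2 fun t ht f hf => ?_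
  have : a.map (MvPolynomial.C : R →+* MvPolynomial κ R) ≤ T'.colon {f} :=
    Ideal.map_le_iff_le_comap.2 fun t ht => Submodule.mem_colon_singleton.2 (h t ht f hf)
  exact Submodule.mem_colon_singleton.1 (this ht)

end GrMod

end GradedIdeals

section GradedRees

open GrMod

variable {R : Type u} [CommRing R] {P : Type w} [AddCommGroup P] [Module R P]

theorem smul_mem_locH {𝔪 I : Ideal R} {a : R} (ha : a ∈ I) {n : ℕ} {u : P}
    (hu : u ∈ locH 𝔪 I P n) : a • u ∈ locH 𝔪 I P (n + 1) := by
  obtain ⟨⟨k, hk⟩, hu⟩ := mem_locH.1 hu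
  refine mem_locH.2 ⟨⟨k, fun t ht => ?_⟩, smul_mem_pow_smul ha hu⟩
  rw [smul_comm]
  exact smul_mem_pow_smul ha (hk t ht)

theorem mem_locH_of_forall_smul_mem [IsNoetherianRing R] {𝔪 I : Ideal R} {n : ℕ} {u : P}
    (hu : u ∈ (I ^ n • ⊤ : Submodule R P)) (h : ∀ t ∈ 𝔪, t • u ∈ locH 𝔪 I P n) :
    u ∈ locH 𝔪 I P n := by
  obtain ⟨s, hs⟩ := IsNoetherian.noetherian 𝔪
  have key : ∃ k : ℕ, ∀ t ∈ s, ∀ w ∈ 𝔪 ^ k, w • t • u ∈ (I ^ (n + 1) • ⊤ : Submodule R P) := by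
    have hmem : ∀ t ∈ s, t ∈ 𝔪 := fun t ht => hs ▸ Submodule.subset_span ht
    clear hs
    classical
    induction s using Finset.induction_on with
    | empty => exact ⟨0, by simp⟩
    | insert t s _ ih =>
      obtain ⟨k, hk⟩ := ih fun t ht => hmem t (Finset.mem_insert_of_mem ht)
      obtain ⟨⟨l, hl⟩, _⟩ := mem_locH.1 (h t (hmem t (Finset.mem_insert_self _ _)))
      refine ⟨k + l, fun t' ht' w hw => ?_⟩
      rcases Finset.mem_insert.1 ht' with rfl | h'
      · exact hl w (Ideal.pow_le_pow_right (by omega) hw)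
      · exact hk t' h' w (Ideal.pow_le_pow_right (by omega) hw)
  obtain ⟨k, hk⟩ := key
  refine mem_locH.2 ⟨⟨k + 1, fun t ht => ?_⟩, hu⟩
  have h1 : 𝔪 ^ (k + 1) ≤ (I ^ (n + 1) • ⊤ : Submodule R P).colon {u} := by
    rw [pow_succ, Ideal.mul_le]
    intro w hw t ht
    have h2 : 𝔪 ≤ ((I ^ (n + 1) • ⊤ : Submodule R P).colon {w • u}) := by
      rw [← hs, Submodule.span_le]
      intro t ht
      refine Submodule.mem_colon_singleton.2 ?_
      rw [smul_comm]
      exact hk t ht w hw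
    have h3 := Submodule.mem_colon_singleton.1 (h2 ht)
    refine Submodule.mem_colon_singleton.2 ?_
    rwa [mul_smul, smul_comm]
  exact Submodule.mem_colon_singleton.1 (h1 ht)

/-- The Rees module `⊕ I^n P` is finitely generated. -/
theorem fg_rees [Module.Finite R P] {I : Ideal R} {m : ℕ} (x : Fin m → R)
    (hx : Ideal.span (Set.range x) = I)
    (hA : ∀ t p, ∀ u ∈ (fun n : ℕ => (I ^ n • ⊤ : Submodule R P)) p,
      x t • u ∈ (fun n : ℕ => (I ^ n • ⊤ : Submodule R P)) (p + (fun _ => 1) t)) :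
    (fam x (fun _ => 1) _ hA).FG := by
  let W := MvPolynomial (Fin m) R
  let X : Ideal W := Ideal.span (Set.range fun l => MvPolynomial.X l)
  let T : Submodule W (GrMod x (fun _ => (1 : ℕ)) P) := Submodule.span W (Set.range (of x _ 0))
  have hgen : ∀ n, ∀ u ∈ (I ^ n • ⊤ : Submodule R P), of x (fun _ => 1) n u ∈ T := by
    intro n
    induction n with
    | zero => exact fun u _ => Submodule.subset_span ⟨u, rfl⟩
    | succ n ih =>
      intro u hu
      refine Submodule.smul_le_right (of_mem_smul (r := x) (δ := fun _ => 1) id 1 (fun _ => rfl)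
        T n _ ih (u := u) ?_)
      change u ∈ Ideal.span (Set.range x) • _
      rwa [hx, ← Submodule.mul_smul, ← pow_succ']
  have hT : fam x (fun _ => 1) _ hA = T := by
    refine le_antisymm (fun f hf => ?_) (Submodule.span_le.2 ?_)
    · exact mem_of_forall_comp_mem T.toAddSubmonoid f fun p => hgen p _ (hf p)
    · rintro _ ⟨u, rfl⟩
      refine of_mem_fam ?_
      rw [pow_zero, Ideal.one_eq_top, Submodule.top_smul]
      trivial
  rw [hT]
  exact span_of_zero_fg

theorem exists_rees_bounds [IsNoetherianRing R] [Module.Finite R P] (𝔪 I : Ideal R) :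
    (∃ s₀ : ℕ, ∀ s, s₀ ≤ s → ∀ n, ∀ u ∈ locH 𝔪 I P n,
      u ∈ (𝔪 ^ s • (I ^ n • ⊤) : Submodule R P) → u ∈ (I ^ (n + 1) • ⊤ : Submodule R P)) ∧
    ∀ s, ∃ y ∈ 𝔪 ^ s, ∃ c : ℕ, ∀ t n, ∀ u ∈ (I ^ n • ⊤ : Submodule R P),
      y • u ∈ locH 𝔪 I P n ⊔ 𝔪 ^ (t + c) • (I ^ n • ⊤) →
        u ∈ locH 𝔪 I P n ⊔ 𝔪 ^ t • (I ^ n • ⊤) := by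
  obtain ⟨m, x, hx⟩ := Submodule.fg_iff_exists_fin_generating_family.1 (IsNoetherian.noetherian I)
  have hxI : ∀ l, x l ∈ I := fun l => hx ▸ Submodule.subset_span ⟨l, rfl⟩
  let W := MvPolynomial (Fin m) R
  have hA : ∀ t p, ∀ u ∈ (fun n : ℕ => (I ^ n • ⊤ : Submodule R P)) p,
      x t • u ∈ (fun n : ℕ => (I ^ n • ⊤ : Submodule R P)) (p + (fun _ => 1) t) :=
    fun t p u hu => smul_mem_pow_smul (hxI t) hu
  have hB : ∀ t p, ∀ u ∈ (fun n : ℕ => (I ^ (n + 1) • ⊤ : Submodule R P)) p,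
      x t • u ∈ (fun n : ℕ => (I ^ (n + 1) • ⊤ : Submodule R P)) (p + (fun _ => 1) t) :=
    fun t p u hu => smul_mem_pow_smul (hxI t) hu
  have hH : ∀ t p, ∀ u ∈ (fun n : ℕ => locH 𝔪 I P n) p,
      x t • u ∈ (fun n : ℕ => locH 𝔪 I P n) (p + (fun _ => 1) t) :=
    fun t p u hu => smul_mem_locH (hxI t) hu
  have hAs : ∀ s : ℕ, ∀ t p, ∀ u ∈ (fun n : ℕ => (𝔪 ^ s • (I ^ n • ⊤) : Submodule R P)) p,
      x t • u ∈ (fun n : ℕ => (𝔪 ^ s • (I ^ n • ⊤) : Submodule R P)) (p + (fun _ => 1) t) :=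
    fun s t p u hu => smul_mem_pow_smul_pow_smul (hxI t) hu
  have hfin : Module.Finite W (fam x (fun _ => 1) _ hA) :=
    Module.Finite.iff_fg.2 (fg_rees x hx hA)
  let J : Ideal W := 𝔪.map MvPolynomial.C
  have hJ : ∀ s, J ^ s = (𝔪 ^ s).map MvPolynomial.C := fun s => (Ideal.map_pow _ _ _).symm
  let H : Submodule W (fam x (fun _ => 1) _ hA) :=
    (fam x (fun _ => 1) _ hH).comap (Submodule.subtype _)
  let B : Submodule W (fam x (fun _ => 1) _ hA) :=
    (fam x (fun _ => 1) _ hB).comap (Submodule.subtype _)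
  have hmap : ∀ s : ℕ,
      (J ^ s • ⊤ : Submodule W (fam x (fun _ => 1) _ hA)).map (Submodule.subtype _) =
      J ^ s • fam x (fun _ => 1) _ hA := fun s => by
    rw [Submodule.map_smul'', Submodule.map_top, Submodule.range_subtype]
  have hlift : ∀ s n, ∀ u (hu : u ∈ (I ^ n • ⊤ : Submodule R P)),
      u ∈ (𝔪 ^ s • (I ^ n • ⊤) : Submodule R P) →
      (⟨of x _ n u, of_mem_fam (hA := hA) (p := n) hu⟩ : fam x (fun _ => 1) _ hA) ∈
        (J ^ s • ⊤ : Submodule W (fam x (fun _ => 1) _ hA)) := by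
    intro s n u hu hus
    have h1 : of x (fun _ => 1) n u ∈ J ^ s • fam x (fun _ => 1) _ hA := by
      rw [hJ]
      exact of_mem_map_smul _ _ _ _ (fun v hv => of_mem_fam (hA := hA) (p := n) hv) hus
    rw [← hmap] at h1
    obtain ⟨f, hf, hfu⟩ := h1
    obtain rfl : f = ⟨of x _ n u, of_mem_fam (hA := hA) (p := n) hu⟩ := Subtype.ext hfu
    exact hf
  have hdesc : ∀ s, ∀ f ∈ (J ^ s • ⊤ : Submodule W (fam x (fun _ => 1) _ hA)), ∀ n,
      comp n f.1 ∈ (𝔪 ^ s • (I ^ n • ⊤) : Submodule R P) := by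
    intro s f hf
    have h1 : f.1 ∈ J ^ s • fam x (fun _ => 1) _ hA := by
      rw [← hmap]
      exact Submodule.mem_map_of_mem hf
    rw [hJ] at h1
    refine map_smul_le (T' := fam x (fun _ => 1) _ (hAs s)) (fun t ht g hg p => ?_) h1
    rw [comp_C_smul]
    exact Submodule.smul_mem_smul ht (hg p)
  constructor
  · have hle : H ≤ satur J B := by
      intro f hf
      have : f.1 ∈ satur J (fam x (fun _ => 1) _ hB) := by
        refine mem_of_forall_comp_mem (satur J (fam x (fun _ => 1) _ hB)).toAddSubmonoid _
          fun p => ?_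
        obtain ⟨⟨k, hk⟩, _⟩ := mem_locH.1 (hf p)
        refine mem_satur.2 ⟨k, fun t ht => ?_⟩
        rw [hJ] at ht
        have h1 : (𝔪 ^ k).map MvPolynomial.C ≤
            (fam x (fun _ => 1) _ hB).colon {of x (fun _ => 1) p (comp p f.1)} :=
          Ideal.map_le_iff_le_comap.2 fun t ht => Submodule.mem_colon_singleton.2 (by
            rw [C_smul_of]
            exact of_mem_fam (hA := hB) (p := p) (hk t ht))
        exact Submodule.mem_colon_singleton.1 (h1 ht)
      obtain ⟨k, hk⟩ := mem_satur.1 this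
      exact mem_satur.2 ⟨k, hk⟩
    obtain ⟨e, z, hz⟩ := Submodule.fg_iff_exists_fin_generating_family.1 (IsNoetherian.noetherian J)
    have hzJ : ∀ l, z l ∈ J := fun l => hz ▸ Submodule.subset_span ⟨l, rfl⟩
    obtain ⟨k, hk⟩ := exists_pow_smul_le_of_forall z H B fun f hf l => by
      obtain ⟨k, hk⟩ := mem_satur.1 (hle hf)
      exact ⟨k, hk _ (Ideal.pow_mem_pow (hzJ l) k)⟩
    change Ideal.span (Set.range z) = J at hz
    rw [hz] at hk
    obtain ⟨s₀, hs₀⟩ := exists_pow_smul_inf_le J hk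
    refine ⟨s₀, fun s hs n u hu hus => ?_⟩
    have h1 := hs₀ s hs ⟨hlift s n u (locH_le n hu) hus, of_mem_fam (hA := hH) (p := n) hu⟩ n
    have h2 : comp n (of x (fun _ => 1) n u) ∈ (I ^ (n + 1) • ⊤ : Submodule R P) := h1
    rwa [comp_of_same] at h2
  · obtain ⟨z, hz, hzd⟩ := exists_nonzerodivisor_mem (W := W)
      (L := fam x (fun _ => 1) _ hA ⧸ H) MvPolynomial.C 𝔪 (by
      intro u hu
      obtain ⟨f, rfl⟩ := H.mkQ_surjective u
      rw [← LinearMap.mem_ker, Submodule.ker_mkQ]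
      refine fun p => mem_locH_of_forall_smul_mem (f.2 p) fun t ht => ?_
      have h1 := hu t ht
      rw [← map_smul, ← LinearMap.mem_ker, Submodule.ker_mkQ] at h1
      have h2 := h1 p
      rwa [Submodule.subtype_apply, Submodule.coe_smul, comp_C_smul] at h2)
    have hzH : ∀ s : ℕ, ∀ f, (MvPolynomial.C (z ^ s) : W) • f ∈ H → f ∈ H := by
      intro s
      induction s with
      | zero =>
        intro f hf
        rwa [pow_zero, map_one, one_smul] at hf
      | succ s ih =>
        intro f hf
        rw [pow_succ, map_mul, mul_smul] at hf
        have h1 := ih _ hf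
        rw [← Submodule.ker_mkQ H, LinearMap.mem_ker, map_smul] at h1
        rw [← Submodule.ker_mkQ H, LinearMap.mem_ker]
        exact hzd _ h1
    intro s
    obtain ⟨c, hc⟩ := exists_mem_of_smul_mem_sup J (hzH s)
    refine ⟨z ^ s, Ideal.pow_mem_pow hz s, c, fun t n u hu hyu => ?_⟩
    obtain ⟨v, hv, w, hw, hvw⟩ := Submodule.mem_sup.1 hyu
    have h1 := hc t ⟨of x _ n u, of_mem_fam (hA := hA) (p := n) hu⟩ (by
      refine Submodule.mem_sup.2 ⟨⟨of x _ n v, of_mem_fam (hA := hA) (p := n) (locH_le n hv)⟩,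
        of_mem_fam (hA := hH) (p := n) hv, _, hlift _ n w (Submodule.smul_le_right hw) hw,
        Subtype.ext ?_⟩
      change of x _ n v + of x _ n w = MvPolynomial.C (z ^ s) • of x _ n u
      rw [C_smul_of, ← hvw, map_add])
    obtain ⟨f, hf, g, hg, hfg⟩ := Submodule.mem_sup.1 h1
    have h2 : comp n f.1 + comp n g.1 = u := by
      rw [← map_add, ← comp_of_same (r := x) (δ := fun _ => 1) n u]
      exact congrArg (fun q => comp n q.1) hfg
    rw [← h2]
    exact Submodule.add_mem_sup (hf n) (hdesc _ g hg n)

end GradedRees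

section Comparison

variable {R : Type u} [CommRing R] {P : Type w} [AddCommGroup P] [Module R P]

theorem relLength_add_le_of_smul {A H : Submodule R P} (hHA : H ≤ A) {𝔞 : ℕ → Ideal R}
    (h𝔞 : Antitone 𝔞) {y : R} {s t c : ℕ} (hsc : s ≤ c) (hy : y ∈ 𝔞 s)
    (h : ∀ u ∈ A, y • u ∈ H ⊔ 𝔞 (t + c) • A → u ∈ H ⊔ 𝔞 t • A) :
    relLength A (H ⊔ 𝔞 s • A) + relLength A (H ⊔ 𝔞 t • A) ≤
      relLength A (H ⊔ 𝔞 (t + c) • A) := by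
  let D := H ⊔ 𝔞 (t + c) • A
  have hDA : D ≤ A := sup_le hHA Submodule.smul_le_right
  have hyA : A.map (LinearMap.lsmul R P y) ≤ 𝔞 s • A := by
    rintro _ ⟨u, hu, rfl⟩
    exact Submodule.smul_mem_smul hy hu
  have hle : A.map (LinearMap.lsmul R P y) ⊔ D ≤ H ⊔ 𝔞 s • A :=
    sup_le (hyA.trans le_sup_right) (sup_le_sup_left
      (Submodule.smul_mono_left (h𝔞 (by omega))) _)
  have hle' : A.map (LinearMap.lsmul R P y) ⊔ D ≤ A :=
    hle.trans (sup_le hHA Submodule.smul_le_right)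
  rw [add_comm, relLength_add (le_sup_right : D ≤ A.map (LinearMap.lsmul R P y) ⊔ D) hle']
  refine add_le_add ?_ (relLength_mono_right hle)
  have : relLength A (A ⊓ D.comap (LinearMap.lsmul R P y)) =
      relLength (A.map (LinearMap.lsmul R P y) ⊔ D) D :=
    relLength_congr (LinearMap.lsmul R P y) (by rw [sup_assoc, sup_idem])
      fun u hu => ⟨fun h => ⟨hu, h⟩, fun h => h.2⟩
  rw [← this]
  exact relLength_mono_right fun u hu => h u hu.1 hu.2

theorem biLen_eq_add {𝔪 I : Ideal R} {n s : ℕ} (h : ∀ u ∈ locH 𝔪 I P n,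
    u ∈ (𝔪 ^ s • (I ^ n • ⊤) : Submodule R P) → u ∈ (I ^ (n + 1) • ⊤ : Submodule R P)) :
    biLen 𝔪 I P n s = relLength (locH 𝔪 I P n) (I ^ (n + 1) • ⊤) +
      relLength (I ^ n • ⊤) (locH 𝔪 I P n ⊔ 𝔪 ^ s • (I ^ n • ⊤)) := by
  have hle : biE 𝔪 I P n s ≤ locH 𝔪 I P n ⊔ 𝔪 ^ s • (I ^ n • ⊤) :=
    sup_le le_sup_right ((le_locH n).trans le_sup_left)
  rw [biLen, relLength_add hle (sup_le (locH_le n) Submodule.smul_le_right)]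
  congr 1
  refine (relLength_congr LinearMap.id ?_ fun u hu => ?_).symm
  · rw [Submodule.map_id]
    exact le_antisymm (sup_le_sup_right le_sup_left _)
      (sup_le (sup_le_sup_left (smul_le_biE n s) _) le_sup_right)
  · refine ⟨fun hE => ?_, fun hu' => le_biE n s hu'⟩
    obtain ⟨v, hv, w, hw, hvw⟩ := Submodule.mem_sup.1 hE
    have hvH : v ∈ locH 𝔪 I P n := by
      rw [← add_sub_cancel_right v w, hvw]
      exact sub_mem hu (le_locH n hw)
    change v + w = u at hvw
    rw [← hvw]
    exact add_mem (h v hvH hv) hw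

theorem DimLE.exists_biLen_eq_locH_add [IsNoetherianRing R] [IsLocalRing R]
    [Infinite (IsLocalRing.ResidueField R)] [Module.Finite R P] {I : Ideal R} (hI : I ≠ ⊤)
    {δ : ℕ} (hP : DimLE I P (δ + 1)) :
    ∃ s₀ : ℕ, ∀ s, s₀ ≤ s → ∃ C n₀ : ℕ, ∀ n, n₀ ≤ n → ∃ e : ℕ,
      (biLen (IsLocalRing.maximalIdeal R) I P n s).toNat =
        (relLength (locH (IsLocalRing.maximalIdeal R) I P n) (I ^ (n + 1) • ⊤)).toNat + e ∧
      n * e ≤ C * n ^ δ := by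
  obtain ⟨⟨s₀, hs₀⟩, hreg⟩ := exists_rees_bounds (P := P) (IsLocalRing.maximalIdeal R) I
  obtain ⟨C, n₀, hC⟩ := hP.exists_biLen_le hI
  refine ⟨s₀, fun s hs => ?_⟩
  obtain ⟨y, hy, c', hc'⟩ := hreg s
  let c := c' + s
  let q : ℕ → ℕ → ℕ∞ := fun n t => relLength (I ^ n • ⊤ : Submodule R P)
    (locH (IsLocalRing.maximalIdeal R) I P n ⊔
      IsLocalRing.maximalIdeal R ^ t • (I ^ n • ⊤))
  have hq : ∀ n t, q n s + q n t ≤ q n (t + c) := fun n t =>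
    relLength_add_le_of_smul (locH_le n) (𝔞 := fun t => IsLocalRing.maximalIdeal R ^ t)
      (fun _ _ h => Ideal.pow_le_pow_right h) (Nat.le_add_left _ _) hy fun u hu h => by
        have hle : locH (IsLocalRing.maximalIdeal R) I P n ⊔
            IsLocalRing.maximalIdeal R ^ (t + c) • (I ^ n • ⊤) ≤
            locH (IsLocalRing.maximalIdeal R) I P n ⊔
            IsLocalRing.maximalIdeal R ^ (t + c') • (I ^ n • ⊤) :=
          sup_le_sup_left (Submodule.smul_mono_left (Ideal.pow_le_pow_right (by omega))) _
        exact hc' t n u hu (hle h)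
  have hmul : ∀ n j : ℕ, (j : ℕ∞) * q n s ≤ q n (j * c) := by
    intro n j
    induction j with
    | zero => simp
    | succ j ih =>
      rw [Nat.cast_add, Nat.cast_one, add_mul, one_mul, add_mul, one_mul, add_comm]
      exact (add_le_add_right ih _).trans (hq n _)
  have hqle : ∀ n t, q n t ≤ biLen (IsLocalRing.maximalIdeal R) I P n t := fun n t =>
    relLength_mono_right (sup_le le_sup_right ((le_locH n).trans le_sup_left))
  have hqtop : ∀ n t, q n t ≠ ⊤ := fun n t => ne_top_of_le_ne_top (biLen_ne_top n t) (hqle n t)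
  refine ⟨C * (c + 2) ^ δ, n₀ + 1, fun n hn => ⟨(q n s).toNat, ?_, ?_⟩⟩
  · have h1 := biLen_eq_add (hs₀ s hs n)
    have h2 : relLength (locH (IsLocalRing.maximalIdeal R) I P n) (I ^ (n + 1) • ⊤) ≠ ⊤ := by
      refine ne_top_of_le_ne_top (biLen_ne_top (I := I) (P := P) n s) ?_
      rw [h1]
      exact le_self_add
    rw [h1, ENat.toNat_add h2 (hqtop n s)]
  · have h1 := (hmul n n).trans ((hqle n (n * c)).trans (hC n (by omega) (n * c)))
    rw [← ENat.natCast_toNat (hqtop n s), ← Nat.cast_mul, Nat.cast_le] at h1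
    refine h1.trans ?_
    rw [mul_assoc, ← mul_pow]
    gcongr
    nlinarith

end Comparison

section Asymptotics

open Asymptotics

/-- The sequence `u` grows like `c * (n+e choose e)`, up to lower order terms. -/
def GrowsLike (u : ℕ → ℝ) (e : ℕ) (c : ℝ) : Prop :=
  (fun n => u n - c * ((n + e).choose e : ℝ)) =o[atTop] fun n : ℕ => ((n : ℝ) + 1) ^ e

theorem GrowsLike.of_eventually_const {u : ℕ → ℝ} {n₀ : ℕ} (h : ∀ n, n₀ ≤ n → u (n + 1) = u n) :
    ∃ c, GrowsLike u 0 c := by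
  refine ⟨u n₀, ?_⟩
  have : (fun n => u n - u n₀ * ((n + 0).choose 0 : ℝ)) =ᶠ[atTop] fun _ => 0 := by
    filter_upwards [eventually_ge_atTop n₀] with n hn
    have : u n = u n₀ := by
      induction n, hn using Nat.le_induction with
      | base => rfl
      | succ n hn ih => rw [h n hn, ih]
    simp [this]
  exact this.trans_isLittleO (isLittleO_zero _ _)

theorem GrowsLike.of_succ_eq {u v : ℕ → ℝ} {e : ℕ} {c : ℝ} (hv : GrowsLike v e c) {n₀ : ℕ}
    (h : ∀ n, n₀ ≤ n → u (n + 1) = u n + v (n + 1)) : GrowsLike u (e + 1) c := by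
  have h1 : (fun n => v (n + 1) - c * ((n + 1 + e).choose e : ℝ)) =o[atTop]
      fun n : ℕ => ((n : ℝ) + 2) ^ e := by
    have := hv.comp_tendsto (tendsto_add_atTop_nat 1)
    refine this.congr (fun _ => rfl) fun n => ?_
    simp only [Function.comp_apply]
    push_cast
    ring
  let f : ℕ → ℝ := fun n => u n - c * ((n + (e + 1)).choose (e + 1) : ℝ)
  have h2 : (fun n => f (n + 1) - f n) =o[atTop] fun n : ℕ => ((n : ℝ) + 2) ^ e := by
    refine h1.congr' ?_ EventuallyEq.rfl
    filter_upwards [eventually_ge_atTop n₀] with n hn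
    have hc : (n + 1 + (e + 1)).choose (e + 1) =
        (n + 1 + e).choose e + (n + (e + 1)).choose (e + 1) := by
      rw [show n + 1 + (e + 1) = (n + 1 + e) + 1 by ring, Nat.choose_succ_succ,
        show n + (e + 1) = n + 1 + e by ring]
    simp only [f]
    rw [h n hn, hc]
    push_cast
    ring
  have h3 := h2.sum_range (fun n => by positivity) (by
    refine tendsto_atTop_mono (fun n => ?_) (tendsto_natCast_atTop_atTop (R := ℝ))
    calc (n : ℝ) = ∑ _i ∈ Finset.range n, (1 : ℝ) := by simp
      _ ≤ _ := Finset.sum_le_sum fun i _ => one_le_pow₀ (by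
        have : (0 : ℝ) ≤ i := Nat.cast_nonneg i
        linarith))
  simp only [Finset.sum_range_sub] at h3
  have h4 : (fun n : ℕ => ∑ i ∈ Finset.range n, ((i : ℝ) + 2) ^ e) =O[atTop]
      fun n : ℕ => ((n : ℝ) + 1) ^ (e + 1) := by
    refine IsBigO.of_bound 1 (Eventually.of_forall fun n => ?_)
    rw [one_mul, Real.norm_of_nonneg (by positivity), Real.norm_of_nonneg (by positivity)]
    calc ∑ i ∈ Finset.range n, ((i : ℝ) + 2) ^ e
        ≤ ∑ _i ∈ Finset.range n, ((n : ℝ) + 1) ^ e := Finset.sum_le_sum fun i hi => by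
          have : ((i + 1 : ℕ) : ℝ) ≤ n := Nat.cast_le.2 (Finset.mem_range.1 hi)
          push_cast at this
          exact pow_le_pow_left₀ (by positivity) (by linarith) e
      _ = n * ((n : ℝ) + 1) ^ e := by simp
      _ ≤ ((n : ℝ) + 1) ^ (e + 1) := by
        rw [pow_succ']
        gcongr
        linarith
  have h5 : (fun _ : ℕ => f 0) =o[atTop] fun n : ℕ => ((n : ℝ) + 1) ^ (e + 1) := by
    refine isLittleO_const_left.2 (Or.inr ?_)
    refine tendsto_norm_atTop_atTop.comp ((tendsto_pow_atTop e.succ_ne_zero).comp ?_)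
    exact tendsto_atTop_add_const_right _ _ tendsto_natCast_atTop_atTop
  refine ((h3.trans_isBigO h4).add h5).congr (fun n => ?_) fun _ => rfl
  rw [sub_add_cancel]

theorem GrowsLike.tendsto {u h : ℕ → ℝ} {e : ℕ} {c C : ℝ} (hu : GrowsLike u e c) {n₀ : ℕ}
    (hle : ∀ n, n₀ ≤ n → h n ≤ u n) (hh : ∀ n : ℕ, n₀ ≤ n → n * (u n - h n) ≤ C * (n : ℝ) ^ e) :
    Tendsto (fun n : ℕ => (e.factorial : ℝ) / (n : ℝ) ^ e * h n) atTop (nhds c) := by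
  have hshift : Tendsto (fun n : ℕ => ((n : ℝ) + e) / n) atTop (nhds 1) := by
    have h1 : Tendsto (fun n : ℕ => 1 + (e : ℝ) / n) atTop (nhds (1 + 0)) :=
      tendsto_const_nhds.add (tendsto_const_div_atTop_nhds_zero_nat _)
    rw [add_zero] at h1
    refine h1.congr' ?_
    filter_upwards [eventually_gt_atTop 0] with n hn
    field_simp
  have hshift' : Tendsto (fun n : ℕ => ((n : ℝ) + 1) / n) atTop (nhds 1) := by
    have h1 : Tendsto (fun n : ℕ => 1 + (1 : ℝ) / n) atTop (nhds (1 + 0)) :=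
      tendsto_const_nhds.add (tendsto_const_div_atTop_nhds_zero_nat _)
    rw [add_zero] at h1
    refine h1.congr' ?_
    filter_upwards [eventually_gt_atTop 0] with n hn
    field_simp
  have hchoose : Tendsto (fun n : ℕ => (e.factorial : ℝ) / (n : ℝ) ^ e * ((n + e).choose e : ℝ))
      atTop (nhds 1) := by
    have h1 := (isEquivalent_iff_tendsto_one ?_).1 (isEquivalent_choose e)
    · have h2 := (h1.comp (tendsto_add_atTop_nat e)).mul (hshift.pow e)
      rw [one_pow, one_mul] at h2
      refine h2.congr' ?_
      filter_upwards [eventually_gt_atTop 0] with n hn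
      simp only [Function.comp_apply, Pi.div_apply]
      push_cast
      rw [div_pow]
      field_simp
    · filter_upwards [eventually_gt_atTop 0] with n hn
      positivity
  have hlow : Tendsto (fun n : ℕ => (u n - c * ((n + e).choose e : ℝ)) / ((n : ℝ) + 1) ^ e) atTop
      (nhds 0) := hu.tendsto_div_nhds_zero
  have herr : Tendsto (fun n : ℕ => (u n - h n) / (n : ℝ) ^ e) atTop (nhds 0) := by
    refine tendsto_of_tendsto_of_tendsto_of_le_of_le' tendsto_const_nhds
      (tendsto_const_div_atTop_nhds_zero_nat C) ?_ ?_
    · filter_upwards [eventually_ge_atTop n₀] with n hn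
      have := hle n hn
      exact div_nonneg (by linarith) (by positivity)
    · filter_upwards [eventually_ge_atTop n₀, eventually_gt_atTop 0] with n hn hpos
      have h1 := hh n hn
      have hpos' : (0 : ℝ) < n := Nat.cast_pos.2 hpos
      rw [div_le_div_iff₀ (by positivity) hpos', mul_comm]
      exact h1
  have := ((hchoose.const_mul c).add
    ((hlow.mul (hshift'.pow e)).const_mul (e.factorial : ℝ))).sub
    (herr.const_mul (e.factorial : ℝ))
  simp only [mul_one, zero_mul, mul_zero, add_zero, sub_zero] at this
  refine this.congr' ?_
  filter_upwards [eventually_gt_atTop 0] with n hn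
  have hpos' : (0 : ℝ) < n := Nat.cast_pos.2 hn
  rw [div_pow]
  field_simp
  ring

end Asymptotics

section Growth

variable {R : Type u} [CommRing R] [IsNoetherianRing R] [IsLocalRing R] {I : Ideal R}

theorem GoodElt.growsLike {P : Type w} [AddCommGroup P] [Module R P] [Module.Finite R P] {a : R}
    (h : GoodElt (IsLocalRing.maximalIdeal R) I P a) (ha : a ∈ I) {s e : ℕ} {c : ℝ}
    (hc : GrowsLike (fun n => ((biLen (IsLocalRing.maximalIdeal R) I (P ⧸ mulTop P a) n s).toNat : ℝ)) e c) :
    GrowsLike (fun n => ((biLen (IsLocalRing.maximalIdeal R) I P n s).toNat : ℝ)) (e + 1) c := by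
  obtain ⟨n₀, hn₀⟩ := h.biLen_succ ha (IsLocalRing.maximalIdeal.isMaximal R).ne_top
  refine hc.of_succ_eq (n₀ := n₀) fun n hn => ?_
  rw [hn₀ n hn s, ENat.toNat_add (biLen_ne_top n s) (biLen_ne_top (n + 1) s), Nat.cast_add]

theorem DimLE.exists_growsLike [Infinite (IsLocalRing.ResidueField R)] (hI : I ≠ ⊤) (s : ℕ)
    {e : ℕ} : ∀ {P : Type w} [AddCommGroup P] [Module R P] [Module.Finite R P],
    DimLE I P (e + 1) → ∃ c, GrowsLike (fun n => ((biLen (IsLocalRing.maximalIdeal R) I P n s).toNat : ℝ)) e c := by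
  have h𝔪 := (IsLocalRing.maximalIdeal.isMaximal R).ne_top
  induction e with
  | zero =>
    intro P _ _ _ h
    obtain ⟨a, ha, hgood⟩ := exists_goodElt P I
    obtain ⟨n₁, h₁⟩ := hgood.biLen_succ ha h𝔪
    obtain ⟨n₂, h₂⟩ := (hgood.dimLE_quotient ha h𝔪 hI h).exists_biLen_eq_zero (𝔪 := IsLocalRing.maximalIdeal R) hI
    refine GrowsLike.of_eventually_const (n₀ := n₁ + n₂) fun n hn => ?_
    rw [h₁ n (by omega) s, h₂ (n + 1) (by omega) s, add_zero]
  | succ e ih =>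
    intro P _ _ _ h
    obtain ⟨a, ha, hgood⟩ := exists_goodElt P I
    obtain ⟨c, hc⟩ := ih (hgood.dimLE_quotient ha h𝔪 hI h)
    exact ⟨c, hgood.growsLike ha hc⟩

/-- `(P/K)/a(P/K)` is `P/(K + aP)`. -/
noncomputable def quotientMulTopEquiv {P : Type w} [AddCommGroup P] [Module R P]
    (K : Submodule R P) (a : R) :
    ((P ⧸ K) ⧸ mulTop (P ⧸ K) a) ≃ₗ[R] P ⧸ (K ⊔ mulTop P a) :=
  (Submodule.quotEquivOfEq _ _ (by
    rw [Submodule.map_sup, Submodule.mkQ_map_self, bot_sup_eq]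
    refine le_antisymm ?_ ?_
    · rintro _ ⟨u, rfl⟩
      obtain ⟨u, rfl⟩ := K.mkQ_surjective u
      exact ⟨a • u, ⟨u, rfl⟩, map_smul _ _ _⟩
    · rintro _ ⟨_, ⟨u, rfl⟩, rfl⟩
      exact ⟨K.mkQ u, (map_smul _ _ _).symm⟩)).trans
    (Submodule.quotientQuotientEquivQuotient K (K ⊔ mulTop P a) le_sup_left)

theorem DimLE.of_surjective {P P' : Type*} [AddCommGroup P] [Module R P] [AddCommGroup P']
    [Module R P'] {δ : ℕ} (h : DimLE I P δ) (f : P →ₗ[R] P') (hf : Function.Surjective f) :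
    DimLE I P' δ :=
  fun p hp => h p (Module.support_subset_of_surjective f hf hp)

theorem sup_mulTop_sup_span {P : Type w} [AddCommGroup P] [Module R P] (K : Submodule R P) (a : R)
    (as : List R) : K ⊔ mulTop P a ⊔ Ideal.span {b | b ∈ as} • ⊤ =
      K ⊔ Ideal.span {b | b ∈ a :: as} • ⊤ := by
  have h1 : {b | b ∈ a :: as} = {a} ∪ {b | b ∈ as} := by
    ext b
    simp
  have h2 : (Ideal.span {a} • ⊤ : Submodule R P) = mulTop P a := by
    ext u
    rw [Submodule.ideal_span_singleton_smul, Submodule.mem_smul_pointwise_iff_exists, mem_mulTop]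
    simp
  rw [h1, Ideal.span_union, Submodule.sup_smul, h2, sup_assoc]

theorem chain_dimLE {P : Type w} [AddCommGroup P] [Module R P] [Module.Finite R P] (hI : I ≠ ⊤)
    {e : ℕ} (as : List R) (haI : ∀ a ∈ as, a ∈ I) (K : Submodule R P)
    (h : GoodChain (IsLocalRing.maximalIdeal R) I K as) (hK : DimLE I (P ⧸ K) (e + as.length)) :
    DimLE I (P ⧸ (K ⊔ Ideal.span {a | a ∈ as} • ⊤)) e := by
  have h𝔪 := (IsLocalRing.maximalIdeal.isMaximal R).ne_top
  induction as generalizing K with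
  | nil =>
    refine hK.of_surjective (Submodule.factor le_sup_left) (Submodule.factor_surjective _)
  | cons a as ih =>
    have h1 := h.1.dimLE_quotient (haI a List.mem_cons_self) h𝔪 hI (δ := e + as.length) hK
    have h2 := ih (fun b hb => haI b (List.mem_cons_of_mem _ hb)) _ h.2
      (h1.of_surjective (quotientMulTopEquiv K a).toLinearMap (quotientMulTopEquiv K a).surjective)
    refine h2.of_surjective (Submodule.factor (le_of_eq ?_)) (Submodule.factor_surjective _)
    exact sup_mulTop_sup_span K a as

theorem chain_growsLike {P : Type w} [AddCommGroup P] [Module R P] [Module.Finite R P]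
    {e s : ℕ} {c : ℝ} (as : List R) (haI : ∀ a ∈ as, a ∈ I) (K : Submodule R P)
    (h : GoodChain (IsLocalRing.maximalIdeal R) I K as) (hc : GrowsLike (fun n => ((biLen (IsLocalRing.maximalIdeal R) I
      (P ⧸ (K ⊔ Ideal.span {a | a ∈ as} • ⊤)) n s).toNat : ℝ)) e c) :
    GrowsLike (fun n => ((biLen (IsLocalRing.maximalIdeal R) I (P ⧸ K) n s).toNat : ℝ)) (e + as.length) c := by
  induction as generalizing K with
  | nil =>
    have : K ⊔ Ideal.span {a : R | a ∈ []} • ⊤ = K := by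
      simp
    rwa [this] at hc
  | cons a as ih =>
    refine h.1.growsLike (haI a List.mem_cons_self) (e := e + as.length) ?_
    simp only [biLen_eq_of_equiv (quotientMulTopEquiv K a)]
    refine ih (fun b hb => haI b (List.mem_cons_of_mem _ hb)) _ h.2 ?_
    rwa [sup_mulTop_sup_span]

end Growth

section Saturation

variable {R : Type u} [CommRing R] [IsNoetherianRing R] {I : Ideal R}

theorem exists_pow_smul_le_of_le_satur {P : Type w} [AddCommGroup P] [Module R P]
    [Module.Finite R P] {G K : Submodule R P} (h : G ≤ satur I K) : ∃ k : ℕ, I ^ k • G ≤ K := by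
  obtain ⟨m, x, hx⟩ := Submodule.fg_iff_exists_fin_generating_family.1 (IsNoetherian.noetherian I)
  change Ideal.span (Set.range x) = I at hx
  have := exists_pow_smul_le_of_forall x G K fun u hu l => by
    obtain ⟨r, hr⟩ := mem_satur.1 (h hu)
    exact ⟨r, hr _ (Ideal.pow_mem_pow (hx ▸ Ideal.subset_span ⟨l, rfl⟩) r)⟩
  rwa [hx] at this

theorem le_satur {P : Type w} [AddCommGroup P] [Module R P] (K : Submodule R P) : K ≤ satur I K :=
  fun _ hu => mem_satur.2 ⟨0, fun t _ => K.smul_mem t hu⟩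

theorem exists_biLen_eq_of_surjective {𝔪 : Ideal R} {P P' : Type*} [AddCommGroup P] [Module R P]
    [Module.Finite R P] [AddCommGroup P'] [Module R P'] (f : P →ₗ[R] P')
    (hf : Function.Surjective f) {k : ℕ} (hk : I ^ k • LinearMap.ker f = ⊥) :
    ∃ n₀ : ℕ, ∀ n, n₀ ≤ n → ∀ s, biLen 𝔪 I P n s = biLen 𝔪 I P' n s := by
  obtain ⟨n₀, h₀⟩ := exists_pow_smul_inf_le I hk.le
  refine ⟨n₀, fun n hn s => relLength_congr f ?_ fun u hu => ?_⟩
  · rw [map_pow_smul_top f hf]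
  · rw [← map_biE f hf]
    refine ⟨fun ⟨v, hv, hvu⟩ => ?_, fun h => ⟨u, h, rfl⟩⟩
    have h1 := h₀ n hn (x := v - u) ⟨sub_mem (biE_le n s hv) hu, by
      rw [SetLike.mem_coe, LinearMap.mem_ker, map_sub, hvu, sub_self]⟩
    rw [Submodule.mem_bot, sub_eq_zero] at h1
    rwa [← h1]

theorem exists_biLen_quotient_satur {𝔪 : Ideal R} {P : Type w} [AddCommGroup P] [Module R P]
    [Module.Finite R P] (K : Submodule R P) :
    ∃ n₀ : ℕ, ∀ n, n₀ ≤ n → ∀ s,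
      biLen 𝔪 I (P ⧸ satur I K) n s = biLen 𝔪 I (P ⧸ K) n s := by
  obtain ⟨k, hk⟩ := exists_pow_smul_le_of_le_satur (le_refl (satur I K))
  obtain ⟨n₀, h₀⟩ := exists_biLen_eq_of_surjective (𝔪 := 𝔪) (I := I) (Submodule.factor (le_satur (I := I) K))
    (Submodule.factor_surjective _) (k := k) (by
      rw [eq_bot_iff, Submodule.smul_le]
      intro t ht u hu
      obtain ⟨u, rfl⟩ := K.mkQ_surjective u
      have hu : u ∈ satur I K := (Submodule.Quotient.mk_eq_zero _).1 hu
      exact (Submodule.Quotient.mk_eq_zero K).2 (hk (Submodule.smul_mem_smul ht hu)))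
  exact ⟨n₀, fun n hn s => (h₀ n hn s).symm⟩

theorem eq_zero_of_pow_smul_eq_zero {P : Type w} [AddCommGroup P] [Module R P]
    [Module.Finite R P] {K : Submodule R P} {u : P ⧸ satur I K} (h : ∀ t ∈ I, t • u = 0) :
    u = 0 := by
  obtain ⟨k, hk⟩ := exists_pow_smul_le_of_le_satur (le_refl (satur I K))
  obtain ⟨u, rfl⟩ := Submodule.mkQ_surjective _ u
  refine (Submodule.Quotient.mk_eq_zero _).2 (mem_satur.2 ⟨k + 1, fun t ht => ?_⟩)
  have hle : I ^ (k + 1) ≤ K.colon {u} := by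
    rw [pow_succ, Ideal.mul_le]
    intro r hr t ht
    refine Submodule.mem_colon_singleton.2 ?_
    rw [mul_smul]
    exact hk (Submodule.smul_mem_smul hr ((Submodule.Quotient.mk_eq_zero _).1 (h t ht)))
  exact Submodule.mem_colon_singleton.1 (hle ht)

end Saturation

section Dimension

variable {R : Type u} [CommRing R] {I : Ideal R} {P : Type w} [AddCommGroup P] [Module R P]
  [Module.Finite R P] {δ : ℕ}

theorem mDim_le_iff : mDim R P ≤ (δ : WithBot ℕ∞) ↔
    ∀ p ∈ Module.support R P, Order.coheight p ≤ δ := by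
  have hco : ∀ p : PrimeSpectrum.zeroLocus (Module.annihilator R P : Set R),
      Order.coheight p = Order.coheight p.1 := fun p => by
    refine Order.coheight_eq_of_strictMono Subtype.val (fun _ _ h => h) (fun p' q hq => ?_) p
    exact ⟨⟨q, Set.Subset.trans p'.2 hq.le⟩, hq, rfl⟩
  rw [mDim, ringKrullDim_quotient, Module.support_eq_zeroLocus]
  refine ⟨fun h p hp => ?_, fun h => ?_⟩
  · have := (Order.coheight_le_krullDim (⟨p, hp⟩ : PrimeSpectrum.zeroLocus _)).trans h
    rw [hco] at this
    exact_mod_cast this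
  · rw [Order.krullDim_eq_iSup_coheight]
    refine iSup_le fun p => ?_
    rw [hco]
    exact_mod_cast h p.1 p.2

theorem DimLE.of_mDim_le (h : mDim R P ≤ (δ : WithBot ℕ∞)) : DimLE I P δ :=
  fun p hp _ => mDim_le_iff.1 h p hp

theorem DimLE.mDim_le [IsNoetherianRing R] (h : DimLE I P δ)
    (h0 : ∀ u : P, (∀ t ∈ I, t • u = 0) → u = 0) : mDim R P ≤ (δ : WithBot ℕ∞) := by
  refine mDim_le_iff.2 fun p hp => ?_
  rw [Module.support_eq_zeroLocus] at hp
  obtain ⟨q, hq, hqp⟩ := Ideal.exists_minimalPrimes_le (J := p.asIdeal) hp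
  have hass := Module.associatedPrimes.minimalPrimes_annihilator_subset_associatedPrimes R P hq
  have hIq : ¬ I ≤ q := fun hIq => by
    obtain ⟨_, f, hf⟩ := (isAssociatedPrime_iff_exists_injective_linearMap q P).1 hass
    have h1 : f 1 = 0 := h0 _ fun t ht => by
      rw [← map_smul, ← map_zero f]
      congr 1
      rw [Algebra.smul_def, mul_one]
      exact Ideal.Quotient.eq_zero_iff_mem.2 (hIq ht)
    have h2 : (1 : R ⧸ q) = 0 := hf (by rw [h1, map_zero])
    exact hq.isPrime.ne_top ((Ideal.eq_top_iff_one q).2 (Ideal.Quotient.eq_zero_iff_mem.1 h2))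
  refine (Order.coheight_anti (a := ⟨q, hq.isPrime⟩) hqp).trans (h _ ?_ hIq)
  rw [Module.support_eq_zeroLocus]
  exact hq.1.2

end Dimension

section Multiplicity

variable {R : Type u} [CommRing R] {P : Type w} [AddCommGroup P] [Module R P]

theorem mLength_H0_gradedPiece (𝔪 I : Ideal R) (n : ℕ) :
    mLength R (H0 𝔪 (gradedPiece I (M := P) n)) =
      relLength (locH 𝔪 I P n) (I ^ (n + 1) • ⊤) := by
  have h : (H0 𝔪 (gradedPiece I (M := P) n)).map (gradedPiece I (M := P) n).subtype =
      (locH 𝔪 I P n).map (I ^ (n + 1) • ⊤ : Submodule R P).mkQ := by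
    ext y
    constructor
    · rintro ⟨⟨_, u, hu, rfl⟩, hy, rfl⟩
      obtain ⟨r, hr⟩ := mem_H0.1 hy
      refine ⟨u, mem_locH.2 ⟨⟨r, fun t ht => ?_⟩, hu⟩, rfl⟩
      exact (Submodule.Quotient.mk_eq_zero _).1 (congrArg Subtype.val (hr t ht))
    · rintro ⟨u, hu, rfl⟩
      obtain ⟨⟨r, hr⟩, hu⟩ := mem_locH.1 hu
      refine ⟨⟨_, u, hu, rfl⟩, mem_H0.2 ⟨r, fun t ht => Subtype.ext ?_⟩, rfl⟩
      exact (Submodule.Quotient.mk_eq_zero _).2 (hr t ht)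
  refine (Module.length_eq_height R (H0 𝔪 (gradedPiece I (M := P) n))).symm.trans ?_
  rw [relLength, ← h]
  exact (Submodule.equivMapOfInjective _ (Submodule.injective_subtype _) _).length_eq

theorem DimLE.exists_jMult_eq [IsNoetherianRing R] [IsLocalRing R]
    [Infinite (IsLocalRing.ResidueField R)] [Module.Finite R P] {I : Ideal R} (hI : I ≠ ⊤) {e : ℕ}
    (hP : DimLE I P (e + 1)) :
    ∃ s₀ : ℕ, ∀ s, s₀ ≤ s → ∀ c : ℝ,
      GrowsLike (fun n => ((biLen (IsLocalRing.maximalIdeal R) I P n s).toNat : ℝ)) e c →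
      jMult (IsLocalRing.maximalIdeal R) I P (e + 1) = c := by
  obtain ⟨s₀, h₀⟩ := hP.exists_biLen_eq_locH_add hI
  refine ⟨s₀, fun s hs c hc => ?_⟩
  obtain ⟨C, n₀, h⟩ := h₀ s hs
  refine Tendsto.limUnder_eq ?_
  simp only [mLength_H0_gradedPiece, Nat.add_sub_cancel]
  refine hc.tendsto (n₀ := n₀) (C := C) (fun n hn => ?_) fun n hn => ?_
  · obtain ⟨e', he, _⟩ := h n hn
    rw [he, Nat.cast_le]
    exact Nat.le_add_right _ _
  · obtain ⟨e', he, hle⟩ := h n hn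
    rw [he, Nat.cast_add, add_sub_cancel_left]
    exact_mod_cast hle

end Multiplicity

/-- Lemma 3.5: for `1 ≤ i < d` and general elements `a₁, …, aᵢ` of `I`,
`dim (M/((a₁, …, aᵢ)M :_M I^∞)) ≤ d−i` and
`j_d(I, M) = j_{d−i}(I, M/((a₁, …, aᵢ)M :_M I^∞))`. -/
theorem stmt_9 {R : Type*} [CommRing R] [IsNoetherianRing R] [IsLocalRing R]
    (hdim : 0 < ringKrullDim R) (hres : Infinite (IsLocalRing.ResidueField R))
    (I : Ideal R) (hI : I ≠ ⊤)
    (M : Type*) [AddCommGroup M] [Module R M] [Module.Finite R M]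
    (d : ℕ) (hd : 0 < d) (hMd : mDim R M ≤ (d : WithBot ℕ∞))
    (i : ℕ) (hi1 : 1 ≤ i) (hid : i < d) :
    GeneralElts (IsLocalRing.maximalIdeal R) I i fun a =>
      mDim R (M ⧸ satur I (Ideal.span (Set.range a) • ⊤ : Submodule R M)) ≤
        ((d - i : ℕ) : WithBot ℕ∞) ∧
      jMult (IsLocalRing.maximalIdeal R) I M d =
        jMult (IsLocalRing.maximalIdeal R) I
          (M ⧸ satur I (Ideal.span (Set.range a) • ⊤ : Submodule R M)) (d - i) := by
  intro m x hx
  obtain ⟨F, hF, hgood⟩ := exists_goodChain (M := M) x hx i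
  refine ⟨F, hF, fun c hc => ?_⟩
  have hchain := hgood c hc
  set a : Fin i → R := fun j => ∑ l, c (j, l) * x l with ha
  obtain ⟨e, rfl⟩ : ∃ e, d = e + i + 1 := ⟨d - i - 1, by omega⟩
  rw [show e + i + 1 - i = e + 1 by omega]
  have haI : ∀ b ∈ List.ofFn a, b ∈ I := fun b hb => by
    obtain ⟨j, rfl⟩ := (List.mem_ofFn' a b).1 hb
    exact sum_mem fun l _ => I.mul_mem_left _ (hx ▸ Ideal.subset_span ⟨l, rfl⟩)
  have hset : (⊥ ⊔ Ideal.span {b | b ∈ List.ofFn a} • ⊤ : Submodule R M) =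
      Ideal.span (Set.range a) • ⊤ := by
    rw [bot_sup_eq]
    congr 2
    ext b
    exact List.mem_ofFn' a b
  let E : (M ⧸ (⊥ : Submodule R M)) ≃ₗ[R] M := Submodule.quotEquivOfEqBot ⊥ rfl
  have hM : DimLE I M (e + i + 1) := DimLE.of_mDim_le hMd
  have h1 := chain_dimLE hI (List.ofFn a) haI ⊥ hchain (e := e + 1) (by
    rw [List.length_ofFn, add_right_comm]
    exact hM.of_surjective E.symm.toLinearMap E.symm.surjective)
  rw [hset] at h1
  set K : Submodule R M := Ideal.span (Set.range a) • ⊤ with hK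
  have h2 : DimLE I (M ⧸ satur I K) (e + 1) :=
    h1.of_surjective (Submodule.factor (le_satur K)) (Submodule.factor_surjective _)
  refine ⟨h2.mDim_le fun u hu => eq_zero_of_pow_smul_eq_zero hu, ?_⟩
  obtain ⟨s₁, hs₁⟩ := hM.exists_jMult_eq hI
  obtain ⟨s₂, hs₂⟩ := h2.exists_jMult_eq hI
  obtain ⟨γ, hγ⟩ := h2.exists_growsLike hI (max s₁ s₂)
  rw [hs₂ _ (le_max_right _ _) γ hγ]
  refine hs₁ (max s₁ s₂) (le_max_left _ _) γ ?_
  have h3 : GrowsLike (fun n => ((biLen (IsLocalRing.maximalIdeal R) I (M ⧸ K) n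
      (max s₁ s₂)).toNat : ℝ)) e γ := by
    obtain ⟨n₀, h₀⟩ := exists_biLen_quotient_satur (𝔪 := IsLocalRing.maximalIdeal R) (I := I) K
    refine hγ.congr' ?_ EventuallyEq.rfl
    filter_upwards [eventually_ge_atTop n₀] with n hn
    rw [h₀ n hn]
  rw [← hset] at h3
  have h4 := chain_growsLike (List.ofFn a) haI ⊥ hchain h3
  rw [List.length_ofFn] at h4
  simpa only [biLen_eq_of_equiv E] using h4

end
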